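/- Let k be a formally real number field and let r be the number of orderings of k (equivalently, the number of real embeddings of k). Then there exist nonzero elements a_0, …, a_{r+2} and b_0, …, b_{r+2} of k such that the r + 3 fields k_{a_i, b_i} are pairwise not Witt equivalent; in particular there are at least r + 3 Witt-inequivalent fields of the form k_{a,b} with a, b ∈ kˣ. -/

import Mathlib

open MvPolynomial

noncomputable section

/-- The defining polynomial `a·x² + b·y² − 1` of the affine conic. -/
def conicPoly (k : Type*) [Field k] (a b : k) : MvPolynomial (Fin 2) k :=
  C a * X 0 ^ 2 + C b * X 1 ^ 2 - 1

/-- The coordinate ring `k[x,y]/(a·x² + b·y² − 1)` of the affine conic. -/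
abbrev ConicRing (k : Type*) [Field k] (a b : k) : Type _ :=
  MvPolynomial (Fin 2) k ⧸ Ideal.span {conicPoly k a b}

/-- `K` (together with the embedding `ι : k →+* K`) is a model of the function field
`k_{a,b}`, i.e. the quotient field of `k[x,y]/(a·x² + b·y² − 1)`. -/
def IsConicFunctionField (k : Type*) [Field k] (a b : k)
    (K : Type*) [Field K] (ι : k →+* K) : Prop :=
  ∃ f : ConicRing k a b →+* K,
    Function.Injective f ∧
    f.comp (algebraMap k (ConicRing k a b)) = ι ∧
    ∀ z : K, ∃ p q : ConicRing k a b, f q ≠ 0 ∧ z = f p / f q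

/-- The subgroup of squares in `Kˣ`. -/
def sqSubgroup (K : Type*) [Field K] : Subgroup Kˣ :=
  MonoidHom.range (powMonoidHom 2 : Kˣ →* Kˣ)

/-- The square class group `Kˣ/Kˣ²`. -/
abbrev SqClass (K : Type*) [Field K] := Kˣ ⧸ sqSubgroup K

/-- The square class of a unit. -/
def sqCl {K : Type*} [Field K] (u : Kˣ) : SqClass K := QuotientGroup.mk u

/-- `α : Kˣ/Kˣ² → Lˣ/Lˣ²` is a Witt equivalence: it sends `-1` to `-1` and preserves
binary value sets. -/
structure IsWittEquiv {K L : Type*} [Field K] [Field L]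
    (α : SqClass K ≃* SqClass L) : Prop where
  map_neg_one : α (sqCl (-1)) = sqCl (-1)
  represents : ∀ (a b c : Kˣ) (a' b' c' : Lˣ),
    α (sqCl a) = sqCl a' → α (sqCl b) = sqCl b' → α (sqCl c) = sqCl c' →
    ((∃ x y : K, (c : K) = (a : K) * x ^ 2 + (b : K) * y ^ 2) ↔
      (∃ x y : L, (c' : L) = (a' : L) * x ^ 2 + (b' : L) * y ^ 2))

/-- Two fields are Witt equivalent if there is a Witt equivalence between them. -/
def WittEquivalent (K L : Type*) [Field K] [Field L] : Prop :=
  ∃ α : SqClass K ≃* SqClass L, IsWittEquiv α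

/-- An ordering of a field `F`. -/
structure IsOrdering {F : Type*} [Field F] (P : Set F) : Prop where
  add_mem : ∀ x ∈ P, ∀ y ∈ P, x + y ∈ P
  mul_mem : ∀ x ∈ P, ∀ y ∈ P, x * y ∈ P
  total : ∀ x : F, x ∈ P ∨ -x ∈ P
  antisymm : ∀ x : F, x ∈ P → -x ∈ P → x = 0

universe u

/-- The function fields `k_{a,b}` and `k_{c,d}` are *not* Witt equivalent:
no model of `k_{a,b}` is Witt equivalent to a model of `k_{c,d}`. -/
def ConicNotWittEquivalent (k : Type u) [Field k] (a b c d : k) : Prop :=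
  ∀ (K L : Type u) [Field K] [Field L] (ι : k →+* K) (ι' : k →+* L),
    IsConicFunctionField k a b K ι → IsConicFunctionField k c d L ι' →
    ¬ WittEquivalent K L

namespace ConicWitt

section Invariants

variable {K L : Type*} [Field K] [Field L]

lemma sqCl_surjective : Function.Surjective (sqCl : Kˣ → SqClass K) :=
  QuotientGroup.mk_surjective

lemma sqCl_mul (u v : Kˣ) : sqCl (u * v) = sqCl u * sqCl v := rfl

lemma sqCl_one : sqCl (1 : Kˣ) = 1 := rfl

lemma sqCl_inv (u : Kˣ) : sqCl u⁻¹ = (sqCl u)⁻¹ := rfl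

lemma sqCl_eq_iff {u v : Kˣ} : sqCl u = sqCl v ↔ ∃ w : Kˣ, v = u * w ^ 2 := by
  unfold sqCl
  rw [QuotientGroup.eq]
  constructor
  · rintro ⟨w, hw⟩
    refine ⟨w, ?_⟩
    have : w ^ 2 = u⁻¹ * v := hw
    rw [this]; group
  · rintro ⟨w, rfl⟩
    exact ⟨w, by simp⟩

lemma sqCl_eq_one_iff {u : Kˣ} : sqCl u = 1 ↔ ∃ w : Kˣ, u = w ^ 2 := by
  rw [eq_comm, ← sqCl_one, sqCl_eq_iff]; simp

/-- The binary form with coefficients in the classes `a`, `b` represents the class `c`. -/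
def RepCl (a b c : SqClass K) : Prop :=
  ∃ u v w : Kˣ, sqCl u = a ∧ sqCl v = b ∧ sqCl w = c ∧
    ∃ x y : K, (w : K) = u * x ^ 2 + v * y ^ 2

lemma repCl_iff (u v w : Kˣ) :
    RepCl (sqCl u) (sqCl v) (sqCl w) ↔ ∃ x y : K, (w : K) = u * x ^ 2 + v * y ^ 2 := by
  constructor
  · rintro ⟨u', v', w', hu, hv, hw, x, y, h⟩
    obtain ⟨p, rfl⟩ := sqCl_eq_iff.1 hu.symm
    obtain ⟨q, rfl⟩ := sqCl_eq_iff.1 hv.symm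
    obtain ⟨r, rfl⟩ := sqCl_eq_iff.1 hw.symm
    refine ⟨p * x / r, q * y / r, ?_⟩
    have hr : (r : K) ≠ 0 := r.ne_zero
    push_cast at h
    field_simp
    linear_combination h
  · rintro ⟨x, y, h⟩
    exact ⟨u, v, w, rfl, rfl, rfl, x, y, h⟩

/-- Square classes of nonzero sums of squares, described through binary value sets. -/
inductive SSq : SqClass K → Prop
  | one : SSq 1
  | step {s t : SqClass K} : SSq s → RepCl 1 s t → SSq t

lemma SSq.isSumSq {s : SqClass K} (h : SSq s) : ∀ u : Kˣ, sqCl u = s → IsSumSq (u : K) := by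
  induction h with
  | one =>
    intro u hu
    obtain ⟨w, rfl⟩ := sqCl_eq_one_iff.1 hu
    push_cast
    rw [sq]; exact IsSumSq.mul_self _
  | @step s t _ h2 ih =>
    intro u hu
    obtain ⟨v, rfl⟩ := sqCl_surjective s
    rw [← hu, ← sqCl_one, repCl_iff] at h2
    obtain ⟨x, y, h⟩ := h2
    rw [h]
    have := ih v rfl
    simp only [Units.val_one, one_mul, sq]
    exact (IsSumSq.mul_self _).add (this.mul (IsSumSq.mul_self _))

lemma ssq_of_isSumSq {a : K} (ha : IsSumSq a) : ∀ u : Kˣ, (u : K) = a → SSq (sqCl u) := by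
  induction ha with
  | zero => intro u hu; exact absurd hu u.ne_zero
  | @sq_add a s _ ih =>
    intro u hu
    by_cases hs : s = 0
    · subst hs
      have ha0 : a ≠ 0 := by rintro rfl; simp at hu
      have : sqCl u = 1 := sqCl_eq_one_iff.2 ⟨Units.mk0 a ha0, by
        ext; simp [hu, sq]⟩
      rw [this]; exact SSq.one
    · refine SSq.step (ih (Units.mk0 s hs) rfl) ?_
      rw [← sqCl_one, repCl_iff]
      exact ⟨a, 1, by simp [hu, sq]⟩

lemma ssq_iff (u : Kˣ) : SSq (sqCl u) ↔ IsSumSq (u : K) :=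
  ⟨fun h => h.isSumSq u rfl, fun h => ssq_of_isSumSq h u rfl⟩

/-- The subgroup generated by the elements of `H` represented by `⟨1, x⟩` for some `x ∉ H`. -/
def binGen (H : Subgroup (SqClass K)) : Subgroup (SqClass K) :=
  Subgroup.closure {t | t ∈ H ∧ ∃ x, x ∉ H ∧ RepCl 1 x t}

/-- Subgroups of index two in the square class group which behave like the group of units of a
real, non-exceptional discrete valuation. -/
structure IsGood (H : Subgroup (SqClass K)) : Prop where
  ne_top : H ≠ ⊤
  mul_mem_of_notMem : ∀ x y, x ∉ H → y ∉ H → x * y ∈ H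
  neg_one_mem : sqCl (-1) ∈ H
  not_ssq : ∀ t ∈ binGen H, ¬ SSq (sqCl (-1) * t)
  exists_rep : ∃ h, RepCl 1 1 h ∧ h ∉ binGen H ∧ sqCl (-1) * h ∉ binGen H

/-- The intersection of all good subgroups. -/
def goodInf (K : Type*) [Field K] : Subgroup (SqClass K) := sInf {H | IsGood H}

/-- Some good subgroup is generated by `goodInf` and its own binary elements. -/
def HasSplitPlace (K : Type*) [Field K] : Prop :=
  ∃ H : Subgroup (SqClass K), IsGood H ∧ H ≤ goodInf K ⊔ binGen H

/-- There are `n` elements of `goodInf` which are independent modulo sums of squares. -/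
def HasIndep (K : Type*) [Field K] (n : ℕ) : Prop :=
  ∃ e : Fin n → SqClass K, (∀ i, e i ∈ goodInf K) ∧
    ∀ s : Finset (Fin n), s.Nonempty → ¬ SSq (∏ i ∈ s, e i)

variable {α : SqClass K ≃* SqClass L}

lemma _root_.IsWittEquiv.symm (hα : IsWittEquiv α) : IsWittEquiv α.symm where
  map_neg_one := by rw [← hα.map_neg_one]; simp
  represents a b c a' b' c' ha hb hc :=
    (hα.represents a' b' c' a b c (by simp [← ha]) (by simp [← hb]) (by simp [← hc])).symm

lemma _root_.IsWittEquiv.repCl (hα : IsWittEquiv α) {a b c : SqClass K} :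
    RepCl (α a) (α b) (α c) ↔ RepCl a b c := by
  obtain ⟨u, rfl⟩ := sqCl_surjective a
  obtain ⟨v, rfl⟩ := sqCl_surjective b
  obtain ⟨w, rfl⟩ := sqCl_surjective c
  obtain ⟨u', hu⟩ := sqCl_surjective (α (sqCl u))
  obtain ⟨v', hv⟩ := sqCl_surjective (α (sqCl v))
  obtain ⟨w', hw⟩ := sqCl_surjective (α (sqCl w))
  rw [← hu, ← hv, ← hw, repCl_iff, repCl_iff]
  exact (hα.represents u v w u' v' w' hu.symm hv.symm hw.symm).symm

lemma _root_.IsWittEquiv.ssq (hα : IsWittEquiv α) {s : SqClass K} (h : SSq s) : SSq (α s) := by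
  induction h with
  | one => rw [map_one]; exact SSq.one
  | step _ h ih => exact SSq.step ih (by rw [← map_one α]; exact hα.repCl.2 h)

lemma _root_.IsWittEquiv.ssq_iff (hα : IsWittEquiv α) {s : SqClass K} : SSq (α s) ↔ SSq s :=
  ⟨fun h => by simpa using hα.symm.ssq h, hα.ssq⟩

lemma mem_map_equiv {H : Subgroup (SqClass K)} {x : SqClass K} :
    α x ∈ H.map α.toMonoidHom ↔ x ∈ H := by
  rw [Subgroup.mem_map]
  exact ⟨fun ⟨y, hy, h⟩ => by rwa [← α.injective h], fun h => ⟨x, h, rfl⟩⟩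

lemma _root_.IsWittEquiv.binGen_map (hα : IsWittEquiv α) (H : Subgroup (SqClass K)) :
    binGen (H.map α.toMonoidHom) = (binGen H).map α.toMonoidHom := by
  unfold binGen
  rw [MonoidHom.map_closure]
  congr 1
  ext t
  obtain ⟨t, rfl⟩ := α.surjective t
  simp only [Set.mem_ofPred_eq, Set.mem_image, mem_map_equiv]
  constructor
  · rintro ⟨ht, x, hx, h⟩
    obtain ⟨x, rfl⟩ := α.surjective x
    rw [mem_map_equiv] at hx
    rw [← map_one α, hα.repCl] at h
    exact ⟨t, ⟨ht, x, hx, h⟩, rfl⟩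
  · rintro ⟨s, ⟨ht, x, hx, h⟩, hs⟩
    obtain rfl := α.injective hs
    refine ⟨ht, α x, ?_, ?_⟩
    · rwa [mem_map_equiv]
    · rwa [← map_one α, hα.repCl]

lemma _root_.IsWittEquiv.isGood_map (hα : IsWittEquiv α) {H : Subgroup (SqClass K)}
    (hH : IsGood H) : IsGood (H.map α.toMonoidHom) where
  ne_top h := by
    apply hH.ne_top
    rw [Subgroup.eq_top_iff']
    intro x
    rw [← mem_map_equiv (α := α), h]
    trivial
  mul_mem_of_notMem x y hx hy := by
    obtain ⟨x, rfl⟩ := α.surjective x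
    obtain ⟨y, rfl⟩ := α.surjective y
    rw [mem_map_equiv] at hx hy
    rw [← map_mul, mem_map_equiv]
    exact hH.mul_mem_of_notMem x y hx hy
  neg_one_mem := by
    rw [← hα.map_neg_one, mem_map_equiv]; exact hH.neg_one_mem
  not_ssq t ht := by
    obtain ⟨t, rfl⟩ := α.surjective t
    rw [hα.binGen_map, mem_map_equiv] at ht
    rw [← hα.map_neg_one, ← map_mul, hα.ssq_iff]
    exact hH.not_ssq t ht
  exists_rep := by
    obtain ⟨h, h1, h2, h3⟩ := hH.exists_rep
    refine ⟨α h, ?_, ?_, ?_⟩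
    · rw [← hα.repCl, map_one] at h1; exact h1
    · rwa [hα.binGen_map, mem_map_equiv]
    · rwa [hα.binGen_map, ← hα.map_neg_one, ← map_mul, mem_map_equiv]

lemma _root_.IsWittEquiv.mem_goodInf (hα : IsWittEquiv α) {x : SqClass K}
    (hx : x ∈ goodInf K) : α x ∈ goodInf L := by
  unfold goodInf at *
  rw [Subgroup.mem_sInf] at *
  intro H hH
  have := hx _ (hα.symm.isGood_map hH)
  rw [← mem_map_equiv (α := α.symm)]
  simpa using this

lemma _root_.IsWittEquiv.hasSplitPlace (hα : IsWittEquiv α) (h : HasSplitPlace K) :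
    HasSplitPlace L := by
  obtain ⟨H, hH, h⟩ := h
  refine ⟨_, hα.isGood_map hH, ?_⟩
  refine (Subgroup.map_mono h).trans ?_
  rw [Subgroup.map_sup, hα.binGen_map]
  refine sup_le_sup_right ?_ _
  rintro _ ⟨x, hx, rfl⟩
  exact hα.mem_goodInf hx

lemma _root_.IsWittEquiv.hasIndep (hα : IsWittEquiv α) {n : ℕ} (h : HasIndep K n) :
    HasIndep L n := by
  obtain ⟨e, h1, h2⟩ := h
  refine ⟨fun i => α (e i), fun i => hα.mem_goodInf (h1 i), fun s hs => ?_⟩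
  rw [← map_prod, hα.ssq_iff]
  exact h2 s hs

end Invariants

/-- Multiplicative groups `T ≤ H` of a field, with `H` of index two containing `-1`, such that the
elements outside `H` are `T`-rigid and `T` is non-exceptional. -/
structure RigidPair {K : Type*} [Field K] (T H : Set K) : Prop where
  zero_notMem : (0 : K) ∉ H
  le : ∀ {x}, x ∈ T → x ∈ H
  T_mul : ∀ {x y}, x ∈ T → y ∈ T → x * y ∈ T
  T_sq : ∀ {x : K}, x ≠ 0 → x * x ∈ T
  H_mul : ∀ {x y}, x ∈ H → y ∈ H → x * y ∈ H
  odd_mul : ∀ {x y : K}, x ≠ 0 → y ≠ 0 → x ∉ H → y ∉ H → x * y ∈ H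
  H_neg_one : (-1 : K) ∈ H
  neg_one : (-1 : K) ∉ T
  key : ∀ {x : K}, x ≠ 0 → x ∉ H → 1 + x ∈ T ∨ ∃ t ∈ T, 1 + x = x * t
  exc : ∃ t ∈ T, 1 + t ∉ T ∧ -(1 + t) ∉ T

namespace RigidPair

variable {K : Type*} [Field K] {T H : Set K} (R : RigidPair T H)
include R

lemma H_ne {x : K} (h : x ∈ H) : x ≠ 0 := by rintro rfl; exact R.zero_notMem h
lemma T_ne {x : K} (h : x ∈ T) : x ≠ 0 := R.H_ne (R.le h)

lemma T_one : (1 : K) ∈ T := by simpa using R.T_sq (one_ne_zero (α := K))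

lemma T_inv {x : K} (h : x ∈ T) : x⁻¹ ∈ T := by
  have h0 := R.T_ne h
  have := R.T_mul h (R.T_sq (inv_ne_zero h0))
  rwa [mul_inv_cancel_left₀ h0] at this

lemma T_div {x y : K} (h : x ∈ T) (h' : y ∈ T) : x / y ∈ T := by
  rw [div_eq_mul_inv]; exact R.T_mul h (R.T_inv h')

lemma H_inv {x : K} (h : x ∈ H) : x⁻¹ ∈ H := by
  have h0 := R.H_ne h
  have := R.H_mul h (R.le (R.T_sq (inv_ne_zero h0)))
  rwa [mul_inv_cancel_left₀ h0] at this

lemma H_div {x y : K} (h : x ∈ H) (h' : y ∈ H) : x / y ∈ H := by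
  rw [div_eq_mul_inv]; exact R.H_mul h (R.H_inv h')

lemma H_neg {x : K} (h : x ∈ H) : -x ∈ H := by
  have := R.H_mul R.H_neg_one h
  rwa [neg_one_mul] at this

lemma neg_mem_H {x : K} : -x ∈ H ↔ x ∈ H :=
  ⟨fun h => by simpa using R.H_neg h, R.H_neg⟩

lemma inv_mem_H {x : K} : x⁻¹ ∈ H ↔ x ∈ H :=
  ⟨fun h => by simpa using R.H_inv h, R.H_inv⟩

lemma mul_mem_H_left {x y : K} (hy : y ∈ H) : y * x ∈ H ↔ x ∈ H := by
  refine ⟨fun h => ?_, R.H_mul hy⟩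
  have := R.H_mul (R.H_inv hy) h
  rwa [inv_mul_cancel_left₀ (R.H_ne hy)] at this

lemma mul_mem_H_right {x y : K} (hy : y ∈ H) : x * y ∈ H ↔ x ∈ H := by
  rw [mul_comm, R.mul_mem_H_left hy]

lemma mul_mem_T_left {x y : K} (hy : y ∈ T) : y * x ∈ T ↔ x ∈ T := by
  refine ⟨fun h => ?_, R.T_mul hy⟩
  have := R.T_mul (R.T_inv hy) h
  rwa [inv_mul_cancel_left₀ (R.T_ne hy)] at this

lemma inv_mem_T {x : K} : x⁻¹ ∈ T ↔ x ∈ T :=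
  ⟨fun h => by simpa using R.T_inv h, R.T_inv⟩

lemma not_neg {x : K} (h : x ∈ T) (h' : -x ∈ T) : False := by
  refine R.neg_one ?_
  have := R.T_div h' h
  rwa [neg_div, div_self (R.T_ne h)] at this

/-- Elements of positive value outside `H`. -/
def _root_.ConicWitt.OddPos (T H : Set K) (x : K) : Prop := x ≠ 0 ∧ x ∉ H ∧ 1 + x ∈ T

lemma oddPos_or {x : K} (h0 : x ≠ 0) (h : x ∉ H) : OddPos T H x ∨ OddPos T H x⁻¹ := by
  rcases R.key h0 h with h1 | ⟨t, ht, h1⟩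
  · exact Or.inl ⟨h0, h, h1⟩
  · refine Or.inr ⟨inv_ne_zero h0, by rwa [R.inv_mem_H], ?_⟩
    convert ht using 1
    field_simp
    linear_combination h1

lemma not_oddPos_inv {x : K} (h : OddPos T H x) : ¬ OddPos T H x⁻¹ := by
  rintro ⟨_, _, h3⟩
  apply h.2.1
  have := R.T_div h.2.2 h3
  have h1 := h.1
  have h4 := R.T_ne h3
  have h5 := R.T_ne h.2.2
  convert R.le this using 1
  field_simp
  have : x + 1 ≠ 0 := by rwa [add_comm]
  field_simp
  ring

lemma one_add_mem_H {g : K} (hg : g ∈ H) (h : -g ∉ T) : 1 + g ∈ H := by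
  by_contra hx
  have h0 : 1 + g ≠ 0 := by
    intro h0
    apply h
    rw [show -g = 1 by linear_combination -h0]
    exact R.T_one
  rcases R.key (neg_ne_zero.2 h0) (by rwa [R.neg_mem_H]) with h1 | ⟨t, ht, h1⟩
  · exact h (by convert h1 using 1; ring)
  · have h2 : -(1 + g) * t ∈ H := by
      rw [← h1]; convert R.H_neg hg using 1; ring
    rw [R.mul_mem_H_right (R.le ht), R.neg_mem_H] at h2
    exact hx h2

/-- A rigid sum `p + q` lies in `p T ∪ q T`. -/
lemma add_mem_or {p q : K} (hp : p ≠ 0) (hq : q ≠ 0) (h : q / p ∉ H) :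
    (∃ t ∈ T, p + q = p * t) ∨ ∃ t ∈ T, p + q = q * t := by
  rcases R.key (div_ne_zero hq hp) h with h1 | ⟨t, ht, h1⟩
  · exact Or.inl ⟨_, h1, by field_simp⟩
  · refine Or.inr ⟨t, ht, ?_⟩
    field_simp at h1
    linear_combination h1

lemma oddPos_neg {x : K} (hx : OddPos T H x) : OddPos T H (-x) := by
  obtain ⟨hx0, hxH, hx1⟩ := hx
  refine ⟨neg_ne_zero.2 hx0, by rwa [R.neg_mem_H], ?_⟩
  rcases R.key (neg_ne_zero.2 hx0) (by rwa [R.neg_mem_H]) with h | ⟨t2, ht2, h2⟩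
  · exact h
  exfalso
  obtain ⟨t0, ht0, hh, hh'⟩ := R.exc
  have hH : 1 + t0 ∈ H := R.one_add_mem_H (R.le ht0) fun h => R.not_neg ht0 h
  obtain ⟨h0, hh0⟩ : ∃ h0, h0 = 1 + t0 := ⟨_, rfl⟩
  rw [← hh0] at hh hh' hH
  have hne := R.H_ne hH
  have ht0ne := R.T_ne ht0
  have ht2ne := R.T_ne ht2
  set g : K := -t0 / h0 with hg
  have hgH : g ∈ H := R.H_div (R.H_neg (R.le ht0)) hH
  have hgne := R.H_ne hgH
  have hgx : g * x ∉ H := by rwa [R.mul_mem_H_left hgH]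
  have hgxne : g * x ≠ 0 := mul_ne_zero hgne hx0
  have hg1 : g = 1 / h0 - 1 := by rw [hg, hh0]; rw [hh0] at hne; field_simp; ring
  have e1 : 1 + g * x = x * (-t2 * (1 + -1 / (h0 * t2))) := by
    rw [hg1]; field_simp; linear_combination h0 * h2
  have hA : 1 + -1 / (h0 * t2) ∈ H := by
    refine R.one_add_mem_H (R.H_div R.H_neg_one (R.H_mul hH (R.le ht2))) fun h => hh ?_
    have := R.T_inv (R.T_mul h ht2)
    convert this using 1
    field_simp
  have hA' : 1 + g * x ∉ H := by
    rw [e1, R.mul_mem_H_right (R.H_mul (R.H_neg (R.le ht2)) hA)]; exact hxH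
  obtain ⟨t3, ht3, h3⟩ : ∃ t ∈ T, 1 + g * x = g * x * t := by
    rcases R.key hgxne hgx with h | h
    · exact absurd (R.le h) hA'
    · exact h
  have hB : 1 + g * t3 ∈ H := by
    refine R.one_add_mem_H (R.H_mul hgH (R.le ht3)) fun h => hh ?_
    have := R.T_div (R.T_mul ht0 ht3) h
    convert this using 1
    have := R.T_ne ht3
    rw [hg]; field_simp
  have hB' : 1 + x + g * x ∉ H := by
    rw [show 1 + x + g * x = x * (1 + g * t3) by linear_combination h3,
      R.mul_mem_H_right hB]
    exact hxH
  obtain ⟨t4, ht4, h4⟩ : ∃ t ∈ T, 1 + x + g * x = g * x * t := by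
    rcases R.add_mem_or (R.T_ne hx1) hgxne (by
      rw [div_eq_mul_inv, R.mul_mem_H_right (R.H_inv (R.le hx1))]; exact hgx) with ⟨t, ht, h⟩ | h
    · rw [h] at hB'; exact absurd (R.H_mul (R.le hx1) (R.le ht)) hB'
    · exact h
  obtain ⟨t5, ht5, h5⟩ : ∃ t ∈ T, 1 + x / h0 = x / h0 * t := by
    rcases R.key (div_ne_zero hx0 hne) (by
      rw [div_eq_mul_inv, R.mul_mem_H_right (R.H_inv hH)]; exact hxH) with h | h
    · refine absurd (R.le h) ?_
      convert hB' using 2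
      rw [hg1]; field_simp; ring
    · exact h
  refine R.not_neg ht5 ?_
  have : -t5 = t0 * t4 := by
    have e : x * (-t0 * t4) = x * t5 := by
      have h6 : 1 + x + g * x = 1 + x / h0 := by rw [hg1]; field_simp; ring
      have h7 : g * x * t4 = x / h0 * t5 := by rw [← h4, ← h5, h6]
      rw [hg] at h7; field_simp at h7; linear_combination x * h7
    linear_combination mul_left_cancel₀ hx0 e
  rw [this]; exact R.T_mul ht0 ht4

lemma one_sub_mem {x : K} (hx : OddPos T H x) : 1 - x ∈ T := by
  have := (R.oddPos_neg hx).2.2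
  rwa [← sub_eq_add_neg] at this

lemma one_sub_mul_mem {x y : K} (hx : OddPos T H x) (hy : OddPos T H y) : 1 - x * y ∈ T := by
  have hx0 := hx.1
  have h1 : (∃ t ∈ T, 1 - x * y = t) ∨ (∃ t ∈ T, 1 - x * y = -x * t) := by
    have hz : x * (1 + y) ∉ H := by rw [R.mul_mem_H_right (R.le hy.2.2)]; exact hx.2.1
    rcases R.add_mem_or (p := 1 + x) (q := -(x * (1 + y))) (R.T_ne hx.2.2)
      (neg_ne_zero.2 (mul_ne_zero hx0 (R.T_ne hy.2.2))) (by
      rw [div_eq_mul_inv, R.mul_mem_H_right (R.H_inv (R.le hx.2.2)), R.neg_mem_H]; exact hz) with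
      ⟨t, ht, h⟩ | ⟨t, ht, h⟩
    · exact Or.inl ⟨_, R.T_mul hx.2.2 ht, by linear_combination h⟩
    · exact Or.inr ⟨_, R.T_mul hy.2.2 ht, by linear_combination h⟩
  have h2 : (∃ t ∈ T, 1 - x * y = t) ∨ (∃ t ∈ T, 1 - x * y = x * t) := by
    have hx1 := R.one_sub_mem hx
    have hy1 := R.one_sub_mem hy
    have hz : x * (1 - y) ∉ H := by rw [R.mul_mem_H_right (R.le hy1)]; exact hx.2.1
    rcases R.add_mem_or (p := 1 - x) (q := x * (1 - y)) (R.T_ne hx1)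
      (mul_ne_zero hx0 (R.T_ne hy1)) (by
      rw [div_eq_mul_inv, R.mul_mem_H_right (R.H_inv (R.le hx1))]; exact hz) with
      ⟨t, ht, h⟩ | ⟨t, ht, h⟩
    · exact Or.inl ⟨_, R.T_mul hx1 ht, by linear_combination h⟩
    · exact Or.inr ⟨_, R.T_mul hy1 ht, by linear_combination h⟩
  rcases h1 with ⟨t, ht, h⟩ | ⟨t, ht, h⟩
  · rwa [h]
  rcases h2 with ⟨s, hs, h'⟩ | ⟨s, hs, h'⟩
  · rwa [h']
  exfalso
  have : -t = s := mul_left_cancel₀ hx0 (by linear_combination h' - h)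
  exact R.not_neg ht (this ▸ hs)

lemma one_add_mul_mem {x y : K} (hx : OddPos T H x) (hy : OddPos T H y) : 1 + x * y ∈ T := by
  have := R.one_sub_mul_mem hx (R.oddPos_neg hy)
  convert this using 1; ring

lemma oddPos_mul {x y z : K} (hx : OddPos T H x) (hy : OddPos T H y) (hz : OddPos T H z) :
    OddPos T H (x * y * z) := by
  have hx0 := hx.1
  have hy0 := hy.1
  have hz0 := hz.1
  have hxy : x * y ∈ H := R.odd_mul hx0 hy0 hx.2.1 hy.2.1
  have hxy0 := mul_ne_zero hx0 hy0
  have hodd : x * y * z ∉ H := by rw [R.mul_mem_H_left hxy]; exact hz.2.1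
  rcases R.oddPos_or (mul_ne_zero hxy0 hz0) hodd with h | h
  · exact h
  exfalso
  have e : z * (x * y * z)⁻¹ = (x * y)⁻¹ := by field_simp
  have a1 := R.one_add_mul_mem hz h
  have a2 := R.one_sub_mul_mem hz h
  rw [e] at a1 a2
  have b1 := R.one_add_mul_mem hx hy
  have b2 := R.one_sub_mul_mem hx hy
  have c1 : x * y ∈ T := by
    convert R.T_div b1 a1 using 1
    have := R.T_ne b1
    have : x * y + 1 ≠ 0 := by rwa [add_comm]
    field_simp
    ring
  refine R.not_neg c1 ?_
  convert R.T_div b2 a2 using 1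
  have h1 := R.T_ne b2
  have h2 : x * y - 1 ≠ 0 := by
    intro h; apply h1; linear_combination -h
  field_simp
  ring

/-- Elements of `H` of nonnegative value. -/
def _root_.ConicWitt.EvenNonneg (T H : Set K) (h : K) : Prop :=
  h ∈ H ∧ ∀ x, OddPos T H x → OddPos T H (h * x)

lemma evenNonneg_of_not {h x : K} (hh : h ∈ H) (hx : OddPos T H x) (hhx : ¬ OddPos T H (h * x)) :
    EvenNonneg T H h⁻¹ ∧ OddPos T H (h * x)⁻¹ := by
  have hne := R.H_ne hh
  have hodd : h * x ∉ H := by rw [R.mul_mem_H_left hh]; exact hx.2.1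
  have h1 := (R.oddPos_or (mul_ne_zero hne hx.1) hodd).resolve_left hhx
  refine ⟨⟨R.H_inv hh, fun y hy => ?_⟩, h1⟩
  have := R.oddPos_mul hy hx h1
  convert this using 1
  have := hx.1
  field_simp

lemma evenNonneg_or {h : K} (hh : h ∈ H) : EvenNonneg T H h ∨ EvenNonneg T H h⁻¹ := by
  by_cases hc : ∀ x, OddPos T H x → OddPos T H (h * x)
  · exact Or.inl ⟨hh, hc⟩
  · push Not at hc
    obtain ⟨x, hx, hhx⟩ := hc
    exact Or.inr (R.evenNonneg_of_not hh hx hhx).1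

/-- An element `h` with `1 / h` not of nonnegative value is a product of two odd positive ones. -/
lemma exists_mul_of_not {h : K} (hh : h ∈ H) (hn : ¬ EvenNonneg T H h⁻¹) :
    ∃ x y, OddPos T H x ∧ OddPos T H y ∧ h = x * y := by
  unfold EvenNonneg at hn
  push Not at hn
  obtain ⟨x, hx, hhx⟩ := hn (R.H_inv hh)
  have := (R.evenNonneg_of_not (R.H_inv hh) hx hhx).2
  refine ⟨_, _, hx, this, ?_⟩
  have := hx.1
  have := R.H_ne hh
  field_simp

lemma oddPos_add {r s : K} (hr : OddPos T H r) (hs : OddPos T H s) (h1 : r / s ∉ T)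
    (h2 : -(r / s) ∉ T) : OddPos T H (r + s) := by
  have hr0 := hr.1
  have hs0 := hs.1
  have hrs : r / s ∈ H := by
    rw [div_eq_mul_inv]
    exact R.odd_mul hr0 (inv_ne_zero hs0) hr.2.1 (by rw [R.inv_mem_H]; exact hs.2.1)
  have e : r + s = s * (1 + r / s) := by field_simp; ring
  have hH : 1 + r / s ∈ H := R.one_add_mem_H hrs h2
  have hodd : r + s ∉ H := by rw [e, R.mul_mem_H_right hH]; exact hs.2.1
  have hne : r + s ≠ 0 := by rw [e]; exact mul_ne_zero hs0 (R.H_ne hH)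
  refine ⟨hne, hodd, ?_⟩
  have aux : ∀ r s : K, OddPos T H r → OddPos T H s → s / (1 + r) ∉ H →
      1 + (r + s) ∈ T ∨ ∃ t ∈ T, 1 + (r + s) = s * t := by
    intro r s hr hs h
    rcases R.add_mem_or (R.T_ne hr.2.2) hs.1 h with ⟨t, ht, h⟩ | ⟨t, ht, h⟩
    · left
      rw [← add_assoc, h]
      exact R.T_mul hr.2.2 ht
    · exact Or.inr ⟨t, ht, by rw [← h]; ring⟩
  have hnot : ∀ r s : K, OddPos T H r → OddPos T H s → s / (1 + r) ∉ H := by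
    intro r s hr hs
    rw [div_eq_mul_inv, R.mul_mem_H_right (R.H_inv (R.le hr.2.2))]; exact hs.2.1
  rcases aux r s hr hs (hnot r s hr hs) with h | ⟨t, ht, h⟩
  · exact h
  rcases aux s r hs hr (hnot s r hs hr) with h' | ⟨t', ht', h'⟩
  · rwa [add_comm r s]
  exfalso
  apply h1
  have e2 : s * t = r * t' := by rw [← h, ← h']; ring
  convert R.T_div ht ht' using 1
  have := R.T_ne ht'
  field_simp
  linear_combination -e2

lemma exists_unit : ∃ t ∈ T, 1 + t ∉ T ∧ -(1 + t) ∉ T ∧ EvenNonneg T H (1 + t)⁻¹ := by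
  obtain ⟨t0, ht0, hh, hh'⟩ := R.exc
  have hH : 1 + t0 ∈ H := R.one_add_mem_H (R.le ht0) fun h => R.not_neg ht0 h
  refine ⟨t0, ht0, hh, hh', ?_⟩
  by_contra hn
  obtain ⟨x, y, hx, hy, h⟩ := R.exists_mul_of_not hH hn
  have := R.one_sub_mul_mem hx hy
  rw [← h] at this
  exact R.not_neg ht0 (by convert this using 1; ring)

lemma one_add_mul_oddPos_of_oddPos {x y : K} (hx : OddPos T H x) (hy : OddPos T H y) :
    OddPos T H ((1 + x) * y) := by
  by_contra hn
  have h1 := (R.evenNonneg_of_not (R.le hx.2.2) hy hn).2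
  have h2 := R.one_sub_mul_mem h1 hy
  have h3 := R.T_ne hx.2.2
  have hy0 := hy.1
  apply hx.2.1
  have := R.T_mul h2 hx.2.2
  convert R.le this using 1
  field_simp
  ring

lemma one_add_mul_oddPos_of_evenNonneg {x y : K} (hx : EvenNonneg T H x) (h1x : 1 + x ∈ H)
    (hy : OddPos T H y) : OddPos T H ((1 + x) * y) := by
  by_contra hn
  have hq := (R.evenNonneg_of_not h1x hy hn).2
  have hp' := hx.2 y hy
  have hxne := R.H_ne hx.1
  have hyne := hy.1
  have h1ne := R.H_ne h1x
  have h1T : 1 + x ∈ T := by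
    have := R.one_sub_mul_mem hp' hq
    rw [← R.inv_mem_T]
    convert this using 1
    field_simp
    ring
  by_cases hc : x ∈ T ∨ -x ∈ T
  · obtain ⟨t, ht, hu, hu', hE⟩ := R.exists_unit
    set h := (1 + t)⁻¹ with hh
    have hne : h ≠ 0 := R.H_ne hE.1
    have hi : h⁻¹ = 1 + t := by rw [hh, inv_inv]
    have htne := R.T_ne ht
    have a1 : h⁻¹ ∉ T := by rwa [hi]
    have a2 : -h⁻¹ ∉ T := by rwa [hi]
    have e1 : 1 - h = t * h := by
      have : h * (1 + t) = 1 := by rw [← hi]; field_simp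
      linear_combination -this
    have b1 : OddPos T H ((1 - h) * y) := by
      have := R.oddPos_add hy (R.oddPos_neg (hE.2 y hy))
        (by convert a2 using 2; field_simp) (by convert a1 using 2; field_simp)
      convert this using 1; ring
    have hne1 : 1 - h ≠ 0 := by rw [e1]; exact mul_ne_zero htne hne
    have key : ∀ z, z ∈ T → z / (1 - h) ∉ T ∧ -(z / (1 - h)) ∉ T := by
      intro z hz
      have hzne := R.T_ne hz
      constructor
      · intro hc
        apply a1
        convert R.T_mul (R.T_div hc hz) ht using 1
        rw [e1]; field_simp
      · intro hc
        apply a2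
        convert R.T_mul (R.T_div hc hz) ht using 1
        rw [e1]; field_simp
    have hk : x / (1 - h) ∉ T ∧ -(x / (1 - h)) ∉ T := by
      rcases hc with hc | hc
      · exact key x hc
      · have := key (-x) hc
        rw [neg_div, neg_neg] at this
        exact this.symm
    have b2 : OddPos T H (x * y + (1 - h) * y) := by
      have e : x * y / ((1 - h) * y) = x / (1 - h) := by field_simp
      exact R.oddPos_add hp' b1 (by rw [e]; exact hk.1) (by rw [e]; exact hk.2)
    have b3 : 1 - ((1 + x) * y)⁻¹ * (h * y) ∈ T := R.one_sub_mul_mem hq (hE.2 y hy)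
    set s := 1 - ((1 + x) * y)⁻¹ * (h * y) with hs
    have hsne := R.T_ne b3
    have e2 : x * y + (1 - h) * y = (1 + x) * y * s := by rw [hs]; field_simp; ring
    have e3 : (x * y + (1 - h) * y) / (h * y) = ((1 + x) * s) * h⁻¹ := by
      rw [e2]; field_simp
    have b4 := R.oddPos_add b2 (hE.2 y hy)
      (by rw [e3, R.mul_mem_T_left (R.T_mul h1T b3)]; exact a1)
      (by rw [e3, ← mul_neg, R.mul_mem_T_left (R.T_mul h1T b3)]; exact a2)
    apply hn
    convert b4 using 1
    ring
  · push Not at hc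
    have e : x * y / y = x := by field_simp
    have := R.oddPos_add hp' hy (by rw [e]; exact hc.1) (by rw [e]; exact hc.2)
    apply hn
    convert this using 1
    ring

/-- Membership in the valuation ring attached to a rigid pair. -/
def _root_.ConicWitt.IsRigidInt (T H : Set K) (x : K) : Prop :=
  x = 0 ∨ OddPos T H x ∨ EvenNonneg T H x

lemma isRigidInt_mul {x y : K} (hx : IsRigidInt T H x) (hy : IsRigidInt T H y) :
    IsRigidInt T H (x * y) := by
  rcases hx with rfl | hx | hx
  · left; simp
  · rcases hy with rfl | hy | hy
    · left; simp
    · exact Or.inr (Or.inr ⟨R.odd_mul hx.1 hy.1 hx.2.1 hy.2.1, fun z hz => R.oddPos_mul hx hy hz⟩)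
    · right; left; rw [mul_comm]; exact hy.2 _ hx
  · rcases hy with rfl | hy | hy
    · left; simp
    · exact Or.inr (Or.inl (hx.2 _ hy))
    · refine Or.inr (Or.inr ⟨R.H_mul hx.1 hy.1, fun z hz => ?_⟩)
      rw [mul_assoc]
      exact hx.2 _ (hy.2 _ hz)

lemma isRigidInt_or_inv (x : K) : IsRigidInt T H x ∨ IsRigidInt T H x⁻¹ := by
  by_cases h0 : x = 0
  · exact Or.inl (Or.inl h0)
  by_cases hH : x ∈ H
  · exact (R.evenNonneg_or hH).imp (fun h => Or.inr (Or.inr h)) (fun h => Or.inr (Or.inr h))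
  · exact (R.oddPos_or h0 hH).imp (fun h => Or.inr (Or.inl h)) (fun h => Or.inr (Or.inl h))

lemma isRigidInt_one : IsRigidInt T H (1 : K) :=
  Or.inr (Or.inr ⟨R.le R.T_one, fun x hx => by rwa [one_mul]⟩)

lemma isRigidInt_neg_one : IsRigidInt T H (-1 : K) :=
  Or.inr (Or.inr ⟨R.H_neg_one, fun x hx => by rw [neg_one_mul]; exact R.oddPos_neg hx⟩)

lemma isRigidInt_one_add {x : K} (hx : IsRigidInt T H x) : IsRigidInt T H (1 + x) := by
  rcases hx with rfl | hx | hx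
  · rw [add_zero]; exact R.isRigidInt_one
  · exact Or.inr (Or.inr ⟨R.le hx.2.2, fun y hy => R.one_add_mul_oddPos_of_oddPos hx hy⟩)
  · by_cases h0 : 1 + x = 0
    · exact Or.inl h0
    by_cases h1 : 1 + x ∈ H
    · exact Or.inr (Or.inr ⟨h1, fun y hy => R.one_add_mul_oddPos_of_evenNonneg hx h1 hy⟩)
    · refine Or.inr (Or.inl ((R.oddPos_or h0 h1).resolve_right fun hz => ?_))
      have h2 := hx.2 _ hz
      apply h2.2.1
      have := R.one_sub_mem hz
      convert R.le this using 1
      field_simp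
      ring

lemma isRigidInt_add {x y : K} (hx : IsRigidInt T H x) (hy : IsRigidInt T H y) :
    IsRigidInt T H (x + y) := by
  by_cases hx0 : x = 0
  · rwa [hx0, zero_add]
  by_cases hy0 : y = 0
  · rwa [hy0, add_zero]
  rcases R.isRigidInt_or_inv (y / x) with h | h
  · rw [show x + y = x * (1 + y / x) by field_simp]
    exact R.isRigidInt_mul hx (R.isRigidInt_one_add h)
  · rw [show x + y = y * (1 + (y / x)⁻¹) by field_simp; ring]
    exact R.isRigidInt_mul hy (R.isRigidInt_one_add h)

/-- The valuation ring attached to a rigid pair. -/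
def valRing : ValuationSubring K where
  carrier := {x | IsRigidInt T H x}
  mul_mem' := R.isRigidInt_mul
  one_mem' := R.isRigidInt_one
  add_mem' := R.isRigidInt_add
  zero_mem' := Or.inl rfl
  neg_mem' {x} hx := by
    have := R.isRigidInt_mul R.isRigidInt_neg_one hx
    rwa [neg_one_mul] at this
  mem_or_inv_mem' := R.isRigidInt_or_inv

lemma mem_valRing {x : K} : x ∈ R.valRing ↔ IsRigidInt T H x := Iff.rfl

lemma mem_H_of_unit {x : K} (h0 : x ≠ 0) (hx : x ∈ R.valRing) (hx' : x⁻¹ ∈ R.valRing) :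
    x ∈ H := by
  by_contra hH
  rw [mem_valRing] at hx hx'
  have h1 : OddPos T H x := by
    rcases hx with h | h | h
    · exact absurd h h0
    · exact h
    · exact absurd h.1 hH
  have h2 : OddPos T H x⁻¹ := by
    rcases hx' with h | h | h
    · exact absurd h (inv_ne_zero h0)
    · exact h
    · exact absurd h.1 (by rwa [R.inv_mem_H])
  exact R.not_oddPos_inv h1 h2

lemma one_add_mem_of_nonunit {x : K} (hx : x⁻¹ ∉ R.valRing) : 1 + x ∈ T := by
  have h1 := (R.isRigidInt_or_inv x).resolve_right hx
  rcases h1 with h | h | h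
  · rw [h, add_zero]; exact R.T_one
  · exact h.2.2
  · obtain ⟨y, z, hy, hz, h⟩ := R.exists_mul_of_not h.1 fun h' => hx (Or.inr (Or.inr h'))
    rw [h]
    exact R.one_add_mul_mem hy hz

end RigidPair

section GoodSubgroups

variable {K : Type*} [Field K]

/-- The nonzero elements of `K` whose square class lies in `H`. -/
def elems (H : Subgroup (SqClass K)) : Set K := {z | ∃ u : Kˣ, (u : K) = z ∧ sqCl u ∈ H}

lemma coe_mem_elems {H : Subgroup (SqClass K)} {u : Kˣ} : (u : K) ∈ elems H ↔ sqCl u ∈ H :=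
  ⟨fun ⟨v, hv, h⟩ => by rwa [← Units.ext hv], fun h => ⟨u, rfl, h⟩⟩

lemma exists_sqCl_of_ne {z : K} (hz : z ≠ 0) : ∃ u : Kˣ, (u : K) = z := ⟨Units.mk0 z hz, rfl⟩

lemma elems_ne_zero {H : Subgroup (SqClass K)} {z : K} (h : z ∈ elems H) : z ≠ 0 := by
  obtain ⟨u, rfl, _⟩ := h; exact u.ne_zero

lemma elems_mul {H : Subgroup (SqClass K)} {x y : K} (hx : x ∈ elems H) (hy : y ∈ elems H) :
    x * y ∈ elems H := by
  obtain ⟨u, rfl, hu⟩ := hx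
  obtain ⟨v, rfl, hv⟩ := hy
  exact ⟨u * v, rfl, by rw [sqCl_mul]; exact H.mul_mem hu hv⟩

lemma elems_sq (H : Subgroup (SqClass K)) {x : K} (hx : x ≠ 0) : x * x ∈ elems H := by
  refine ⟨Units.mk0 x hx * Units.mk0 x hx, rfl, ?_⟩
  rw [show sqCl (Units.mk0 x hx * Units.mk0 x hx) = 1 from
    sqCl_eq_one_iff.2 ⟨Units.mk0 x hx, (sq _).symm⟩]
  exact H.one_mem

lemma binGen_le (H : Subgroup (SqClass K)) : binGen H ≤ H := by
  unfold binGen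
  rw [Subgroup.closure_le]
  exact fun t ht => ht.1

lemma mem_elems_binGen {H : Subgroup (SqClass K)} {x z p q : K} (hx0 : x ≠ 0) (hx : x ∉ elems H)
    (hz : z ∈ elems H) (h : z = p ^ 2 + x * q ^ 2) : z ∈ elems (binGen H) := by
  obtain ⟨u, rfl, hu⟩ := hz
  obtain ⟨v, rfl⟩ := exists_sqCl_of_ne hx0
  rw [coe_mem_elems] at hx ⊢
  refine Subgroup.subset_closure ⟨hu, _, hx, ?_⟩
  rw [← sqCl_one, repCl_iff]
  exact ⟨p, q, by simpa using h⟩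

lemma IsGood.not_isSumSq {H : Subgroup (SqClass K)} (hH : IsGood H) {z : K}
    (hz : z ∈ elems (binGen H)) : ¬ IsSumSq (-z) := by
  obtain ⟨u, rfl, hu⟩ := hz
  intro h
  apply hH.not_ssq _ hu
  rw [← sqCl_mul, ssq_iff]
  simpa using h

lemma IsGood.rigidPair {H : Subgroup (SqClass K)} (hH : IsGood H) :
    RigidPair (elems (binGen H)) (elems H) where
  zero_notMem h := elems_ne_zero h rfl
  le := fun ⟨u, h1, h2⟩ => ⟨u, h1, binGen_le H h2⟩
  T_mul := elems_mul
  T_sq := elems_sq _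
  H_mul := elems_mul
  odd_mul {x y} hx hy hx' hy' := by
    obtain ⟨u, rfl⟩ := exists_sqCl_of_ne hx
    obtain ⟨v, rfl⟩ := exists_sqCl_of_ne hy
    rw [← Units.val_mul]
    rw [coe_mem_elems] at *
    exact hH.mul_mem_of_notMem _ _ hx' hy'
  H_neg_one := ⟨-1, by simp, hH.neg_one_mem⟩
  neg_one h := hH.not_isSumSq h (by rw [neg_neg]; exact IsSumSq.one)
  key {x} hx hx' := by
    have h0 : 1 + x ≠ 0 := by
      intro h
      apply hx'
      rw [show x = -1 by linear_combination h]
      exact ⟨-1, by simp, hH.neg_one_mem⟩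
    by_cases h1 : 1 + x ∈ elems H
    · exact Or.inl (mem_elems_binGen (p := 1) (q := 1) hx hx' h1 (by ring))
    · right
      have h2 : x * (1 + x) ∈ elems H := by
        obtain ⟨u, rfl⟩ := exists_sqCl_of_ne hx
        obtain ⟨v, hv⟩ := exists_sqCl_of_ne h0
        rw [← hv] at h1 ⊢
        rw [← Units.val_mul]
        rw [coe_mem_elems] at *
        exact hH.mul_mem_of_notMem _ _ hx' h1
      have h3 := mem_elems_binGen (p := x) (q := 1) hx hx' h2 (by ring)
      refine ⟨_, elems_mul h3 (elems_sq _ (inv_ne_zero hx)), ?_⟩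
      field_simp
  exc := by
    obtain ⟨h, h1, h2, h3⟩ := hH.exists_rep
    obtain ⟨w, rfl⟩ := sqCl_surjective h
    rw [← sqCl_one, repCl_iff] at h1
    obtain ⟨x, y, h⟩ := h1
    simp only [Units.val_one, one_mul] at h
    have aux : ∀ z : K, (w : K) ≠ z ^ 2 := by
      intro z hz
      apply h2
      rw [show sqCl w = 1 from ?_]
      · exact Subgroup.one_mem _
      · have : z ≠ 0 := by rintro rfl; simp at hz
        exact sqCl_eq_one_iff.2 ⟨Units.mk0 z this, by ext; simpa using hz⟩
    have hx : x ≠ 0 := by rintro rfl; exact aux y (by simpa using h)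
    have hy : y ≠ 0 := by rintro rfl; exact aux x (by simpa using h)
    rw [← sqCl_mul] at h3
    rw [← coe_mem_elems] at h2 h3
    refine ⟨_, elems_sq _ (div_ne_zero hy hx), fun h' => h2 ?_, fun h' => h3 ?_⟩
    · have := elems_mul h' (elems_sq _ hx)
      convert this using 1
      rw [h]; field_simp
    · have := elems_mul h' (elems_sq _ hx)
      convert this using 1
      push_cast
      rw [h]; field_simp

/-- A valuation ring containing the rational numbers contains every number field. -/
lemma mem_of_natCast_inv_mem [CharZero K] (O : ValuationSubring K) (hO : ∀ n : ℕ, (n : K)⁻¹ ∈ O)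
    {k : Type*} [Field k] [NumberField k] (ι : k →+* K) (c : k) : ι c ∈ O := by
  have hq : ∀ q : ℚ, algebraMap ℚ K q ∈ O.toSubring := by
    intro q
    rw [eq_ratCast, Rat.cast_def, div_eq_mul_inv]
    exact mul_mem (intCast_mem _ _) (hO _)
  let f : ℚ →+* O := (algebraMap ℚ K).codRestrict O.toSubring hq
  have hc_int : IsIntegral ℚ c := Algebra.IsIntegral.isIntegral c
  have : IsIntegral O (ι c) := by
    refine ⟨(minpoly ℚ c).map f, (minpoly.monic hc_int).map f, ?_⟩
    rw [Polynomial.eval₂_map]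
    have e : (algebraMap O K).comp f = ι.comp (algebraMap ℚ k) := Subsingleton.elim _ _
    rw [e, ← Polynomial.hom_eval₂]
    have := minpoly.aeval ℚ c
    rw [Polynomial.aeval_def] at this
    rw [this, map_zero]
  obtain ⟨y, hy⟩ := IsIntegrallyClosed.isIntegral_iff.1 this
  rw [← hy]
  exact y.2

/-- The valuation ring of a good subgroup. -/
def IsGood.valRing {H : Subgroup (SqClass K)} (hH : IsGood H) : ValuationSubring K :=
  hH.rigidPair.valRing

variable {H : Subgroup (SqClass K)} (hH : IsGood H)
include hH

lemma IsGood.one_add_mem {x : K} (hx : x⁻¹ ∉ hH.valRing) : 1 + x ∈ elems (binGen H) :=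
  hH.rigidPair.one_add_mem_of_nonunit hx

lemma IsGood.natCast_inv_mem [CharZero K] (n : ℕ) : (n : K)⁻¹ ∈ hH.valRing := by
  rcases Nat.eq_zero_or_pos n with rfl | hn
  · simp [zero_mem]
  by_contra h
  have h1 := hH.one_add_mem (x := -(n : K)) (by
    rw [inv_neg]; exact fun h' => h (by simpa using neg_mem h'))
  apply hH.not_isSumSq h1
  rw [show -(1 + -(n : K)) = ((n - 1 : ℕ) : K) by push_cast [hn]; ring]
  exact IsSumSq.natCast _

lemma IsGood.algebraMap_mem [CharZero K] {k : Type*} [Field k] [NumberField k] (ι : k →+* K)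
    (c : k) : ι c ∈ hH.valRing := mem_of_natCast_inv_mem _ hH.natCast_inv_mem ι c

lemma IsGood.const_mem [CharZero K] {k : Type*} [Field k] [NumberField k] (ι : k →+* K)
    {c : k} (hc : c ≠ 0) : ι c ∈ elems H := by
  refine hH.rigidPair.mem_H_of_unit (by simpa using hc) (hH.algebraMap_mem ι c) ?_
  have := hH.algebraMap_mem ι c⁻¹
  rwa [map_inv₀] at this

end GoodSubgroups

lemma const_mem_goodInf {K : Type*} [Field K] [CharZero K] {k : Type*} [Field k] [NumberField k]
    (ι : k →+* K) {c : k} (hc : c ≠ 0) : ι c ∈ elems (goodInf K) := by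
  have h0 : ι c ≠ 0 := by simpa using hc
  refine ⟨Units.mk0 _ h0, rfl, ?_⟩
  unfold goodInf
  rw [Subgroup.mem_sInf]
  intro H hH
  obtain ⟨u, hu, h⟩ := hH.const_mem ι hc
  rwa [show Units.mk0 _ h0 = u from Units.ext hu.symm]

section RealFields

variable {F : Type*} [Field F]

lemma isSumSq_sq (x : F) : IsSumSq (x ^ 2) := by rw [sq]; exact IsSumSq.mul_self x

lemma isSumSq_inv {x : F} (h : IsSumSq x) : IsSumSq x⁻¹ := by
  by_cases hx : x = 0
  · simp [hx]
  · have := h.mul (IsSumSq.mul_self x⁻¹)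
    rwa [mul_inv_cancel_left₀ hx] at this

lemma isSumSq_div {x y : F} (h : IsSumSq x) (h' : IsSumSq y) : IsSumSq (x / y) := by
  rw [div_eq_mul_inv]; exact h.mul (isSumSq_inv h')

lemma eq_zero_of_add_isSumSq (hF : ¬ IsSumSq (-1 : F)) {x s : F} (hx : IsSumSq x) (hs : IsSumSq s)
    (h : x + s = 0) : x = 0 := by
  by_contra h0
  apply hF
  have := isSumSq_div hs hx
  rwa [show s = -x by linear_combination h, neg_div, div_self h0] at this

lemma charZero_of_real (hF : ¬ IsSumSq (-1 : F)) : CharZero F := by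
  refine charZero_of_inj_zero fun n hn => ?_
  by_contra h0
  apply hF
  have : (-1 : F) = ((n - 1 : ℕ) : F) := by
    rw [Nat.cast_sub (Nat.one_le_iff_ne_zero.2 h0), hn]; simp
  rw [this]
  exact IsSumSq.natCast _

end RealFields

section SquareClassSubgroups

variable {K : Type*} [Field K]

/-- The image in the square class group of a group of units. -/
def clSub (S : Subgroup Kˣ) : Subgroup (SqClass K) := S.map (QuotientGroup.mk' (sqSubgroup K))

lemma mem_clSub {S : Subgroup Kˣ} (hS : ∀ w : Kˣ, w ^ 2 ∈ S) {u : Kˣ} :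
    sqCl u ∈ clSub S ↔ u ∈ S := by
  constructor
  · rintro ⟨v, hv, h⟩
    obtain ⟨w, rfl⟩ := sqCl_eq_iff.1 (show sqCl v = sqCl u from h)
    exact S.mul_mem hv (hS w)
  · exact fun h => ⟨u, h, rfl⟩

end SquareClassSubgroups

section Places

variable {R K F : Type*} [CommRing R] [IsDomain R] [UniqueFactorizationMonoid R] [Field K]
  [Algebra R K] [IsFractionRing R K] [Field F] (φ : R →+* F)

/-- Elements of even value at the place `φ`. -/
def EvenAt (f : K) : Prop := ∃ z : K, z ≠ 0 ∧ ∃ u : R, φ u ≠ 0 ∧ f = z ^ 2 * algebraMap R K u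

/-- Elements of even value at the place `φ` whose residue is a square. -/
def SqAt (f : K) : Prop :=
  ∃ z : K, z ≠ 0 ∧ ∃ u : R, φ u ≠ 0 ∧ IsSquare (φ u) ∧ f = z ^ 2 * algebraMap R K u

/-- The units of even value at the place `φ`. -/
def evenUnits (K : Type*) [Field K] [Algebra R K] [IsFractionRing R K] : Subgroup Kˣ where
  carrier := {f | EvenAt φ (f : K)}
  mul_mem' := by
    rintro a b ⟨z, hz, u, hu, h⟩ ⟨z', hz', u', hu', h'⟩
    refine ⟨z * z', mul_ne_zero hz hz', u * u', by simp [hu, hu'], ?_⟩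
    simp only [Units.val_mul, h, h', map_mul]; ring
  one_mem' := ⟨1, one_ne_zero, 1, by simp, by simp⟩
  inv_mem' := by
    rintro a ⟨z, hz, u, hu, h⟩
    have : algebraMap R K u ≠ 0 := fun h0 => a.ne_zero (by rw [h, h0, mul_zero])
    refine ⟨(z * algebraMap R K u)⁻¹, inv_ne_zero (mul_ne_zero hz this), u, hu, ?_⟩
    simp only [Units.val_inv_eq_inv_val, h]
    field_simp

/-- The units of even value at the place `φ` whose residue is a square. -/
def sqUnits (K : Type*) [Field K] [Algebra R K] [IsFractionRing R K] : Subgroup Kˣ where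
  carrier := {f | SqAt φ (f : K)}
  mul_mem' := by
    rintro a b ⟨z, hz, u, hu, hs, h⟩ ⟨z', hz', u', hu', hs', h'⟩
    refine ⟨z * z', mul_ne_zero hz hz', u * u', by simp [hu, hu'], ?_, ?_⟩
    · rw [map_mul]; exact hs.mul hs'
    simp only [Units.val_mul, h, h', map_mul]; ring
  one_mem' := ⟨1, one_ne_zero, 1, by simp, by simp, by simp⟩
  inv_mem' := by
    rintro a ⟨z, hz, u, hu, hs, h⟩
    have : algebraMap R K u ≠ 0 := fun h0 => a.ne_zero (by rw [h, h0, mul_zero])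
    refine ⟨(z * algebraMap R K u)⁻¹, inv_ne_zero (mul_ne_zero hz this), u, hu, hs, ?_⟩
    simp only [Units.val_inv_eq_inv_val, h]
    field_simp

/-- The subgroup of classes of even value at the place `φ`. -/
def evenSub (K : Type*) [Field K] [Algebra R K] [IsFractionRing R K] : Subgroup (SqClass K) :=
  clSub (evenUnits φ K)

omit [IsDomain R] [UniqueFactorizationMonoid R] in
lemma sq_mem_sqUnits (w : Kˣ) : w ^ 2 ∈ sqUnits φ K :=
  show SqAt φ ((w ^ 2 : Kˣ) : K) from ⟨w, w.ne_zero, 1, by simp, by simp, by simp⟩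

omit [IsDomain R] [UniqueFactorizationMonoid R] in
lemma sqCl_mem_evenSub {u : Kˣ} : sqCl u ∈ evenSub φ K ↔ EvenAt φ (u : K) :=
  mem_clSub fun w => show EvenAt φ ((w ^ 2 : Kˣ) : K) from ⟨w, w.ne_zero, 1, by simp, by simp⟩

omit [IsDomain R] [UniqueFactorizationMonoid R] in
lemma mem_elems_evenSub {z : K} (hz : z ≠ 0) : z ∈ elems (evenSub φ K) ↔ EvenAt φ z := by
  obtain ⟨u, rfl⟩ := exists_sqCl_of_ne hz
  rw [coe_mem_elems, sqCl_mem_evenSub]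

variable {φ} {π : R} (hπ : Prime π) (hφ : ∀ x, φ x = 0 ↔ π ∣ x)
include hπ hφ

lemma exists_frac (z : K) : ∃ n d : R, d ≠ 0 ∧ z = algebraMap R K n / algebraMap R K d ∧
    ¬ (φ n = 0 ∧ φ d = 0) := by
  obtain ⟨n, d, hnd, h⟩ := IsFractionRing.exists_reduced_fraction (A := R) z
  refine ⟨n, d, nonZeroDivisors.coe_ne_zero d, ?_, ?_⟩
  · rw [← h, IsFractionRing.mk'_eq_div]
  · rw [hφ, hφ]
    rintro ⟨h1, h2⟩
    exact hπ.not_isUnit (hnd h1 h2)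

lemma even_or_odd {f : K} (hf : f ≠ 0) : EvenAt φ f ∨
    ∃ z : K, z ≠ 0 ∧ ∃ u : R, φ u ≠ 0 ∧ f = z ^ 2 * algebraMap R K π * algebraMap R K u := by
  obtain ⟨n, d, hd, h, -⟩ := exists_frac (K := K) hπ hφ f
  have hd' : algebraMap R K d ≠ 0 := by simpa using hd
  have hn : n ≠ 0 := by rintro rfl; simp at h; exact hf h
  have hnd : n * d ≠ 0 := mul_ne_zero hn hd
  obtain ⟨m, c, hc, hm⟩ := (FiniteMultiplicity.of_prime_left hπ hnd).exists_eq_pow_mul_and_not_dvd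
    |> fun ⟨c, h1, h2⟩ => (⟨_, c, h2, h1⟩ : ∃ m c, ¬ π ∣ c ∧ n * d = π ^ m * c)
  have hπ' : algebraMap R K π ≠ 0 := by simpa using hπ.ne_zero
  have hf' : f = (algebraMap R K d)⁻¹ ^ 2 * (algebraMap R K π ^ m * algebraMap R K c) := by
    rw [← map_pow, ← map_mul, ← hm, h, map_mul]; field_simp
  rcases Nat.even_or_odd' m with ⟨j, rfl | rfl⟩
  · refine Or.inl ⟨(algebraMap R K d)⁻¹ * algebraMap R K π ^ j, mul_ne_zero (inv_ne_zero hd') (pow_ne_zero _ hπ'), c, ?_, ?_⟩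
    · rwa [Ne, hφ]
    · rw [hf']; ring
  · refine Or.inr ⟨(algebraMap R K d)⁻¹ * algebraMap R K π ^ j, ?_, c, ?_, ?_⟩
    · exact mul_ne_zero (inv_ne_zero hd') (pow_ne_zero _ hπ')
    · rwa [Ne, hφ]
    · rw [hf']; ring

lemma residue_unique {z z' : K} (hz' : z' ≠ 0) {u u' : R} (hu : φ u ≠ 0)
    (hu' : φ u' ≠ 0) (h : z ^ 2 * algebraMap R K u = z' ^ 2 * algebraMap R K u') :
    ∃ e : F, e ≠ 0 ∧ φ u' = e ^ 2 * φ u := by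
  obtain ⟨n, d, hd, hnd, hc⟩ := exists_frac (K := K) hπ hφ (z / z')
  have hd' : algebraMap R K d ≠ 0 := by simpa using hd
  have h1 : n ^ 2 * u = d ^ 2 * u' := by
    apply IsFractionRing.injective R K
    simp only [map_mul, map_pow]
    rw [show algebraMap R K n = z / z' * algebraMap R K d by rw [hnd]; field_simp]
    field_simp
    linear_combination h
  have h2 : φ n ^ 2 * φ u = φ d ^ 2 * φ u' := by simpa using congrArg φ h1
  have hd0 : φ d ≠ 0 := by
    intro h0
    rw [h0] at h2
    have : φ n = 0 := by simpa [hu] using h2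
    exact hc ⟨this, h0⟩
  have hn0 : φ n ≠ 0 := by
    intro h0
    rw [h0] at h2
    have : φ d = 0 := by simpa [hu'] using h2
    exact hd0 this
  refine ⟨φ n / φ d, div_ne_zero hn0 hd0, ?_⟩
  field_simp
  linear_combination -h2

lemma not_even_and_odd {z z' : K} (hz' : z' ≠ 0) {u u' : R} (hu : φ u ≠ 0)
    (hu' : φ u' ≠ 0)
    (h : z ^ 2 * algebraMap R K u = z' ^ 2 * algebraMap R K π * algebraMap R K u') : False := by
  obtain ⟨n, d, hd, hnd, hc⟩ := exists_frac (K := K) hπ hφ (z / z')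
  have hd' : algebraMap R K d ≠ 0 := by simpa using hd
  have h1 : n ^ 2 * u = d ^ 2 * (π * u') := by
    apply IsFractionRing.injective R K
    simp only [map_mul, map_pow]
    rw [show algebraMap R K n = z / z' * algebraMap R K d by rw [hnd]; field_simp]
    field_simp
    linear_combination h
  have hn : φ n = 0 := by
    have : φ (n ^ 2 * u) = 0 := by rw [h1, hφ]; exact ⟨d ^ 2 * u', by ring⟩
    simpa [hu] using this
  obtain ⟨m, rfl⟩ := (hφ n).1 hn
  have h2 : π * (m ^ 2 * u) = d ^ 2 * u' := by
    apply mul_left_cancel₀ hπ.ne_zero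
    linear_combination h1
  have hd0 : φ d = 0 := by
    have : φ (d ^ 2 * u') = 0 := by rw [← h2, hφ]; exact ⟨_, rfl⟩
    simpa [hu'] using this
  exact hc ⟨hn, hd0⟩

lemma sqAt_of_rep {x t p q : K} (hx0 : x ≠ 0) (hx : ¬ EvenAt φ x) (ht : EvenAt φ t) (ht0 : t ≠ 0)
    (h : t = p ^ 2 + x * q ^ 2) : SqAt φ t := by
  obtain ⟨w, hw, v, hv, rfl⟩ := (even_or_odd hπ hφ hx0).resolve_left hx
  by_cases hq : q = 0
  · have hp : p ≠ 0 := by rintro rfl; apply ht0; rw [h, hq]; simp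
    exact ⟨p, hp, 1, by simp, by simp, by rw [h, hq]; simp⟩
  obtain ⟨n, d, hd, hnd, hc⟩ := exists_frac (K := K) hπ hφ (p / (w * q))
  have hd' : algebraMap R K d ≠ 0 := by simpa using hd
  have hwq : w * q ≠ 0 := mul_ne_zero hw hq
  have hp : p = algebraMap R K n / algebraMap R K d * (w * q) := by rw [← hnd]; field_simp
  have hzd : w * q / algebraMap R K d ≠ 0 := div_ne_zero hwq hd'
  have hπ0 : φ π = 0 := (hφ π).2 dvd_rfl
  by_cases hn : φ n = 0
  · exfalso
    obtain ⟨m, rfl⟩ := (hφ n).1 hn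
    have hd0 : φ d ≠ 0 := fun h' => hc ⟨hn, h'⟩
    obtain ⟨z, hz, u, hu, h'⟩ := ht
    refine not_even_and_odd hπ hφ (z := z) hzd hu (u' := π * m ^ 2 + v * d ^ 2) ?_ ?_
    · simp [hπ0, hv, hd0]
    · rw [← h', h, hp]
      simp only [map_mul, map_add, map_pow]
      field_simp
  · refine ⟨w * q / algebraMap R K d, hzd, n ^ 2 + π * v * d ^ 2, ?_, ?_, ?_⟩
    · simp [hπ0, hn]
    · simp [hπ0, IsSquare.sq]
    · rw [h, hp]
      simp only [map_mul, map_add, map_pow]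
      field_simp

lemma residue_isSumSq (hF : ¬ IsSumSq (-1 : F)) {s : K} (hs : IsSumSq s) : s ≠ 0 →
    ∃ z : K, z ≠ 0 ∧ ∃ u : R, φ u ≠ 0 ∧ IsSumSq (φ u) ∧ s = z ^ 2 * algebraMap R K u := by
  induction hs with
  | zero => exact fun h => absurd rfl h
  | @sq_add a s _ ih =>
    intro h
    by_cases hs : s = 0
    · have ha : a ≠ 0 := by rintro rfl; simp [hs] at h
      exact ⟨a, ha, 1, by simp, by simp, by simp [hs, sq]⟩
    obtain ⟨z, hz, u, hu, hsu, e⟩ := ih hs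
    obtain ⟨n, d, hd, hnd, hc⟩ := exists_frac (K := K) hπ hφ (a / z)
    have hd' : algebraMap R K d ≠ 0 := by simpa using hd
    have ha : a = algebraMap R K n / algebraMap R K d * z := by rw [← hnd]; field_simp
    refine ⟨z / algebraMap R K d, div_ne_zero hz hd', n ^ 2 + d ^ 2 * u, ?_, ?_, ?_⟩
    · intro h0
      apply hc
      simp only [map_add, map_mul, map_pow] at h0
      have h1 := eq_zero_of_add_isSumSq hF (isSumSq_sq _) ((isSumSq_sq _).mul hsu) h0
      have h2 : φ n = 0 := by simpa using h1
      refine ⟨h2, ?_⟩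
      rw [h2] at h0
      simpa [hu] using h0
    · simp only [map_add, map_mul, map_pow]
      exact (isSumSq_sq _).add ((isSumSq_sq _).mul hsu)
    · rw [e, ha]
      simp only [map_add, map_mul, map_pow]
      field_simp

lemma binGen_evenSub_le : binGen (evenSub φ K) ≤ clSub (sqUnits φ K) := by
  unfold binGen
  rw [Subgroup.closure_le]
  rintro t ⟨ht, x, hx, h⟩
  obtain ⟨t, rfl⟩ := sqCl_surjective t
  obtain ⟨x, rfl⟩ := sqCl_surjective x
  rw [← sqCl_one, repCl_iff] at h
  obtain ⟨p, q, h⟩ := h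
  rw [sqCl_mem_evenSub] at ht hx
  refine (mem_clSub (sq_mem_sqUnits φ)).2 ?_
  exact sqAt_of_rep hπ hφ x.ne_zero hx ht t.ne_zero (by simpa using h)

lemma sqAt_of_mem_binGen {t : Kˣ} (h : sqCl t ∈ binGen (evenSub φ K)) : SqAt φ (t : K) :=
  (mem_clSub (sq_mem_sqUnits φ)).1 (binGen_evenSub_le hπ hφ h)

lemma isSquare_of_sqAt {u : R} (hu : φ u ≠ 0) (h : SqAt φ (algebraMap R K u)) :
    IsSquare (φ u) := by
  obtain ⟨z, -, v, hv, ⟨r, hr⟩, h⟩ := h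
  obtain ⟨e, -, he⟩ := residue_unique (K := K) hπ hφ one_ne_zero hv hu (by rw [← h]; simp)
  exact ⟨e * r, by rw [he, hr]; ring⟩

/-- A real place with a non-exceptional residue field yields a good subgroup. -/
lemma isGood_evenSub (hF : ¬ IsSumSq (-1 : F))
    (hex : ∃ a b : ℕ, ¬ IsSquare ((a : F) ^ 2 + (b : F) ^ 2)) : IsGood (evenSub φ K) where
  ne_top h := by
    have hπ' : algebraMap R K π ≠ 0 := by simpa using hπ.ne_zero
    have : sqCl (Units.mk0 _ hπ') ∈ evenSub φ K := by rw [h]; trivial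
    rw [sqCl_mem_evenSub] at this
    obtain ⟨z, hz, u, hu, h⟩ := this
    exact not_even_and_odd (K := K) hπ hφ one_ne_zero hu (u' := 1) (by simp)
      (by rw [← h]; simp)
  mul_mem_of_notMem x y hx hy := by
    obtain ⟨x, rfl⟩ := sqCl_surjective x
    obtain ⟨y, rfl⟩ := sqCl_surjective y
    rw [← sqCl_mul]
    rw [sqCl_mem_evenSub] at *
    obtain ⟨z, hz, u, hu, h⟩ := (even_or_odd hπ hφ x.ne_zero).resolve_left hx
    obtain ⟨z', hz', u', hu', h'⟩ := (even_or_odd hπ hφ y.ne_zero).resolve_left hy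
    have hπ' : algebraMap R K π ≠ 0 := by simpa using hπ.ne_zero
    refine ⟨z * z' * algebraMap R K π, mul_ne_zero (mul_ne_zero hz hz') hπ', u * u',
      by simp [hu, hu'], ?_⟩
    rw [Units.val_mul, h, h', map_mul]; ring
  neg_one_mem := (sqCl_mem_evenSub φ).2 ⟨1, one_ne_zero, -1, by simp, by simp⟩
  not_ssq t ht hs := by
    obtain ⟨t, rfl⟩ := sqCl_surjective t
    rw [← sqCl_mul, ssq_iff] at hs
    obtain ⟨z, hz, u, hu, ⟨r, hr⟩, h⟩ := sqAt_of_mem_binGen hπ hφ ht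
    obtain ⟨z', hz', u', hu', hs', h'⟩ := residue_isSumSq hπ hφ hF hs (Units.ne_zero _)
    obtain ⟨e, he, h2⟩ := residue_unique (K := K) hπ hφ (z := z) hz' (u := -u) (by simpa using hu) hu' (by
      rw [← h', Units.val_mul, h]; simp)
    have hr0 : r ≠ 0 := by rintro rfl; simp at hr; exact hu hr
    apply hF
    have := isSumSq_div hs' (isSumSq_sq (e * r))
    convert this using 1
    rw [h2, map_neg, hr]
    field_simp
  exists_rep := by
    obtain ⟨a, b, hab⟩ := hex
    have e : φ ((a : R) ^ 2 + (b : R) ^ 2) = (a : F) ^ 2 + (b : F) ^ 2 := by simp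
    have h0 : φ ((a : R) ^ 2 + (b : R) ^ 2) ≠ 0 := by
      intro h; rw [← e, h] at hab; simp at hab
    have h0' : algebraMap R K ((a : R) ^ 2 + (b : R) ^ 2) ≠ 0 := by
      intro h
      rw [map_eq_zero_iff _ (IsFractionRing.injective R K)] at h
      rw [h] at h0
      simp at h0
    refine ⟨sqCl (Units.mk0 _ h0'), ?_, fun h => ?_, fun h => ?_⟩
    · rw [← sqCl_one, repCl_iff]
      exact ⟨a, b, by simp⟩
    · have := isSquare_of_sqAt hπ hφ h0 (sqAt_of_mem_binGen hπ hφ h)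
      rw [e] at this
      exact hab this
    · rw [← sqCl_mul] at h
      have h1 := sqAt_of_mem_binGen hπ hφ h
      have h2 : ((-1 * Units.mk0 _ h0' : Kˣ) : K)
          = algebraMap R K (-((a : R) ^ 2 + (b : R) ^ 2)) := by simp
      rw [h2] at h1
      obtain ⟨r, hr⟩ := isSquare_of_sqAt hπ hφ (by rwa [map_neg, neg_ne_zero]) h1
      rw [map_neg] at hr
      apply h0
      rw [e]
      rw [e] at hr
      refine eq_zero_of_add_isSumSq hF ((isSumSq_sq _).add (isSumSq_sq _)) (isSumSq_sq r) ?_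
      linear_combination -hr

end Places

section Orderings

/-- A proper preordering of a field. -/
structure IsPreord {F : Type*} [Field F] (Q : Set F) : Prop where
  add_mem : ∀ {x y}, x ∈ Q → y ∈ Q → x + y ∈ Q
  mul_mem : ∀ {x y}, x ∈ Q → y ∈ Q → x * y ∈ Q
  sq_mem : ∀ x : F, x * x ∈ Q
  neg_one : (-1 : F) ∉ Q

variable {F : Type*} [Field F]

lemma IsPreord.one_mem {Q : Set F} (h : IsPreord Q) : (1 : F) ∈ Q := by simpa using h.sq_mem 1

lemma IsPreord.zero_mem {Q : Set F} (h : IsPreord Q) : (0 : F) ∈ Q := by simpa using h.sq_mem 0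

/-- Adjoining `-a` to a preordering not containing `a`. -/
lemma IsPreord.adjoin {Q : Set F} (h : IsPreord Q) {a : F} (ha : a ∉ Q) :
    IsPreord {z | ∃ p ∈ Q, ∃ q ∈ Q, z = p - a * q} where
  add_mem := by
    rintro x y ⟨p, hp, q, hq, rfl⟩ ⟨p', hp', q', hq', rfl⟩
    exact ⟨_, h.add_mem hp hp', _, h.add_mem hq hq', by ring⟩
  mul_mem := by
    rintro x y ⟨p, hp, q, hq, rfl⟩ ⟨p', hp', q', hq', rfl⟩
    exact ⟨_, h.add_mem (h.mul_mem hp hp') (h.mul_mem (h.sq_mem a) (h.mul_mem hq hq')), _,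
      h.add_mem (h.mul_mem hp hq') (h.mul_mem hq hp'), by ring⟩
  sq_mem x := ⟨_, h.sq_mem x, 0, h.zero_mem, by ring⟩
  neg_one := by
    rintro ⟨p, hp, q, hq, e⟩
    have hq0 : q ≠ 0 := by
      rintro rfl
      apply h.neg_one
      rw [e]; simpa using hp
    apply ha
    have := h.mul_mem (h.mul_mem (h.add_mem h.one_mem hp) hq) (h.sq_mem q⁻¹)
    convert this using 1
    field_simp
    linear_combination e

lemma IsPreord.exists_isOrdering {Q : Set F} (h : IsPreord Q) :
    ∃ P : Set F, IsOrdering P ∧ Q ⊆ P := by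
  obtain ⟨P, hQP, hP⟩ := zorn_subset_nonempty {P : Set F | IsPreord P} (by
    intro c hc hchain ⟨P₀, hP₀⟩
    refine ⟨⋃₀ c, ?_, fun s hs => Set.subset_sUnion_of_mem hs⟩
    have key : ∀ {x y}, x ∈ ⋃₀ c → y ∈ ⋃₀ c → ∃ P ∈ c, x ∈ P ∧ y ∈ P := by
      rintro x y ⟨P, hP, hx⟩ ⟨P', hP', hy⟩
      rcases hchain.total hP hP' with h | h
      · exact ⟨P', hP', h hx, hy⟩
      · exact ⟨P, hP, hx, h hy⟩
    refine ⟨fun hx hy => ?_, fun hx hy => ?_, fun x => ⟨P₀, hP₀, (hc hP₀).sq_mem x⟩, ?_⟩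
    · obtain ⟨P, hP, hx, hy⟩ := key hx hy
      exact ⟨P, hP, (hc hP).add_mem hx hy⟩
    · obtain ⟨P, hP, hx, hy⟩ := key hx hy
      exact ⟨P, hP, (hc hP).mul_mem hx hy⟩
    · rintro ⟨P, hP, hx⟩
      exact (hc hP).neg_one hx) Q h
  have hp : IsPreord P := hP.prop
  refine ⟨P, ⟨fun x hx y hy => hp.add_mem hx hy, fun x hx y hy => hp.mul_mem hx hy, ?_, ?_⟩, hQP⟩
  · intro x
    by_contra! hx
    have h2 := hp.adjoin hx.1
    have h3 := hP.le_of_ge h2 (fun p hp' => ⟨p, hp', 0, hp.zero_mem, by ring⟩)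
    exact hx.2 (h3 ⟨0, hp.zero_mem, 1, hp.one_mem, by ring⟩)
  · intro x hx hx'
    by_contra h0
    apply hp.neg_one
    have := hp.mul_mem (hp.mul_mem hx hx') (hp.sq_mem x⁻¹)
    convert this using 1
    field_simp

lemma isPreord_isSumSq (hF : ¬ IsSumSq (-1 : F)) : IsPreord {x : F | IsSumSq x} where
  add_mem hx hy := IsSumSq.add hx hy
  mul_mem hx hy := IsSumSq.mul hx hy
  sq_mem := IsSumSq.mul_self
  neg_one := hF

/-- The linear order attached to an ordering. -/
@[reducible] def _root_.IsOrdering.linearOrder {P : Set F} (hP : IsOrdering P) : LinearOrder F where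
  le x y := y - x ∈ P
  le_refl x := by
    rw [sub_self]
    simpa using hP.total 0
  le_trans x y z h h' := by
    have := hP.add_mem _ h' _ h
    change z - x ∈ P
    convert this using 1; ring
  le_antisymm x y h h' := by
    have := hP.antisymm (y - x) h (by convert (show x - y ∈ P from h') using 1; ring)
    linear_combination -this
  le_total x y := by
    have := hP.total (y - x)
    rwa [neg_sub] at this
  toDecidableLE := Classical.decRel _

lemma _root_.IsOrdering.isStrictOrderedRing {P : Set F} (hP : IsOrdering P) :
    letI := hP.linearOrder
    IsStrictOrderedRing F := by
  let := hP.linearOrder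
  have hle : ∀ x y : F, x ≤ y ↔ y - x ∈ P := fun x y => Iff.rfl
  have : IsOrderedAddMonoid F :=
    { add_le_add_left := fun a b h c => by
        rw [hle] at *
        convert h using 1; ring }
  have : ZeroLEOneClass F := ⟨by
    rw [hle, sub_zero]
    rcases hP.total 1 with h | h
    · exact h
    · simpa using hP.mul_mem _ h _ h⟩
  have : IsOrderedRing F := .of_mul_nonneg fun x y hx hy => by
    rw [hle, sub_zero] at *
    exact hP.mul_mem _ hx _ hy
  exact IsOrderedRing.toIsStrictOrderedRing F

lemma archimedean_of_numberField (k : Type*) [Field k] [NumberField k] [LinearOrder k]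
    [IsStrictOrderedRing k] : Archimedean k := by
  let O : ValuationSubring k :=
    { carrier := {x | ∃ n : ℕ, |x| ≤ n}
      mul_mem' := by
        rintro x y ⟨n, hn⟩ ⟨m, hm⟩
        refine ⟨n * m, ?_⟩
        rw [abs_mul]; push_cast
        exact mul_le_mul hn hm (abs_nonneg _) (Nat.cast_nonneg _)
      one_mem' := ⟨1, by simp⟩
      add_mem' := by
        rintro x y ⟨n, hn⟩ ⟨m, hm⟩
        refine ⟨n + m, (abs_add_le _ _).trans ?_⟩
        push_cast
        exact add_le_add hn hm
      zero_mem' := ⟨0, by simp⟩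
      neg_mem' := by
        rintro x ⟨n, hn⟩
        exact ⟨n, by rwa [abs_neg]⟩
      mem_or_inv_mem' := by
        intro x
        rcases le_total |x| 1 with h | h
        · exact Or.inl ⟨1, by simpa using h⟩
        · refine Or.inr ⟨1, ?_⟩
          rw [abs_inv]; push_cast
          exact inv_le_one_of_one_le₀ h }
  have hO : ∀ x, x ∈ O ↔ ∃ n : ℕ, |x| ≤ n := fun x => Iff.rfl
  refine archimedean_iff_nat_le.2 fun x => ?_
  have := mem_of_natCast_inv_mem O (fun n => (hO _).2 ⟨1, by
    rw [abs_inv, Nat.abs_cast]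
    rcases Nat.eq_zero_or_pos n with rfl | hn
    · simp
    · push_cast
      exact inv_le_one_of_one_le₀ (by exact_mod_cast hn)⟩) (RingHom.id k) x
  obtain ⟨n, hn⟩ := (hO _).1 this
  exact ⟨n, (le_abs_self _).trans hn⟩

lemma _root_.IsOrdering.exists_embedding {k : Type*} [Field k] [NumberField k] {P : Set k}
    (hP : IsOrdering P) : ∃ σ : k →+* ℝ, ∀ x, x ∈ P ↔ 0 ≤ σ x := by
  let := hP.linearOrder
  have := hP.isStrictOrderedRing
  have := archimedean_of_numberField k
  let σ := ConditionallyCompleteLinearOrderedField.inducedOrderRingHom k ℝ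
  have hmono : Monotone σ := OrderHomClass.mono σ
  have hP' : ∀ x, x ∈ P ↔ 0 ≤ x := fun x => by
    rw [show (0 ≤ x) = (x - 0 ∈ P) from rfl, sub_zero]
  refine ⟨σ, fun x => ?_⟩
  rw [hP']
  constructor
  · intro h
    simpa using hmono h
  · intro h
    by_contra! hx
    have h1 := hmono hx.le
    rw [map_zero] at h1
    have : σ x = 0 := le_antisymm h1 h
    rw [map_eq_zero] at this
    exact hx.ne this

lemma exists_embedding_of_isPreord {k : Type*} [Field k] [NumberField k] {Q : Set k}
    (hQ : IsPreord Q) : ∃ σ : k →+* ℝ, ∀ x ∈ Q, 0 ≤ σ x := by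
  obtain ⟨P, hP, h⟩ := hQ.exists_isOrdering
  obtain ⟨σ, hσ⟩ := hP.exists_embedding
  exact ⟨σ, fun x hx => (hσ x).1 (h hx)⟩

lemma isOrdering_nonneg {k : Type*} [Field k] (σ : k →+* ℝ) : IsOrdering {x : k | 0 ≤ σ x} where
  add_mem x hx y hy := by
    simp only [Set.mem_ofPred_eq, map_add] at *
    exact add_nonneg hx hy
  mul_mem x hx y hy := by
    simp only [Set.mem_ofPred_eq, map_mul] at *
    exact mul_nonneg hx hy
  total x := by
    simp only [Set.mem_ofPred_eq, map_neg]
    exact (le_total 0 (σ x)).imp id fun h => by linarith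
  antisymm x hx hy := by
    simp only [Set.mem_ofPred_eq, map_neg] at *
    have : σ x = 0 := by linarith
    simpa using this

lemma embedding_ext_of_nonneg {k : Type*} [Field k] [CharZero k] {σ τ : k →+* ℝ}
    (h : ∀ x, 0 ≤ σ x ↔ 0 ≤ τ x) : σ = τ := by
  have aux : ∀ (σ τ : k →+* ℝ), (∀ x, 0 ≤ σ x ↔ 0 ≤ τ x) → ∀ x, σ x ≤ τ x := by
    intro σ τ h x
    by_contra! hx
    obtain ⟨q, hq1, hq2⟩ := exists_rat_btwn hx
    have h1 := (h (x - q)).1 (by simpa using hq2.le)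
    simp only [map_sub, map_ratCast] at h1
    linarith
  ext x
  exact le_antisymm (aux σ τ h x) (aux τ σ (fun x => (h x).symm) x)

lemma card_orderings (k : Type*) [Field k] [NumberField k] :
    Nat.card {P : Set k // IsOrdering P} = Nat.card (k →+* ℝ) := by
  symm
  refine Nat.card_congr (Equiv.ofBijective
    (fun σ => ⟨{x : k | 0 ≤ σ x}, isOrdering_nonneg σ⟩) ⟨?_, ?_⟩)
  · intro σ τ h
    have h' : {x : k | 0 ≤ σ x} = {x : k | 0 ≤ τ x} := congrArg Subtype.val h
    exact embedding_ext_of_nonneg fun x => Set.ext_iff.1 h' x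
  · rintro ⟨P, hP⟩
    obtain ⟨σ, hσ⟩ := hP.exists_embedding
    refine ⟨σ, Subtype.ext ?_⟩
    ext x
    exact (hσ x).symm

lemma exists_embedding_of_real {k : Type*} [Field k] [NumberField k]
    (hk : ¬ IsSumSq (-1 : k)) : Nonempty (k →+* ℝ) :=
  ⟨(exists_embedding_of_isPreord (isPreord_isSumSq hk)).choose⟩

lemma isSumSq_nonneg {k : Type*} [Field k] (σ : k →+* ℝ) {x : k} (hx : IsSumSq x) : 0 ≤ σ x := by
  induction hx with
  | zero => simp
  | sq_add a _ ih =>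
    rw [map_add, map_mul]
    exact add_nonneg (mul_self_nonneg _) ih

/-- An element which is positive whenever `a` is has the form `s + a t` with `s`, `t` sums of
squares. -/
lemma exists_isSumSq_add_mul {k : Type*} [Field k] [NumberField k] {a c : k}
    (h : ∀ σ : k →+* ℝ, 0 ≤ σ a → 0 < σ c) :
    ∃ s t : k, IsSumSq s ∧ IsSumSq t ∧ c = s + a * t := by
  by_contra hc
  let Q : Set k := {z | ∃ s t : k, IsSumSq s ∧ IsSumSq t ∧ z = s + a * t}
  have hadd : ∀ {x y}, x ∈ Q → y ∈ Q → x + y ∈ Q := by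
    rintro x y ⟨s, t, hs, ht, rfl⟩ ⟨s', t', hs', ht', rfl⟩
    exact ⟨_, _, hs.add hs', ht.add ht', by ring⟩
  have hmul : ∀ {x y}, x ∈ Q → y ∈ Q → x * y ∈ Q := by
    rintro x y ⟨s, t, hs, ht, rfl⟩ ⟨s', t', hs', ht', rfl⟩
    exact ⟨_, _, (hs.mul hs').add ((IsSumSq.mul_self a).mul (ht.mul ht')),
      (hs.mul ht').add (ht.mul hs'), by ring⟩
  have hsq : ∀ x : k, x * x ∈ Q := fun x => ⟨x * x, 0, IsSumSq.mul_self x, .zero, by ring⟩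
  have hneg : (-1 : k) ∉ Q := by
    intro h1
    apply hc
    have := hadd (hsq ((c + 1) / 2)) (hmul h1 (hsq ((c - 1) / 2)))
    rw [show (c + 1) / 2 * ((c + 1) / 2) + -1 * ((c - 1) / 2 * ((c - 1) / 2)) = c by ring] at this
    exact this
  have hQ : IsPreord Q := ⟨hadd, hmul, hsq, hneg⟩
  obtain ⟨σ, hσ⟩ := exists_embedding_of_isPreord (hQ.adjoin (a := c) hc)
  have h1 := hσ a ⟨a, ⟨0, 1, .zero, .one, by ring⟩, 0, hQ.zero_mem, by ring⟩
  have h2 := hσ (-c) ⟨0, hQ.zero_mem, 1, hQ.one_mem, by ring⟩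
  rw [map_neg] at h2
  linarith [h σ h1]

end Orderings

section Signs

variable {k : Type*} [Field k] [NumberField k]

lemma exists_rat_interval (s : Finset ℝ) (x : ℝ) (hx : x ∉ s) : ∃ p q : ℚ, (p : ℝ) < x ∧ x < q ∧
    ∀ y ∈ s, y < p ∨ q < y := by
  have : (s : Set ℝ)ᶜ ∈ nhds x := s.finite_toSet.isClosed.isOpen_compl.mem_nhds (by simpa using hx)
  obtain ⟨ε, hε, h⟩ := Metric.mem_nhds_iff.1 this
  obtain ⟨p, hp1, hp2⟩ := exists_rat_btwn (show x - ε < x by linarith)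
  obtain ⟨q, hq1, hq2⟩ := exists_rat_btwn (show x < x + ε by linarith)
  refine ⟨p, q, hp2, hq1, fun y hy => ?_⟩
  by_contra! hc
  refine h (a := y) ?_ hy
  rw [Metric.mem_ball, Real.dist_eq, abs_lt]
  constructor <;> linarith [hc.1, hc.2]

lemma algHom_ext_of_primitive {F E L : Type*} [Field F] [Field E] [Field L] [Algebra F E]
    [Algebra F L] {θ : E} (hθ : IntermediateField.adjoin F {θ} = ⊤) {σ τ : E →ₐ[F] L}
    (h : σ θ = τ θ) : σ = τ := by
  ext x
  have hx : x ∈ IntermediateField.adjoin F {θ} := by rw [hθ]; trivial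
  induction hx using IntermediateField.adjoin_induction with
  | mem x hx => rw [Set.mem_singleton_iff.1 hx, h]
  | algebraMap x => simp
  | add x y _ _ hx hy => rw [map_add, map_add, hx, hy]
  | inv x _ hx => rw [map_inv₀, map_inv₀, hx]
  | mul x y _ _ hx hy => rw [map_mul, map_mul, hx, hy]

lemma exists_separating (k : Type*) [Field k] [NumberField k] :
    ∃ θ : k, ∀ (σ τ : k →+* ℝ), σ θ = τ θ → σ = τ := by
  obtain ⟨θ, hθ⟩ := Field.exists_primitive_element ℚ k
  refine ⟨θ, fun σ τ h => ?_⟩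
  have : σ.toRatAlgHom = τ.toRatAlgHom := algHom_ext_of_primitive hθ h
  ext x
  exact congrArg (fun f => f x) this

instance finite_ringHom_real : Finite (k →+* ℝ) :=
  Finite.of_injective (fun σ : k →+* ℝ => σ.toRatAlgHom) fun σ τ h => by
    ext x
    exact congrArg (fun f => f x) h

lemma exists_neg_at (σ : k →+* ℝ) : ∃ c : k, σ c < 0 ∧ ∀ τ : k →+* ℝ, τ ≠ σ → 0 < τ c := by
  classical
  cases nonempty_fintype (k →+* ℝ)
  obtain ⟨θ, hθ⟩ := exists_separating k
  obtain ⟨p, q, hp, hq, h⟩ := exists_rat_interval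
    ((Finset.univ.filter (· ≠ σ)).image fun τ : k →+* ℝ => τ θ) (σ θ) (by
      simp only [Finset.mem_image, Finset.mem_filter, Finset.mem_univ, true_and, not_exists, not_and]
      exact fun τ hτ h => hτ (hθ _ _ h))
  refine ⟨(θ - p) * (θ - q), ?_, fun τ hτ => ?_⟩
  · simp only [map_mul, map_sub, map_ratCast]
    exact mul_neg_of_pos_of_neg (by linarith) (by linarith)
  · simp only [map_mul, map_sub, map_ratCast]
    have hpq : (p : ℝ) < q := hp.trans hq
    rcases h (τ θ) (Finset.mem_image.2 ⟨τ, by simpa using hτ, rfl⟩) with h | h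
    · exact mul_pos_of_neg_of_neg (by linarith) (by linarith)
    · exact mul_pos (by linarith) (by linarith)

/-- Independence of the signs of a number field. -/
lemma exists_signs (S : Set (k →+* ℝ)) :
    ∃ c : k, c ≠ 0 ∧ ∀ σ : k →+* ℝ, (σ ∈ S → σ c < 0) ∧ (σ ∉ S → 0 < σ c) := by
  induction S, S.toFinite using Set.Finite.induction_on with
  | empty => exact ⟨1, one_ne_zero, by simp⟩
  | @insert τ S hτ _ ih =>
    obtain ⟨c, hc, h⟩ := ih
    obtain ⟨d, hd, hd'⟩ := exists_neg_at τ
    refine ⟨c * d, mul_ne_zero hc (by rintro rfl; simp at hd), fun σ => ?_⟩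
    rw [map_mul]
    by_cases hσ : σ = τ
    · subst hσ
      exact ⟨fun _ => mul_neg_of_pos_of_neg ((h σ).2 hτ) hd, fun h => absurd (Or.inl rfl) h⟩
    · have h2 := hd' σ hσ
      rw [Set.mem_insert_iff, or_iff_right hσ]
      exact ⟨fun hs => mul_neg_of_neg_of_pos ((h σ).1 hs) h2,
        fun hs => mul_pos ((h σ).2 hs) h2⟩

end Signs

section CircleRing

/-- The coordinate ring `k[x, y] / (x² + y² - b)` of a circle. -/
abbrev CircleRing {k : Type*} [Field k] (b : k) : Type _ :=
  QuadraticAlgebra (Polynomial k) (Polynomial.C b - Polynomial.X ^ 2) 0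

namespace CircleRing

open QuadraticAlgebra

variable {k : Type*} [Field k] {b : k}

/-- The elements of degree at most `m`. -/
def filt (b : k) (m : ℕ) : Submodule k (CircleRing b) where
  carrier := {f | f.re.natDegree ≤ m ∧ (Polynomial.X * f.im).natDegree ≤ m}
  add_mem' := by
    rintro f g ⟨h1, h2⟩ ⟨h3, h4⟩
    refine ⟨by rw [re_add]; exact Polynomial.natDegree_add_le_of_degree_le h1 h3, ?_⟩
    rw [im_add, mul_add]; exact Polynomial.natDegree_add_le_of_degree_le h2 h4
  zero_mem' := by simp
  smul_mem' := by
    rintro c f ⟨h1, h2⟩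
    refine ⟨by rw [re_smul]; exact (Polynomial.natDegree_smul_le _ _).trans h1, ?_⟩
    rw [im_smul, mul_smul_comm]; exact (Polynomial.natDegree_smul_le _ _).trans h2

lemma mem_filt {f : CircleRing b} {m : ℕ} :
    f ∈ filt b m ↔ f.re.natDegree ≤ m ∧ (Polynomial.X * f.im).natDegree ≤ m := Iff.rfl

/-- The leading coefficients in degree `m`. -/
def lead (b : k) (m : ℕ) : CircleRing b →ₗ[k] k × k where
  toFun f := (f.re.coeff m, (Polynomial.X * f.im).coeff m)
  map_add' f g := by simp [mul_add]
  map_smul' c f := by simp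

lemma lead_fst (m : ℕ) (f : CircleRing b) : (lead b m f).1 = f.re.coeff m := rfl
lemma lead_snd (m : ℕ) (f : CircleRing b) : (lead b m f).2 = (Polynomial.X * f.im).coeff m := rfl

lemma filt_mono {m n : ℕ} (h : m ≤ n) : filt b m ≤ filt b n :=
  fun _ hf => ⟨hf.1.trans h, hf.2.trans h⟩

lemma coeff_im_mul_im {m n : ℕ} {f g : CircleRing b} (hf : f ∈ filt b m) (hg : g ∈ filt b n)
    {j : ℕ} (hj : m + n ≤ j) : (f.im * g.im).coeff j = 0 := by
  have : (Polynomial.X * f.im * (Polynomial.X * g.im)).natDegree ≤ m + n := Polynomial.natDegree_mul_le_of_le hf.2 hg.2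
  rw [← Polynomial.coeff_X_mul, ← Polynomial.coeff_X_mul]
  rw [show Polynomial.X * (Polynomial.X * (f.im * g.im)) = Polynomial.X * f.im * (Polynomial.X * g.im) by ring]
  exact Polynomial.coeff_eq_zero_of_natDegree_lt (by omega)

lemma re_mul' (f g : CircleRing b) :
    (f * g).re = f.re * g.re - Polynomial.X * f.im * (Polynomial.X * g.im) + Polynomial.C b * (f.im * g.im) := by
  rw [re_mul]; ring

lemma X_im_mul (f g : CircleRing b) :
    Polynomial.X * (f * g).im = f.re * (Polynomial.X * g.im) + Polynomial.X * f.im * g.re := by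
  rw [im_mul]; ring

lemma mul_mem_filt {m n : ℕ} {f g : CircleRing b} (hf : f ∈ filt b m) (hg : g ∈ filt b n) :
    f * g ∈ filt b (m + n) := by
  constructor
  · rw [re_mul']
    refine Polynomial.natDegree_add_le_of_degree_le ((Polynomial.natDegree_sub_le_of_le
      (Polynomial.natDegree_mul_le_of_le hf.1 hg.1)
      (Polynomial.natDegree_mul_le_of_le hf.2 hg.2)).trans_eq (max_self _)) ?_
    refine Polynomial.natDegree_le_iff_coeff_eq_zero.2 fun j hj => ?_
    rw [Polynomial.coeff_C_mul, coeff_im_mul_im hf hg (by omega), mul_zero]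
  · rw [X_im_mul]
    exact Polynomial.natDegree_add_le_of_degree_le (Polynomial.natDegree_mul_le_of_le hf.1 hg.2)
      (Polynomial.natDegree_mul_le_of_le hf.2 hg.1)

lemma lead_mul_fst {m n : ℕ} {f g : CircleRing b} (hf : f ∈ filt b m) (hg : g ∈ filt b n) :
    (lead b (m + n) (f * g)).1 =
      (lead b m f).1 * (lead b n g).1 - (lead b m f).2 * (lead b n g).2 := by
  simp only [lead_fst, lead_snd]
  rw [re_mul', Polynomial.coeff_add, Polynomial.coeff_sub, Polynomial.coeff_C_mul, coeff_im_mul_im hf hg le_rfl,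
    Polynomial.coeff_mul_add_eq_of_natDegree_le hf.1 hg.1, Polynomial.coeff_mul_add_eq_of_natDegree_le hf.2 hg.2]
  ring

lemma lead_mul_snd {m n : ℕ} {f g : CircleRing b} (hf : f ∈ filt b m) (hg : g ∈ filt b n) :
    (lead b (m + n) (f * g)).2 =
      (lead b m f).1 * (lead b n g).2 + (lead b m f).2 * (lead b n g).1 := by
  simp only [lead_fst, lead_snd]
  rw [X_im_mul, Polynomial.coeff_add, Polynomial.coeff_mul_add_eq_of_natDegree_le hf.1 hg.2,
    Polynomial.coeff_mul_add_eq_of_natDegree_le hf.2 hg.1]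

lemma coeff_norm {m : ℕ} {f : CircleRing b} (hf : f ∈ filt b m) :
    (norm f).coeff (m + m) = (lead b m f).1 ^ 2 + (lead b m f).2 ^ 2 := by
  have : norm f = f.re * f.re + Polynomial.X * f.im * (Polynomial.X * f.im) - Polynomial.C b * (f.im * f.im) := by
    rw [norm_def]; ring
  simp only [lead_fst, lead_snd]
  rw [this, Polynomial.coeff_sub, Polynomial.coeff_add, Polynomial.coeff_C_mul, coeff_im_mul_im hf hf le_rfl,
    Polynomial.coeff_mul_add_eq_of_natDegree_le hf.1 hf.1, Polynomial.coeff_mul_add_eq_of_natDegree_le hf.2 hf.2]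
  ring

lemma Polynomial.natDegree_norm_le {m : ℕ} {f : CircleRing b} (hf : f ∈ filt b m) :
    (norm f).natDegree ≤ m + m := by
  have : norm f = f.re * f.re + Polynomial.X * f.im * (Polynomial.X * f.im) - Polynomial.C b * (f.im * f.im) := by
    rw [norm_def]; ring
  rw [this]
  refine (Polynomial.natDegree_sub_le_of_le (Polynomial.natDegree_add_le_of_degree_le
    (Polynomial.natDegree_mul_le_of_le hf.1 hf.1) (Polynomial.natDegree_mul_le_of_le hf.2 hf.2))
    (?_ : _ ≤ m + m)).trans_eq (max_self _)
  refine Polynomial.natDegree_le_iff_coeff_eq_zero.2 fun j hj => ?_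
  rw [Polynomial.coeff_C_mul, coeff_im_mul_im hf hf (by omega), mul_zero]

lemma exists_lead_ne_zero {f : CircleRing b} (hf : f ≠ 0) :
    ∃ m, f ∈ filt b m ∧ lead b m f ≠ 0 := by
  refine ⟨max f.re.natDegree (Polynomial.X * f.im).natDegree, ⟨le_max_left _ _, le_max_right _ _⟩, ?_⟩
  intro h
  have h1 : f.re.coeff _ = 0 := congrArg Prod.fst h
  have h2 : (Polynomial.X * f.im).coeff _ = 0 := congrArg Prod.snd h
  have key : f.re = 0 ∧ Polynomial.X * f.im = 0 := by
    rcases le_total f.re.natDegree (Polynomial.X * f.im).natDegree with h | h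
    · rw [max_eq_right h] at h1 h2
      have h3 : Polynomial.X * f.im = 0 := Polynomial.leadingCoeff_eq_zero.1 h2
      rw [h3, Polynomial.natDegree_zero] at h1 h
      refine ⟨?_, h3⟩
      rw [Polynomial.eq_C_of_natDegree_le_zero h, h1, Polynomial.C_0]
    · rw [max_eq_left h] at h1 h2
      have h3 : f.re = 0 := Polynomial.leadingCoeff_eq_zero.1 h1
      rw [h3, Polynomial.natDegree_zero] at h2 h
      refine ⟨h3, ?_⟩
      rw [Polynomial.eq_C_of_natDegree_le_zero h, h2, Polynomial.C_0]
  apply hf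
  ext1
  · exact key.1
  · simpa using key.2

/-- The degree of an element, i.e. the pole order at infinity. -/
def dg (f : CircleRing b) : ℕ := (norm f).natDegree / 2

variable [hk : Fact (¬ IsSumSq (-1 : k))]

lemma sq_add_sq_eq_zero {F : Type*} [Field F] (hF : ¬ IsSumSq (-1 : F)) {p q : F}
    (h : p ^ 2 + q ^ 2 = 0) : p = 0 ∧ q = 0 := by
  have h1 := eq_zero_of_add_isSumSq hF (isSumSq_sq p) (isSumSq_sq q) h
  rw [h1, zero_add] at h
  exact ⟨pow_eq_zero_iff two_ne_zero |>.1 h1, pow_eq_zero_iff two_ne_zero |>.1 h⟩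

lemma Polynomial.natDegree_norm_eq {m : ℕ} {f : CircleRing b} (hf : f ∈ filt b m) (h : lead b m f ≠ 0) :
    (norm f).natDegree = m + m := by
  refine Polynomial.natDegree_eq_of_le_of_coeff_ne_zero (Polynomial.natDegree_norm_le hf) ?_
  rw [coeff_norm hf]
  intro h0
  exact h (Prod.ext (sq_add_sq_eq_zero hk.out h0).1 (sq_add_sq_eq_zero hk.out h0).2)

lemma dg_eq {m : ℕ} {f : CircleRing b} (hf : f ∈ filt b m) (h : lead b m f ≠ 0) :
    dg f = m := by
  rw [dg, Polynomial.natDegree_norm_eq hf h]; omega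

lemma norm_ne_zero {f : CircleRing b} (hf : f ≠ 0) : norm f ≠ 0 := by
  obtain ⟨m, hm, hl⟩ := exists_lead_ne_zero hf
  intro h
  have := coeff_norm hm
  rw [h, Polynomial.coeff_zero] at this
  exact hl (Prod.ext (sq_add_sq_eq_zero hk.out this.symm).1
    (sq_add_sq_eq_zero hk.out this.symm).2)

instance : NoZeroDivisors (CircleRing b) where
  eq_zero_or_eq_zero_of_mul_eq_zero {f g} h := by
    by_contra! hc
    have := congrArg QuadraticAlgebra.norm h
    rw [map_mul, QuadraticAlgebra.norm_zero] at this
    exact mul_ne_zero (norm_ne_zero hc.1) (norm_ne_zero hc.2) this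

instance : IsDomain (CircleRing b) := NoZeroDivisors.to_isDomain _

lemma two_dg {f : CircleRing b} (hf : f ≠ 0) : (norm f).natDegree = 2 * dg f := by
  obtain ⟨m, hm, hl⟩ := exists_lead_ne_zero hf
  rw [dg_eq hm hl, Polynomial.natDegree_norm_eq hm hl, two_mul]

lemma dg_mul {f g : CircleRing b} (hf : f ≠ 0) (hg : g ≠ 0) : dg (f * g) = dg f + dg g := by
  have := two_dg (mul_ne_zero hf hg)
  rw [map_mul, Polynomial.natDegree_mul (norm_ne_zero hf) (norm_ne_zero hg), two_dg hf, two_dg hg] at this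
  omega

lemma mem_filt_dg (f : CircleRing b) : f ∈ filt b (dg f) := by
  rcases eq_or_ne f 0 with rfl | hf
  · exact zero_mem _
  obtain ⟨m, hm, hl⟩ := exists_lead_ne_zero hf
  rwa [dg_eq hm hl]

lemma lead_dg_ne_zero {f : CircleRing b} (hf : f ≠ 0) : lead b (dg f) f ≠ 0 := by
  obtain ⟨m, hm, hl⟩ := exists_lead_ne_zero hf
  rwa [dg_eq hm hl]

omit hk in
lemma dg_le_of_mem {m : ℕ} {f : CircleRing b} (h : f ∈ filt b m) : dg f ≤ m := by
  have := Polynomial.natDegree_norm_le h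
  rw [dg]; omega

lemma mem_filt_iff {m : ℕ} {f : CircleRing b} : f ∈ filt b m ↔ dg f ≤ m :=
  ⟨dg_le_of_mem, fun h => filt_mono h (mem_filt_dg f)⟩

lemma dg_lt_of_lead {m : ℕ} {f : CircleRing b} (h0 : f ≠ 0) (hf : f ∈ filt b m)
    (h : lead b m f = 0) : dg f < m := by
  refine lt_of_le_of_ne (dg_le_of_mem hf) fun hm => ?_
  subst hm
  exact lead_dg_ne_zero h0 h

omit hk in
/-- Constants. -/
lemma algebraMap_eq_mk (c : k) : algebraMap k (CircleRing b) c = ⟨Polynomial.C c, 0⟩ := rfl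

omit hk in
lemma exists_of_mem_filt_zero {f : CircleRing b} (hf : f ∈ filt b 0) :
    ∃ c : k, f = algebraMap k _ c := by
  refine ⟨f.re.coeff 0, ?_⟩
  have h2 : f.im = 0 := by
    by_contra h
    have := hf.2
    rw [Polynomial.natDegree_X_mul h] at this
    omega
  ext1
  · exact Polynomial.eq_C_of_natDegree_le_zero hf.1
  · exact h2

lemma isUnit_of_dg_eq_zero {f : CircleRing b} (h0 : f ≠ 0) (hf : dg f = 0) : IsUnit f := by
  obtain ⟨c, rfl⟩ := exists_of_mem_filt_zero (mem_filt_iff.2 hf.le)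
  have hc : c ≠ 0 := by rintro rfl; simp at h0
  exact (IsUnit.mk0 c hc).map _

omit hk in
/-- Elements with prescribed leading coefficient. -/
lemma exists_lead (b : k) {m : ℕ} (hm : m ≠ 0) (v : k × k) :
    ∃ f ∈ filt b m, lead b m f = v := by
  obtain ⟨n, rfl⟩ := Nat.exists_eq_succ_of_ne_zero hm
  refine ⟨⟨Polynomial.C v.1 * Polynomial.X ^ (n + 1), Polynomial.C v.2 * Polynomial.X ^ n⟩, ⟨Polynomial.natDegree_C_mul_X_pow_le _ _, ?_⟩, ?_⟩
  · change (Polynomial.X * (Polynomial.C v.2 * Polynomial.X ^ n)).natDegree ≤ _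
    rw [show Polynomial.X * (Polynomial.C v.2 * Polynomial.X ^ n) = Polynomial.C v.2 * Polynomial.X ^ (n + 1) by ring]
    exact Polynomial.natDegree_C_mul_X_pow_le _ _
  · refine Prod.ext ?_ ?_
    · rw [lead_fst]; simp
    · rw [lead_snd]
      change (Polynomial.X * (Polynomial.C v.2 * Polynomial.X ^ n)).coeff _ = _
      rw [show Polynomial.X * (Polynomial.C v.2 * Polynomial.X ^ n) = Polynomial.C v.2 * Polynomial.X ^ (n + 1) by ring]
      simp

/-- Cancelling leading terms. -/
lemma exists_sub_mul_dg_lt {f g : CircleRing b} (hg : g ≠ 0) (h : dg g < dg f) :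
    ∃ u, f - u * g = 0 ∨ dg (f - u * g) < dg f := by
  set w := lead b (dg g) g with hw
  set v := lead b (dg f) f with hv
  have hn : w.1 ^ 2 + w.2 ^ 2 ≠ 0 := fun h0 => lead_dg_ne_zero hg
    (Prod.ext (sq_add_sq_eq_zero hk.out h0).1 (sq_add_sq_eq_zero hk.out h0).2)
  obtain ⟨u, hu, hl⟩ := exists_lead b (m := dg f - dg g) (by omega)
    ((v.1 * w.1 + v.2 * w.2) / (w.1 ^ 2 + w.2 ^ 2),
      (v.2 * w.1 - v.1 * w.2) / (w.1 ^ 2 + w.2 ^ 2))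
  have hd : dg f - dg g + dg g = dg f := by omega
  have hug : u * g ∈ filt b (dg f) := by
    have := mul_mem_filt hu (mem_filt_dg g)
    rwa [hd] at this
  have hlug : lead b (dg f) (u * g) = v := by
    have h1 := lead_mul_fst hu (mem_filt_dg g)
    have h2 := lead_mul_snd hu (mem_filt_dg g)
    rw [hd, hl, ← hw] at h1 h2
    refine Prod.ext ?_ ?_
    · rw [h1]; field_simp; ring
    · rw [h2]; field_simp; ring
  refine ⟨u, or_iff_not_imp_left.2 fun h0 => ?_⟩
  exact dg_lt_of_lead h0 (sub_mem (mem_filt_dg f) hug) (by rw [map_sub, hlug, ← hv, sub_self])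

/-- The coordinate functions. -/
def xc (b : k) : CircleRing b := ⟨Polynomial.X, 0⟩
/-- The coordinate functions. -/
def yc (b : k) : CircleRing b := ⟨0, 1⟩

omit hk in
lemma xc_sq_add_yc_sq : xc b ^ 2 + yc b ^ 2 = algebraMap k _ b := by
  rw [algebraMap_eq_mk]
  ext1 <;> simp [xc, yc, sq]

omit hk in
lemma xc_mem : xc b ∈ filt b 1 := by
  simp [mem_filt, xc]

omit hk in
lemma yc_mem : yc b ∈ filt b 1 := by
  simp [mem_filt, yc]

lemma isPrincipalIdealRing (hb : ∀ p q : k, p ^ 2 + q ^ 2 ≠ b) :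
    IsPrincipalIdealRing (CircleRing b) := by
  refine ⟨fun I => ?_⟩
  rcases eq_or_ne I ⊥ with rfl | hI
  · exact bot_isPrincipal
  obtain ⟨g₀, hg₀, hg₀0⟩ := Submodule.exists_mem_ne_zero_of_ne_bot hI
  obtain ⟨g, ⟨hgI, hg0⟩, hgmin⟩ := (measure (dg (b := b))).wf.has_min {g | g ∈ I ∧ g ≠ 0}
    ⟨g₀, hg₀, hg₀0⟩
  have hmin : ∀ f ∈ I, dg f < dg g → f = 0 := fun f hf h => by
    by_contra h0
    exact hgmin f ⟨hf, h0⟩ h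
  refine ⟨g, le_antisymm (fun f₀ hf₀ => ?_) ((Ideal.span_singleton_le_iff_mem I).2 hgI)⟩
  by_contra hfg₀
  obtain ⟨f, ⟨hfI, hfg⟩, hfmin⟩ := (measure (dg (b := b))).wf.has_min
    {f | f ∈ I ∧ f ∉ Ideal.span {g}} ⟨f₀, hf₀, hfg₀⟩
  have hmin' : ∀ f' ∈ I, dg f' < dg f → f' ∈ Ideal.span {g} := fun f' hf h => by
    by_contra h0
    exact hfmin f' ⟨hf, h0⟩ h
  have hgg : ∀ u, u * g ∈ Ideal.span {g} := fun u => Ideal.mul_mem_left _ _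
    (Ideal.mem_span_singleton_self g)
  have hf0 : f ≠ 0 := by rintro rfl; exact hfg (zero_mem _)
  have hd : dg f = dg g := by
    rcases lt_trichotomy (dg f) (dg g) with h | h | h
    · exact absurd (hmin f hfI h) hf0
    · exact h
    · exfalso
      obtain ⟨u, hu⟩ := exists_sub_mul_dg_lt hg0 h
      apply hfg
      have h1 : f - u * g ∈ Ideal.span {g} := by
        rcases hu with hu | hu
        · rw [hu]; exact zero_mem _
        · exact hmin' _ (sub_mem hfI (I.mul_mem_left _ hgI)) hu
      simpa using add_mem h1 (hgg u)
  set d := dg g with hdd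
  have hfm : f ∈ filt b d := hd ▸ mem_filt_dg f
  have hgm : g ∈ filt b d := mem_filt_dg g
  have hsm : ∀ (c : k) (h : CircleRing b), h ∈ I → c • h ∈ I := fun c h hh => by
    rw [Algebra.smul_def]; exact I.mul_mem_left _ hh
  -- elements of `I` of degree `d` are combinations of `f` and `g`
  have hcomb : ∀ h ∈ I, h ∈ filt b d → ∃ c, h - algebraMap k _ c * f ∈ Ideal.span {g} := by
    intro h hh hhm
    set v := lead b d f with hv
    set w := lead b d g with hw
    set z := lead b d h with hz
    have hvw : v.1 * w.2 - v.2 * w.1 ≠ 0 := by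
      intro h0
      have hw0 : w ≠ 0 := lead_dg_ne_zero hg0
      have : ∃ c : k, v = c • w := by
        by_cases h1 : w.1 = 0
        · have h2 : w.2 ≠ 0 := fun h2 => hw0 (Prod.ext h1 h2)
          refine ⟨v.2 / w.2, Prod.ext ?_ ?_⟩
          · rw [h1, mul_zero, sub_zero, mul_eq_zero, or_iff_left h2] at h0
            rw [Prod.smul_fst, h0, h1, smul_zero]
          · rw [Prod.smul_snd, smul_eq_mul, div_mul_cancel₀ _ h2]
        · refine ⟨v.1 / w.1, Prod.ext ?_ ?_⟩
          · rw [Prod.smul_fst, smul_eq_mul, div_mul_cancel₀ _ h1]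
          · rw [Prod.smul_snd, smul_eq_mul]
            field_simp
            linear_combination -h0
      obtain ⟨c, hc⟩ := this
      have h3 : f - c • g ∈ I := sub_mem hfI (hsm c g hgI)
      have h4 : f - c • g ≠ 0 := by
        intro h5
        apply hfg
        rw [sub_eq_zero.1 h5, Algebra.smul_def]
        exact hgg _
      refine h4 (hmin _ h3 (dg_lt_of_lead h4 (sub_mem hfm (Submodule.smul_mem _ _ hgm)) ?_))
      rw [map_sub, map_smul, ← hv, hc, ← hw, sub_self]
    set D := v.1 * w.2 - v.2 * w.1 with hD
    refine ⟨(z.1 * w.2 - z.2 * w.1) / D, ?_⟩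
    set c₁ := (z.1 * w.2 - z.2 * w.1) / D with hc₁
    set c₂ := (v.1 * z.2 - v.2 * z.1) / D with hc₂
    have h1 : h - c₁ • f - c₂ • g ∈ I := sub_mem (sub_mem hh (hsm _ _ hfI)) (hsm _ _ hgI)
    have h2 : h - c₁ • f - c₂ • g = 0 := by
      by_contra h0
      refine h0 (hmin _ h1 (dg_lt_of_lead h0 (sub_mem (sub_mem hhm
        (Submodule.smul_mem _ _ hfm)) (Submodule.smul_mem _ _ hgm)) ?_))
      rw [map_sub, map_sub, map_smul, map_smul, ← hv, ← hw, ← hz]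
      refine Prod.ext ?_ ?_
      · simp only [Prod.fst_sub, Prod.smul_fst, smul_eq_mul, Prod.fst_zero, hc₁, hc₂]
        field_simp
        rw [hD]; ring
      · simp only [Prod.snd_sub, Prod.smul_snd, smul_eq_mul, Prod.snd_zero, hc₁, hc₂]
        field_simp
        rw [hD]; ring
    rw [← Algebra.smul_def, sub_eq_zero.1 h2, Algebra.smul_def]
    exact hgg _
  have hlin : ∀ u ∈ filt b 1, ∃ c, (u - algebraMap k _ c) * f ∈ Ideal.span {g} := by
    intro u hu
    have hum : u * f ∈ filt b (d + 1) := by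
      rw [add_comm]; exact mul_mem_filt hu hfm
    have : ∃ t, u * f - t * g ∈ filt b d := by
      by_cases h : dg g < dg (u * f)
      · obtain ⟨t, ht⟩ := exists_sub_mul_dg_lt hg0 h
        refine ⟨t, ?_⟩
        rcases ht with ht | ht
        · rw [ht]; exact zero_mem _
        · rw [mem_filt_iff] at *
          omega
      · exact ⟨0, by rw [zero_mul, sub_zero, mem_filt_iff]; omega⟩
    obtain ⟨t, ht⟩ := this
    obtain ⟨c, hc⟩ := hcomb _ (sub_mem (I.mul_mem_left u hfI) (I.mul_mem_left t hgI)) ht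
    refine ⟨c, ?_⟩
    have := add_mem hc (hgg t)
    convert this using 1
    ring
  obtain ⟨p, hp⟩ := hlin _ xc_mem
  obtain ⟨q, hq⟩ := hlin _ yc_mem
  have h1 : algebraMap k _ (b - p ^ 2 - q ^ 2) * f ∈ Ideal.span {g} := by
    have := add_mem ((Ideal.span {g}).mul_mem_left (xc b + algebraMap k _ p) hp)
      ((Ideal.span {g}).mul_mem_left (yc b + algebraMap k _ q) hq)
    convert this using 1
    rw [map_sub, map_sub, ← xc_sq_add_yc_sq, map_pow, map_pow]
    ring
  have hne : b - p ^ 2 - q ^ 2 ≠ 0 := fun h => hb p q (by linear_combination -h)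
  apply hfg
  have := (Ideal.span {g}).mul_mem_left (algebraMap k _ (b - p ^ 2 - q ^ 2)⁻¹) h1
  rwa [← mul_assoc, ← map_mul, inv_mul_cancel₀ hne, map_one, one_mul] at this

lemma finrank_quotient {f : CircleRing b} (hf : f ≠ 0) :
    Module.finrank k (CircleRing b ⧸ Ideal.span {f}) = 2 * dg f := by
  rw [finrank_quotient_span_eq_natDegree_norm (QuadraticAlgebra.basis _ _) hf, ← two_dg hf,
    Algebra.norm_apply, ← det_toLinearMap_eq_norm]
  rfl

omit hk in
/-- The space of elements of degree at most `m` as pairs of polynomials. -/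
lemma finrank_filt (b : k) (m : ℕ) : Module.finrank k (filt b m) = 2 * m + 1 := by
  have hmem : ∀ f : CircleRing b, f ∈ filt b m ↔
      f.re ∈ Polynomial.degreeLT k (m + 1) ∧ f.im ∈ Polynomial.degreeLT k m := by
    intro f
    rw [mem_filt, Polynomial.mem_degreeLT, Polynomial.mem_degreeLT,
      Polynomial.degree_lt_iff_coeff_zero, Polynomial.degree_lt_iff_coeff_zero,
      Polynomial.natDegree_le_iff_coeff_eq_zero, Polynomial.natDegree_le_iff_coeff_eq_zero]
    refine and_congr Iff.rfl ⟨fun h j hj => ?_, fun h j hj => ?_⟩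
    · rw [← Polynomial.coeff_X_mul]
      exact h _ (by omega)
    · obtain ⟨j, rfl⟩ := Nat.exists_eq_succ_of_ne_zero (n := j) (by omega)
      rw [Nat.succ_eq_add_one, Polynomial.coeff_X_mul]
      exact h _ (by omega)
  let e : filt b m ≃ₗ[k] Polynomial.degreeLT k (m + 1) × Polynomial.degreeLT k m :=
    { toFun f := (⟨f.1.re, ((hmem _).1 f.2).1⟩, ⟨f.1.im, ((hmem _).1 f.2).2⟩)
      invFun p := ⟨⟨p.1.1, p.2.1⟩, (hmem _).2 ⟨p.1.2, p.2.2⟩⟩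
      map_add' _ _ := rfl
      map_smul' _ _ := rfl
      left_inv _ := rfl
      right_inv _ := rfl }
  rw [e.finrank_eq, Module.finrank_prod, (Polynomial.degreeLTEquiv k _).finrank_eq,
    (Polynomial.degreeLTEquiv k _).finrank_eq]
  simp
  omega

end CircleRing

end CircleRing

namespace CircleRing

open QuadraticAlgebra

section Eval

variable {k S : Type*} [Field k] [CommRing S] {b : k}

/-- Evaluation of functions on the circle at a point. -/
def evalHom (φ : k →+* S) (x y : S) (h : x ^ 2 + y ^ 2 = φ b) : CircleRing b →+* S where
  toFun f := f.re.eval₂ φ x + f.im.eval₂ φ x * y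
  map_one' := by simp [QuadraticAlgebra.re_one, QuadraticAlgebra.im_one]
  map_zero' := by simp
  map_add' f g := by
    simp only [re_add, im_add, Polynomial.eval₂_add]; ring
  map_mul' f g := by
    simp only [re_mul, im_mul, Polynomial.eval₂_add, Polynomial.eval₂_mul, Polynomial.eval₂_sub,
      Polynomial.eval₂_C, Polynomial.eval₂_pow, Polynomial.eval₂_X, Polynomial.eval₂_zero]
    linear_combination -f.im.eval₂ φ x * g.im.eval₂ φ x * h

lemma evalHom_apply (φ : k →+* S) (x y : S) (h : x ^ 2 + y ^ 2 = φ b) (f : CircleRing b) :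
    evalHom φ x y h f = f.re.eval₂ φ x + f.im.eval₂ φ x * y := rfl

@[simp] lemma evalHom_algebraMap (φ : k →+* S) (x y : S) (h : x ^ 2 + y ^ 2 = φ b) (c : k) :
    evalHom φ x y h (algebraMap k _ c) = φ c := by
  rw [evalHom_apply, algebraMap_eq_mk]; simp

@[simp] lemma evalHom_xc (φ : k →+* S) (x y : S) (h : x ^ 2 + y ^ 2 = φ b) :
    evalHom φ x y h (xc b) = x := by
  rw [evalHom_apply, xc]; simp

@[simp] lemma evalHom_yc (φ : k →+* S) (x y : S) (h : x ^ 2 + y ^ 2 = φ b) :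
    evalHom φ x y h (yc b) = y := by
  rw [evalHom_apply, yc]; simp

end Eval

end CircleRing

lemma isSumSq_map {R S : Type*} [CommRing R] [CommRing S] (f : R →+* S) {x : R}
    (h : IsSumSq x) : IsSumSq (f x) := by
  induction h with
  | zero => rw [map_zero]; exact .zero
  | sq_add a _ ih => rw [map_add, map_mul]; exact .sq_add _ ih

section

variable {F : Type*} [CommRing F]

/-- Every sum of squares is the multiplier of a similitude of a sum of squares form. -/
lemma exists_similitude {c : F} (hc : IsSumSq c) :
    ∃ (n : ℕ) (T : Matrix (Fin (n + 1)) (Fin (n + 1)) F),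
      T * T.transpose = c • 1 ∧ T.transpose * T = c • 1 := by
  suffices h : ∃ (ι : Type) (_ : Fintype ι) (_ : DecidableEq ι) (_ : Nonempty ι)
      (T : Matrix ι ι F), T * T.transpose = c • 1 ∧ T.transpose * T = c • 1 by
    obtain ⟨ι, _, _, _, T, h1, h2⟩ := h
    obtain ⟨n, hn⟩ := Nat.exists_eq_succ_of_ne_zero (Fintype.card_ne_zero (α := ι))
    let e : ι ≃ Fin (n + 1) := Fintype.equivFinOfCardEq hn
    refine ⟨n, T.submatrix e.symm e.symm, ?_, ?_⟩
    · rw [Matrix.transpose_submatrix, Matrix.submatrix_mul_equiv, h1]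
      simp [Matrix.submatrix_smul]
    · rw [Matrix.transpose_submatrix, Matrix.submatrix_mul_equiv, h2]
      simp [Matrix.submatrix_smul]
  induction hc with
  | zero => exact ⟨Unit, inferInstance, inferInstance, inferInstance, 0, by simp, by simp⟩
  | @sq_add a s _ ih =>
    obtain ⟨ι, _, _, _, T, h1, h2⟩ := ih
    refine ⟨ι ⊕ ι, inferInstance, inferInstance, inferInstance,
      Matrix.fromBlocks T (a • 1) (-(a • 1)) T.transpose, ?_, ?_⟩
    · rw [Matrix.fromBlocks_transpose, Matrix.fromBlocks_multiply, ← Matrix.fromBlocks_one,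
        Matrix.fromBlocks_smul]
      congr 1 <;> simp [h1, h2, smul_smul, add_smul, add_comm]
    · rw [Matrix.fromBlocks_transpose, Matrix.fromBlocks_multiply, ← Matrix.fromBlocks_one,
        Matrix.fromBlocks_smul]
      congr 1 <;> simp [h1, h2, smul_smul, add_smul, add_comm]

end

namespace CircleRing

open QuadraticAlgebra

set_option linter.unusedSectionVars false

variable {k : Type*} [Field k] {b : k} [hk : Fact (¬ IsSumSq (-1 : k))]
  [hb : Fact (∀ p q : k, p ^ 2 + q ^ 2 ≠ b)]

instance : IsPrincipalIdealRing (CircleRing b) := isPrincipalIdealRing hb.out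

/-- The primes with formally real residue field. -/
def RealPrime (p : CircleRing b) : Prop :=
  Prime p ∧ ¬ IsSumSq (-1 : CircleRing b ⧸ Ideal.span {p})

lemma isMaximal_of_prime {p : CircleRing b} (hp : Prime p) : (Ideal.span {p}).IsMaximal :=
  IsPrime.to_maximal_ideal (hpi := (Ideal.span_singleton_prime hp.ne_zero).2 hp)
    (by simpa using hp.ne_zero)

omit hk hb in
lemma mk_eq_zero_iff (p x : CircleRing b) : Ideal.Quotient.mk (Ideal.span {p}) x = 0 ↔ p ∣ x := by
  rw [Ideal.Quotient.eq_zero_iff_mem, Ideal.mem_span_singleton]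

/-- The residue field at a prime. -/
@[reducible] def resField {p : CircleRing b} (hp : Prime p) : Field (CircleRing b ⧸ Ideal.span {p}) :=
  haveI := isMaximal_of_prime hp
  Ideal.Quotient.field _

lemma one_le_dg {p : CircleRing b} (hp : Prime p) : 1 ≤ dg p := by
  by_contra! h
  exact hp.not_isUnit (isUnit_of_dg_eq_zero hp.ne_zero (by omega))

lemma dg_le_of_dvd {p f : CircleRing b} (hf : f ≠ 0) (h : p ∣ f) : dg p ≤ dg f := by
  obtain ⟨g, rfl⟩ := h
  rw [dg_mul (left_ne_zero_of_mul hf) (right_ne_zero_of_mul hf)]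
  omega

omit hb in
lemma dg_of_isUnit {f : CircleRing b} (hf : IsUnit f) : dg f = 0 := by
  obtain ⟨g, h⟩ := hf.exists_right_inv
  have h1 : dg (1 : CircleRing b) = 0 := by rw [dg, map_one]; simp
  have hf0 : f ≠ 0 := hf.ne_zero
  have hg0 : g ≠ 0 := by rintro rfl; simp at h
  have := dg_mul hf0 hg0
  rw [h, h1] at this
  omega

/-- The value at infinity of a form representing the residue of a linear prime. -/
lemma exists_of_isSumSq_quadratic {e : k} {z : QuadraticAlgebra k (-e) 0} (hz : IsSumSq z) :
    ∃ s t : k, IsSumSq s ∧ IsSumSq t ∧ z.re = s - e * t := by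
  induction hz with
  | zero => exact ⟨0, 0, .zero, .zero, by simp⟩
  | @sq_add a z _ ih =>
    obtain ⟨s, t, hs, ht, h⟩ := ih
    refine ⟨a.re * a.re + s, a.im * a.im + t, .sq_add _ hs, .sq_add _ ht, ?_⟩
    rw [re_add, re_mul, h]; ring

variable {K : Type*} [Field K] [Algebra (CircleRing b) K] [IsFractionRing (CircleRing b) K]

/-- Products of constants and sums of squares. -/
def ConstSumSq (b : k) (K : Type*) [Field K] [Algebra (CircleRing b) K] (z : K) : Prop :=
  ∃ c : k, c ≠ 0 ∧ IsSumSq (algebraMap (CircleRing b) K (algebraMap k _ c) * z)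

omit hk hb in
lemma ConstSumSq.mul {z w : K} (hz : ConstSumSq b K z) (hw : ConstSumSq b K w) :
    ConstSumSq b K (z * w) := by
  obtain ⟨c, hc, h⟩ := hz
  obtain ⟨d, hd, h'⟩ := hw
  refine ⟨c * d, mul_ne_zero hc hd, ?_⟩
  rw [map_mul, map_mul]
  convert h.mul h' using 1
  ring

omit hk hb in
lemma constSumSq_of_isSumSq {z : K} (hz : IsSumSq z) : ConstSumSq b K z :=
  ⟨1, one_ne_zero, by simpa using hz⟩

lemma algebraMap_const_ne_zero {c : k} (hc : c ≠ 0) :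
    algebraMap (CircleRing b) K (algebraMap k _ c) ≠ 0 := by
  intro h
  rw [map_eq_zero_iff _ (IsFractionRing.injective _ K)] at h
  exact hc (by simpa using h)

lemma constSumSq_const {c : k} (hc : c ≠ 0) :
    ConstSumSq b K (algebraMap (CircleRing b) K (algebraMap k _ c)) :=
  ⟨c, hc, IsSumSq.mul_self _⟩

lemma EvenAt.of_mul {R F : Type*} [CommRing R] [IsDomain R] [Algebra R K] [IsFractionRing R K]
    [Field F] {φ : R →+* F} {f g : K} (hf : EvenAt φ f) (hfg : EvenAt φ (f * g)) : EvenAt φ g := by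
  obtain ⟨z, hz, u, hu, h⟩ := hf
  obtain ⟨z', hz', u', hu', h'⟩ := hfg
  have hu0 : algebraMap R K u ≠ 0 := by
    intro h0
    rw [map_eq_zero_iff _ (IsFractionRing.injective R K)] at h0
    exact hu (by rw [h0, map_zero])
  refine ⟨z' / (z * algebraMap R K u), div_ne_zero hz' (mul_ne_zero hz hu0), u * u', ?_, ?_⟩
  · rw [map_mul]; exact mul_ne_zero hu hu'
  · rw [h] at h'
    rw [map_mul]
    field_simp
    linear_combination h'

variable (b K) in
/-- Even value at all formally real primes. -/
def EvenReal (f : K) : Prop :=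
  ∀ q : CircleRing b, ∀ hq : RealPrime q,
    letI := resField hq.1
    EvenAt (Ideal.Quotient.mk (Ideal.span {q})) f

lemma evenAt_mk {p f : CircleRing b} (hp : Prime p) (h : ¬ p ∣ f) :
    letI := resField hp
    EvenAt (Ideal.Quotient.mk (Ideal.span {p})) (algebraMap (CircleRing b) K f) :=
  ⟨1, one_ne_zero, f, by rwa [Ne, mk_eq_zero_iff], by simp⟩

lemma RealPrime.of_associated {p q : CircleRing b} (hp : RealPrime p) (h : Associated p q) :
    RealPrime q := by
  refine ⟨h.prime_iff.1 hp.1, ?_⟩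
  rw [← Ideal.span_singleton_eq_span_singleton.2 h]
  exact hp.2

lemma constSumSq_of_evenReal {n : ℕ} (IH : ∀ q : CircleRing b, Prime q → dg q < n →
      ¬ RealPrime q → ConstSumSq b K (algebraMap _ K q)) :
    ∀ (m : ℕ) (h : CircleRing b), dg h = m → m < n → h ≠ 0 →
      EvenReal b K (algebraMap _ K h) → ConstSumSq b K (algebraMap _ K h) := by
  intro m
  induction m using Nat.strong_induction_on with
  | _ m ih =>
  intro h hm hmn h0 hev
  rcases Nat.eq_zero_or_pos m with rfl | hm0
  · obtain ⟨c, rfl⟩ := exists_of_mem_filt_zero (mem_filt_iff.2 hm.le)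
    exact constSumSq_const (by rintro rfl; simp at h0)
  have hu : ¬ IsUnit h := fun hu => by rw [dg_of_isUnit hu] at hm; omega
  obtain ⟨q, hq, g, rfl⟩ := WfDvdMonoid.exists_irreducible_factor hu h0
  replace hq : Prime q := hq.prime
  have hq0 := hq.ne_zero
  have hg0 : g ≠ 0 := right_ne_zero_of_mul h0
  have hd := dg_mul hq0 hg0
  have hq1 := one_le_dg hq
  by_cases hqr : RealPrime q
  · let _inst := resField hq
    have hqg : q ∣ g := by
      by_contra hqg
      obtain ⟨z, hz, u, hu, hzu⟩ := hev q hqr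
      refine not_even_and_odd (K := K) (z := z) (z' := 1) hq (mk_eq_zero_iff q) one_ne_zero hu
        (u' := g) (by rwa [Ne, mk_eq_zero_iff]) ?_
      rw [← hzu, map_mul]; ring
    obtain ⟨f, rfl⟩ := hqg
    have hf0 : f ≠ 0 := right_ne_zero_of_mul hg0
    have hd' := dg_mul hq0 hf0
    have hq' : algebraMap (CircleRing b) K q ≠ 0 := by simpa using hq0
    have := ih (dg f) (by omega) f rfl (by omega) hf0 (fun p hp => by
      obtain ⟨z, hz, u, hu, hzu⟩ := hev p hp
      refine ⟨z / algebraMap _ K q, div_ne_zero hz hq', u, hu, ?_⟩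
      rw [map_mul, map_mul] at hzu
      field_simp
      linear_combination hzu)
    have h2 := (constSumSq_of_isSumSq (b := b) (IsSumSq.mul_self (algebraMap _ K q))).mul this
    rw [map_mul, map_mul, ← mul_assoc]
    exact h2
  · rw [map_mul]
    refine (IH q hq (by omega) hqr).mul (ih (dg g) (by omega) g rfl (by omega) hg0 fun p hp => ?_)
    have hpev := hev p hp
    rw [map_mul] at hpev
    let _inst := resField hp.1
    refine EvenAt.of_mul (evenAt_mk hp.1 fun hpq => hqr ?_) hpev
    exact hp.of_associated ((hp.1.dvd_prime_iff_associated hq).1 hpq)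

/-- A linear prime with nonreal residue field. -/
lemma constSumSq_of_dg_one (hK : ¬ IsSumSq (-1 : K)) {p : CircleRing b} (hp : Prime p)
    (h1 : dg p = 1) (hr : ¬ RealPrime p) : ConstSumSq b K (algebraMap _ K p) := by
  obtain ⟨α, β, γ, hpe, hn0⟩ : ∃ α β γ : k, p = algebraMap k _ α + algebraMap k _ β * xc b +
      algebraMap k _ γ * yc b ∧ β ^ 2 + γ ^ 2 ≠ 0 := by
    have hm := mem_filt_iff.2 h1.le
    have hl := lead_dg_ne_zero hp.ne_zero
    rw [h1] at hl
    have him : p.im.natDegree ≤ 0 := by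
      by_cases h : p.im = 0
      · simp [h]
      · have := hm.2
        rw [Polynomial.natDegree_X_mul h] at this
        omega
    refine ⟨p.re.coeff 0, p.re.coeff 1, p.im.coeff 0, ?_, fun h0 => hl (Prod.ext ?_ ?_)⟩
    · ext1
      · conv_lhs => rw [Polynomial.eq_X_add_C_of_natDegree_le_one hm.1]
        simp [algebraMap_eq_mk, xc, yc]
        ring
      · conv_lhs => rw [Polynomial.eq_C_of_natDegree_le_zero him]
        simp [algebraMap_eq_mk, xc, yc]
    · exact (sq_add_sq_eq_zero hk.out h0).1
    · rw [lead_snd, Polynomial.coeff_X_mul]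
      exact (sq_add_sq_eq_zero hk.out h0).2
  set n := β ^ 2 + γ ^ 2 with hn
  set e := α ^ 2 - n * b with he
  have hes : IsSumSq e := by
    let Q := QuadraticAlgebra k (-e) 0
    let w : Q := ⟨0, 1⟩
    have hw : w * w = algebraMap k Q (-e) := by
      refine QuadraticAlgebra.ext ?_ ?_
      · rw [QuadraticAlgebra.re_mul]
        change 0 * 0 + -e * 1 * 1 = -e
        ring
      · rw [QuadraticAlgebra.im_mul]
        change (0 * 1 + 1 * 0 + 0 * 1 * 1 : k) = 0
        ring
    let x₀ : Q := algebraMap k Q n⁻¹ * (algebraMap k Q (-α * β) - algebraMap k Q γ * w)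
    let y₀ : Q := algebraMap k Q n⁻¹ * (algebraMap k Q (-α * γ) + algebraMap k Q β * w)
    have hxy : x₀ ^ 2 + y₀ ^ 2 = algebraMap k Q b := by
      have : x₀ ^ 2 + y₀ ^ 2 = algebraMap k Q (n⁻¹ ^ 2 * n * α ^ 2) +
          algebraMap k Q (n⁻¹ ^ 2 * n) * (w * w) := by
        simp only [x₀, y₀, hn, map_mul, map_add, map_pow, map_neg]; ring
      rw [this, hw, ← map_mul, ← map_add]
      congr 1
      rw [he]
      field_simp
      ring
    let ψ := evalHom (algebraMap k Q) x₀ y₀ hxy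
    have hψp : ψ p = 0 := by
      rw [hpe]
      simp only [ψ, map_add, map_mul, evalHom_algebraMap, evalHom_xc, evalHom_yc]
      have : algebraMap k Q α + algebraMap k Q β * x₀ + algebraMap k Q γ * y₀ =
          algebraMap k Q (α - n⁻¹ * (n * α)) := by
        simp only [x₀, y₀, hn, map_mul, map_add, map_pow, map_neg, map_sub]; ring
      rw [this, ← map_zero (algebraMap k Q)]
      congr 1
      field_simp
      ring
    let Ψ := Ideal.Quotient.lift (Ideal.span {p}) ψ (fun a ha => by
      obtain ⟨c, rfl⟩ := Ideal.mem_span_singleton.1 ha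
      rw [map_mul, hψp, zero_mul])
    have hneg : IsSumSq (-1 : CircleRing b ⧸ Ideal.span {p}) := by
      by_contra h; exact hr ⟨hp, h⟩
    have := isSumSq_map Ψ hneg
    rw [map_neg, map_one] at this
    obtain ⟨s, t, hs, ht, hst⟩ := exists_of_isSumSq_quadratic this
    rw [re_neg, QuadraticAlgebra.re_one] at hst
    have ht0 : t ≠ 0 := by
      rintro rfl
      apply hk.out
      rw [hst]; simpa using hs
    have : e = (1 + s) / t := by field_simp; linear_combination hst
    rw [this]
    exact isSumSq_div (IsSumSq.one.add hs) ht
  let ι := (algebraMap (CircleRing b) K).comp (algebraMap k (CircleRing b))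
  let w := algebraMap (CircleRing b) K (algebraMap k _ β * yc b - algebraMap k _ γ * xc b)
  have key : ι (2 * α) * algebraMap _ K p = algebraMap _ K p * algebraMap _ K p + ι e + w * w := by
    have : algebraMap k (CircleRing b) (2 * α) * p = p * p + algebraMap k _ e +
        (algebraMap k _ β * yc b - algebraMap k _ γ * xc b) *
        (algebraMap k _ β * yc b - algebraMap k _ γ * xc b) := by
      rw [he, hn, map_sub, map_mul _ _ b, ← xc_sq_add_yc_sq, hpe]
      simp only [map_mul, map_add, map_pow, map_ofNat]
      ring
    simpa [ι, w] using congrArg (algebraMap (CircleRing b) K) this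
  have hsum : IsSumSq (ι (2 * α) * algebraMap _ K p) := by
    rw [key]
    exact ((IsSumSq.mul_self _).add (isSumSq_map ι hes)).add (IsSumSq.mul_self _)
  refine ⟨2 * α, fun h0 => ?_, hsum⟩
  rw [h0, map_zero, zero_mul] at key
  have := eq_zero_of_add_isSumSq hK (IsSumSq.mul_self (algebraMap _ K p))
    ((isSumSq_map ι hes).add (IsSumSq.mul_self w)) (by rw [← add_assoc]; exact key.symm)
  rw [mul_self_eq_zero, map_eq_zero_iff _ (IsFractionRing.injective _ K)] at this
  exact hp.ne_zero this

/-- A square matrix preserves some nonzero vector with entries in a subspace of codimension one. -/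
lemma exists_vec_mem {k B : Type*} [Field k] [CommRing B] [Algebra k B] [Module.Finite k B]
    (V : Submodule k B) (hq : Module.finrank k (B ⧸ V) = 1) (hB : 2 < Module.finrank k B)
    {n : ℕ} (T : Matrix (Fin (n + 1)) (Fin (n + 1)) B) :
    ∃ u : Fin (n + 1) → B, u ≠ 0 ∧ (∀ i, u i ∈ V) ∧ ∀ i, T.mulVec u i ∈ V := by
  let M : (Fin (n + 1) → B) →ₗ[k] (Fin (n + 1) → B) := T.mulVecLin.restrictScalars k
  let Q : (Fin (n + 1) → B) →ₗ[k] (Fin (n + 1) → B ⧸ V) :=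
    LinearMap.pi fun i => V.mkQ ∘ₗ LinearMap.proj i
  have hker : LinearMap.ker (Q.prod (Q ∘ₗ M)) ≠ ⊥ := by
    apply LinearMap.ker_ne_bot_of_finrank_lt
    rw [Module.finrank_prod, Module.finrank_pi_fintype, Module.finrank_pi_fintype]
    simp only [hq, Finset.sum_const, Finset.card_univ, Fintype.card_fin, smul_eq_mul]
    nlinarith
  obtain ⟨u, hu, hu0⟩ := Submodule.exists_mem_ne_zero_of_ne_bot hker
  refine ⟨u, hu0, fun i => ?_, fun i => ?_⟩
  · have := congrFun (congrArg Prod.fst (LinearMap.mem_ker.1 hu)) i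
    exact (Submodule.Quotient.mk_eq_zero V).1 this
  · have := congrFun (congrArg Prod.snd (LinearMap.mem_ker.1 hu)) i
    exact (Submodule.Quotient.mk_eq_zero V).1 this

/-- A nonreal prime divides a sum of squares of small degree. -/
lemma exists_sum_sq_eq_mul {p : CircleRing b} (hp : Prime p) (hd : 2 ≤ dg p)
    (hr : ¬ RealPrime p) : ∃ (n : ℕ) (g : Fin n → CircleRing b) (h : CircleRing b),
      (∑ i, g i * g i = p * h) ∧ (∃ i, g i ≠ 0) ∧ ∀ i, g i ∈ filt b (dg p - 1) := by
  classical
  have hneg : IsSumSq (-1 : CircleRing b ⧸ Ideal.span {p}) := by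
    by_contra h; exact hr ⟨hp, h⟩
  obtain ⟨n, T, hT, hT'⟩ := exists_similitude hneg
  let π : CircleRing b →ₗ[k] (CircleRing b ⧸ Ideal.span {p}) :=
    (Ideal.Quotient.mkₐ k (Ideal.span {p})).toLinearMap
  have hπ : ∀ x, π x = 0 ↔ p ∣ x := fun x => mk_eq_zero_iff p x
  let V := (filt b (dg p - 1)).map π
  have hfin : Module.finrank k (CircleRing b ⧸ Ideal.span {p}) = 2 * dg p :=
    finrank_quotient hp.ne_zero
  have : Module.Finite k (CircleRing b ⧸ Ideal.span {p}) :=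
    Module.finite_of_finrank_pos (by omega)
  have hV : Module.finrank k V = 2 * (dg p - 1) + 1 := by
    rw [← finrank_filt b (dg p - 1)]
    let f := π.submoduleMap (filt b (dg p - 1))
    refine (LinearEquiv.finrank_eq (LinearEquiv.ofBijective f ⟨?_, ?_⟩)).symm
    · rw [← LinearMap.ker_eq_bot, LinearMap.ker_eq_bot']
      intro m hm
      have h1 : π (m : CircleRing b) = 0 := congrArg Subtype.val hm
      rw [hπ] at h1
      by_contra hm0
      have := dg_le_of_dvd (fun h => hm0 (Subtype.ext h)) h1
      have := mem_filt_iff.1 m.2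
      omega
    · exact LinearMap.submoduleMap_surjective _ _
  have hq : Module.finrank k ((CircleRing b ⧸ Ideal.span {p}) ⧸ V) = 1 := by
    have := V.finrank_quotient_add_finrank
    omega
  obtain ⟨u, hu0, hu1, hu2⟩ := exists_vec_mem V hq (by omega) T
  choose g hg hgu using hu1
  choose g' hg' hgu' using hu2
  have hsum : p ∣ ∑ i, g i * g i + ∑ i, g' i * g' i := by
    rw [← mk_eq_zero_iff, map_add, map_sum, map_sum]
    have e1 : ∀ i, Ideal.Quotient.mk (Ideal.span {p}) (g i) = u i := hgu
    have e2 : ∀ i, Ideal.Quotient.mk (Ideal.span {p}) (g' i) = T.mulVec u i := hgu'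
    simp only [map_mul, e1, e2]
    change u ⬝ᵥ u + T.mulVec u ⬝ᵥ T.mulVec u = 0
    rw [Matrix.dotProduct_mulVec, Matrix.vecMul_mulVec, hT', neg_smul, one_smul, Matrix.vecMul_neg,
      Matrix.vecMul_one, neg_dotProduct, add_neg_cancel]
  obtain ⟨h, hh⟩ := hsum
  refine ⟨(n + 1) + (n + 1), Fin.append g g', h, ?_, ?_, ?_⟩
  · rw [Fin.sum_univ_add]
    simp only [Fin.append_left, Fin.append_right]
    exact hh
  · obtain ⟨i, hi⟩ := Function.ne_iff.1 hu0
    refine ⟨Fin.castAdd _ i, fun h0 => hi ?_⟩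
    rw [Fin.append_left] at h0
    rw [← hgu, h0, map_zero, Pi.zero_apply]
  · intro i
    refine Fin.addCases (fun i => ?_) (fun i => ?_) i
    · rw [Fin.append_left]; exact hg i
    · rw [Fin.append_right]; exact hg' i

lemma isSumSq_sum {R ι : Type*} [CommRing R] (s : Finset ι) (g : ι → R) :
    IsSumSq (∑ i ∈ s, g i * g i) := by
  classical
  induction s using Finset.induction_on with
  | empty => rw [Finset.sum_empty]; exact .zero
  | insert a s ha ih => rw [Finset.sum_insert ha]; exact .sq_add _ ih

lemma eq_zero_of_sum_sq_eq_zero {F ι : Type*} [Field F] (hF : ¬ IsSumSq (-1 : F)) [Fintype ι]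
    {g : ι → F} (h : ∑ i, g i * g i = 0) (i : ι) : g i = 0 := by
  classical
  rw [← Finset.add_sum_erase _ _ (Finset.mem_univ i)] at h
  exact mul_self_eq_zero.1
    (eq_zero_of_add_isSumSq hF (IsSumSq.mul_self (g i)) (isSumSq_sum _ g) h)

/-- Primes with nonreal residue field are, up to constants, sums of squares. -/
theorem constSumSq_of_not_realPrime (hK : ¬ IsSumSq (-1 : K)) :
    ∀ (d : ℕ) (p : CircleRing b), Prime p → dg p = d → ¬ RealPrime p →
      ConstSumSq b K (algebraMap _ K p) := by
  intro d
  induction d using Nat.strong_induction_on with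
  | _ d IH =>
  intro p hp hpd hr
  have h1 := one_le_dg hp
  rcases h1.eq_or_lt with h1 | h2
  · exact constSumSq_of_dg_one hK hp h1.symm hr
  obtain ⟨n, g, h, hgh, ⟨i, hi⟩, hgm⟩ := exists_sum_sq_eq_mul hp h2 hr
  have hs0 : ∑ i, g i * g i ≠ 0 := by
    intro h0
    have := congrArg (algebraMap _ K) h0
    simp only [map_sum, map_mul, map_zero] at this
    have := eq_zero_of_sum_sq_eq_zero hK this i
    rw [map_eq_zero_iff _ (IsFractionRing.injective _ K)] at this
    exact hi this
  have hh0 : h ≠ 0 := by rintro rfl; exact hs0 (by rw [hgh, mul_zero])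
  have hdeg : dg (∑ i, g i * g i) ≤ 2 * (dg p - 1) := by
    apply dg_le_of_mem
    refine Submodule.sum_mem _ fun i _ => ?_
    rw [two_mul]
    exact mul_mem_filt (hgm i) (hgm i)
  rw [hgh, dg_mul hp.ne_zero hh0] at hdeg
  have hsK : IsSumSq (algebraMap _ K p * algebraMap _ K h) := by
    rw [← map_mul, ← hgh]
    exact isSumSq_map _ (isSumSq_sum _ _)
  have hsK0 : algebraMap _ K p * algebraMap _ K h ≠ 0 := by
    rw [← map_mul, ← hgh, Ne, map_eq_zero_iff _ (IsFractionRing.injective _ K)]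
    exact hs0
  have hev : EvenReal b K (algebraMap _ K h) := by
    intro q hq
    let _inst := resField hq.1
    obtain ⟨z, hz, u, hu, -, hzu⟩ := residue_isSumSq hq.1 (mk_eq_zero_iff q) hq.2 hsK hsK0
    refine EvenAt.of_mul (evenAt_mk hq.1 fun hqp => hr ?_) ⟨z, hz, u, hu, hzu⟩
    exact hq.of_associated ((hq.1.dvd_prime_iff_associated hp).1 hqp)
  obtain ⟨c, hc, hch⟩ := constSumSq_of_evenReal (n := d)
    (fun q hq hqd hqr => IH (dg q) hqd q hq rfl hqr) (dg h) h rfl (by omega) hh0 hev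
  refine ⟨c, hc, ?_⟩
  have hhK := right_ne_zero_of_mul hsK0
  have : algebraMap (CircleRing b) K (algebraMap k _ c) * algebraMap _ K p =
      (algebraMap _ K p * algebraMap _ K h) * (algebraMap (CircleRing b) K (algebraMap k _ c) *
        algebraMap _ K h) / (algebraMap _ K h * algebraMap _ K h) := by
    field_simp
  rw [this]
  exact isSumSq_div (hsK.mul hch) (IsSumSq.mul_self _)

/-- Functions of even value at all real primes are products of constants and sums of squares. -/
theorem constSumSq_of_evenReal' (hK : ¬ IsSumSq (-1 : K)) {f : K} (hf0 : f ≠ 0)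
    (hf : EvenReal b K f) : ConstSumSq b K f := by
  obtain ⟨x, y, hy, rfl⟩ := IsFractionRing.div_surjective (A := CircleRing b) f
  have hy0 : algebraMap (CircleRing b) K y ≠ 0 := by
    simpa using nonZeroDivisors.ne_zero hy
  have hx0 : algebraMap (CircleRing b) K x ≠ 0 := fun h => hf0 (by rw [h, zero_div])
  have hxy : x * y ≠ 0 := by
    intro h
    have := congrArg (algebraMap _ K) h
    rw [map_mul, map_zero] at this
    exact mul_ne_zero hx0 hy0 this
  obtain ⟨c, hc, h⟩ := constSumSq_of_evenReal (K := K) (n := dg (x * y) + 1)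
    (fun q hq _ hqr => constSumSq_of_not_realPrime hK _ q hq rfl hqr) (dg (x * y)) (x * y) rfl
    (Nat.lt_succ_self _) hxy (fun q hq => by
      obtain ⟨z, hz, u, hu, h⟩ := hf q hq
      refine ⟨z * algebraMap _ K y, mul_ne_zero hz hy0, u, hu, ?_⟩
      rw [map_mul]
      field_simp at h
      rw [h]; ring)
  refine ⟨c, hc, ?_⟩
  have : algebraMap (CircleRing b) K (algebraMap k _ c) * (algebraMap _ K x / algebraMap _ K y) =
      (algebraMap (CircleRing b) K (algebraMap k _ c) * algebraMap _ K (x * y)) /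
        (algebraMap _ K y * algebraMap _ K y) := by
    rw [map_mul]; field_simp
  rw [this]
  exact isSumSq_div h (IsSumSq.mul_self _)

end CircleRing

lemma mem_adjoin_sqrt {F : Type*} [Field F] [CharZero F] {α : F} {n : ℚ} (hα : α ^ 2 = n)
    (halg : IsAlgebraic ℚ α) {x : F} (hx : x ∈ IntermediateField.adjoin ℚ {α}) :
    ∃ u v : ℚ, x = u + v * α := by
  have hx' : x ∈ Algebra.adjoin ℚ {α} := by
    rw [← IntermediateField.adjoin_simple_toSubalgebra_of_isAlgebraic halg]
    exact hx
  induction hx' using Algebra.adjoin_induction with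
  | mem y hy => exact ⟨0, 1, by rw [Set.mem_singleton_iff.1 hy]; simp⟩
  | algebraMap r => exact ⟨r, 0, by simp⟩
  | add y z _ _ hy hz =>
    obtain ⟨u, v, rfl⟩ := hy (IntermediateField.algebra_adjoin_le_adjoin _ _ ‹_›)
    obtain ⟨u', v', rfl⟩ := hz (IntermediateField.algebra_adjoin_le_adjoin _ _ ‹_›)
    exact ⟨u + u', v + v', by push_cast; ring⟩
  | mul y z _ _ hy hz =>
    obtain ⟨u, v, rfl⟩ := hy (IntermediateField.algebra_adjoin_le_adjoin _ _ ‹_›)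
    obtain ⟨u', v', rfl⟩ := hz (IntermediateField.algebra_adjoin_le_adjoin _ _ ‹_›)
    refine ⟨u * u' + v * v' * n, u * v' + v * u', ?_⟩
    push_cast
    rw [← hα]; ring

lemma not_isSquare_prime_mul {p q : ℕ} (hp : p.Prime) (hq : q.Prime) (h : p ≠ q) (v : ℚ) :
    (q : ℚ) ≠ v ^ 2 * p := by
  intro e
  have hp0 : (p : ℚ) ≠ 0 := by exact_mod_cast hp.ne_zero
  have hv0 : v ≠ 0 := by
    rintro rfl
    simp [hq.ne_zero] at e
  have := Fact.mk hp
  have := Fact.mk hq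
  have := congrArg (padicValRat p) e
  rw [padicValRat.mul (pow_ne_zero 2 hv0) hp0, padicValRat.pow, padicValRat.of_nat,
    padicValRat.of_nat, padicValNat_primes (p := p) (q := q) h, padicValNat_self] at this
  push_cast at this
  omega

lemma not_isSquare_prime {p : ℕ} (hp : p.Prime) (v : ℚ) : (p : ℚ) ≠ v ^ 2 := by
  intro e
  have hv0 : v ≠ 0 := by
    rintro rfl
    simp [hp.ne_zero] at e
  have := Fact.mk hp
  have := congrArg (padicValRat p) e
  rw [padicValRat.pow, padicValRat.of_nat, padicValNat_self] at this
  push_cast at this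
  omega

/-- In a number field some sum of two squares is not a square. -/
lemma exists_not_isSquare {F : Type*} [Field F] [NumberField F] :
    ∃ a b : ℕ, ¬ IsSquare ((a : F) ^ 2 + (b : F) ^ 2) := by
  by_contra! hall
  let S := {p : ℕ | p.Prime ∧ p ≡ 1 [MOD 4]}
  have hS : S.Infinite := Nat.infinite_setOfPred_prime_modEq_one (by norm_num)
  have hsq : ∀ p : S, ∃ s : F, s ^ 2 = (p : ℕ) := by
    rintro ⟨p, hp, h4⟩
    have := Fact.mk hp
    obtain ⟨a, b, hab⟩ := Nat.Prime.sq_add_sq (p := p) (by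
      intro h
      unfold Nat.ModEq at h4
      omega)
    obtain ⟨s, hs⟩ := hall a b
    exact ⟨s, by rw [sq, ← hs]; simp only [← hab]; push_cast; rfl⟩
  choose s hs using hsq
  have : Infinite S := hS.to_subtype
  have : Finite (IntermediateField ℚ F) :=
    Field.finite_intermediateField_of_exists_primitive_element ℚ F
      (Field.exists_primitive_element ℚ F)
  obtain ⟨p, q, hpq, hE⟩ := Finite.exists_ne_map_eq_of_infinite
    (fun p : S => IntermediateField.adjoin ℚ {s p})
  have hmem : s q ∈ IntermediateField.adjoin ℚ {s p} := by
    rw [hE]; exact IntermediateField.mem_adjoin_simple_self ℚ (s q)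
  obtain ⟨u, v, huv⟩ := mem_adjoin_sqrt (n := (p : ℕ)) (by rw [hs]; simp)
    (Algebra.IsAlgebraic.isAlgebraic _) hmem
  have hp0 : (u * v : ℚ) = 0 := by
    by_contra h0
    have h0' : ((u * v : ℚ) : F) ≠ 0 := by exact_mod_cast h0
    have h1 : s p = (((q : ℕ) - u ^ 2 - v ^ 2 * (p : ℕ)) / (2 * (u * v)) : ℚ) := by
      push_cast at h0' ⊢
      rw [eq_div_iff (by simpa using h0'), ← hs, ← hs, huv]; ring
    have h2 := hs p
    rw [h1] at h2
    exact not_isSquare_prime p.2.1 _ (by exact_mod_cast h2.symm)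
  have hq := hs q
  rcases mul_eq_zero.1 hp0 with rfl | rfl
  · rw [huv, Rat.cast_zero, zero_add, mul_pow, hs] at hq
    exact not_isSquare_prime_mul p.2.1 q.2.1 (fun h => hpq (Subtype.ext h)) v
      (by exact_mod_cast hq.symm)
  · rw [huv, Rat.cast_zero, zero_mul, add_zero] at hq
    exact not_isSquare_prime q.2.1 u (by exact_mod_cast hq.symm)

lemma isSumSq_sq' {R : Type*} [CommRing R] (x y : R) : IsSumSq (x ^ 2 + y ^ 2) := by
  rw [sq, sq]
  exact (IsSumSq.mul_self x).add (IsSumSq.mul_self y)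

namespace CircleRing

open QuadraticAlgebra

set_option linter.unusedSectionVars false

section RealPoint

variable {k : Type*} [Field k] [NumberField k] {b : k} [hk : Fact (¬ IsSumSq (-1 : k))]

lemma exists_eval_ne_zero (σ : k →+* ℝ) (hσ : 0 < σ b) {d : CircleRing b} (hd : d ≠ 0) :
    ∃ (x y : ℝ) (h : x ^ 2 + y ^ 2 = σ b), evalHom σ x y h d ≠ 0 := by
  have hN := norm_ne_zero hd
  have hN' : (QuadraticAlgebra.norm d).map σ ≠ 0 := by
    rwa [Ne, Polynomial.map_eq_zero]
  have hI : (Set.Ioo 0 (√(σ b))).Infinite := Set.Ioo_infinite (Real.sqrt_pos.2 hσ)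
  obtain ⟨x, ⟨hx0, hx1⟩, hx⟩ := hI.exists_notMem_finite
    (Polynomial.finite_setOfPred_isRoot hN')
  have hx2 : x ^ 2 ≤ σ b := by
    have := Real.sq_sqrt hσ.le
    nlinarith
  have hy : √(σ b - x ^ 2) ^ 2 = σ b - x ^ 2 := Real.sq_sqrt (by linarith)
  refine ⟨x, √(σ b - x ^ 2), by rw [hy]; ring, fun h0 => hx ?_⟩
  rw [evalHom_apply] at h0
  rw [Set.mem_ofPred_eq, Polynomial.IsRoot, Polynomial.eval_map, norm_def]
  simp only [Polynomial.eval₂_add, Polynomial.eval₂_mul, Polynomial.eval₂_sub,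
      Polynomial.eval₂_C, Polynomial.eval₂_pow, Polynomial.eval₂_X, Polynomial.eval₂_zero]
  linear_combination (d.re.eval₂ σ x - d.im.eval₂ σ x * √(σ b - x ^ 2)) * h0 +
    (d.im.eval₂ σ x) ^ 2 * hy

variable {K : Type*} [Field K] [Algebra (CircleRing b) K] [IsFractionRing (CircleRing b) K]

lemma isSumSq_clear_denom {R : Type*} [CommRing R] [IsDomain R] [Algebra R K] [IsFractionRing R K]
    {z : K} (hz : IsSumSq z) :
    ∃ d : R, d ≠ 0 ∧ ∃ s : R, IsSumSq s ∧ z * algebraMap R K d ^ 2 = algebraMap R K s := by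
  induction hz with
  | zero => exact ⟨1, one_ne_zero, 0, .zero, by simp⟩
  | @sq_add a z _ ih =>
    obtain ⟨d, hd, s, hs, h⟩ := ih
    obtain ⟨n, e, he, rfl⟩ := IsFractionRing.div_surjective (A := R) a
    have he0 := nonZeroDivisors.ne_zero he
    have he' : algebraMap R K e ≠ 0 := by simpa using he0
    refine ⟨d * e, mul_ne_zero hd he0, (d * n) * (d * n) + s * (e * e),
      (IsSumSq.mul_self _).add (hs.mul (IsSumSq.mul_self _)), ?_⟩
    simp only [map_mul, map_add]
    rw [← h]
    field_simp

/-- Constants which are sums of squares on the circle are nonnegative at real embeddings for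
which the circle has real points. -/
lemma nonneg_of_isSumSq (σ : k →+* ℝ) (hσ : 0 < σ b) {c : k}
    (hc : IsSumSq (algebraMap (CircleRing b) K (algebraMap k _ c))) : 0 ≤ σ c := by
  obtain ⟨d, hd, s, hs, h⟩ := isSumSq_clear_denom (R := CircleRing b) hc
  rw [← map_pow, ← map_mul, (IsFractionRing.injective (CircleRing b) K).eq_iff] at h
  obtain ⟨x, y, hxy, hne⟩ := exists_eval_ne_zero σ hσ hd
  have h1 := congrArg (evalHom σ x y hxy) h
  rw [map_mul, map_pow, evalHom_algebraMap] at h1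
  have h2 : 0 ≤ evalHom σ x y hxy s :=
    isSumSq_nonneg (k := ℝ) (RingHom.id ℝ) (isSumSq_map (evalHom σ x y hxy) hs)
  rw [← h1] at h2
  exact nonneg_of_mul_nonneg_left h2 (by positivity)

lemma real_of_pos (σ : k →+* ℝ) (hσ : 0 < σ b) : ¬ IsSumSq (-1 : K) := by
  intro h
  have := nonneg_of_isSumSq (K := K) σ hσ (c := -1) (by simpa using h)
  rw [map_neg, map_one] at this
  linarith

/-- Constants positive where the circle has real points are sums of squares. -/
lemma isSumSq_of_pos (hb0 : b ≠ 0) {c : k} (hc : ∀ σ : k →+* ℝ, 0 < σ b → 0 < σ c) :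
    IsSumSq (algebraMap (CircleRing b) K (algebraMap k _ c)) := by
  obtain ⟨s, t, hs, ht, rfl⟩ := exists_isSumSq_add_mul (a := b) (c := c) (fun σ hσ =>
    hc σ (hσ.lt_of_ne' (by simpa using hb0)))
  have h : IsSumSq (algebraMap k (CircleRing b) (s + b * t)) := by
    rw [map_add, map_mul, ← xc_sq_add_yc_sq]
    exact (isSumSq_map (algebraMap k (CircleRing b)) hs).add
      ((isSumSq_sq' _ _).mul (isSumSq_map (algebraMap k (CircleRing b)) ht))
  exact isSumSq_map (algebraMap (CircleRing b) K) h

end RealPoint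

section Indep

variable {k : Type*} [Field k] [NumberField k] {b : k} [hk : Fact (¬ IsSumSq (-1 : k))]
  [hb : Fact (∀ p q : k, p ^ 2 + q ^ 2 ≠ b)]
variable {K : Type*} [Field K] [Algebra (CircleRing b) K] [IsFractionRing (CircleRing b) K]

lemma b_ne_zero : b ≠ 0 := fun h => hb.out 0 0 (by rw [h]; ring)

lemma numberField_of_finite (k F : Type*) [Field k] [NumberField k] [Field F] [Algebra k F]
    [Module.Finite k F] : NumberField F := by
  have : CharZero F := charZero_of_injective_algebraMap (algebraMap k F).injective
  have : FiniteDimensional ℚ F := Module.Finite.trans k F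
  exact NumberField.mk

lemma numberField_resField {p : CircleRing b} (hp : Prime p) :
    letI := resField hp
    NumberField (CircleRing b ⧸ Ideal.span {p}) := by
  have hfin : Module.finrank k (CircleRing b ⧸ Ideal.span {p}) = 2 * dg p :=
    finrank_quotient hp.ne_zero
  have := one_le_dg hp
  have : Module.Finite k (CircleRing b ⧸ Ideal.span {p}) :=
    Module.finite_of_finrank_pos (by omega)
  let _inst := resField hp
  exact numberField_of_finite k _

lemma RealPrime.isGood {p : CircleRing b} (hp : RealPrime p) :
    letI := resField hp.1
    IsGood (evenSub (Ideal.Quotient.mk (Ideal.span {p})) K) := by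
  have h := numberField_resField hp.1
  let _inst := resField hp.1
  exact isGood_evenSub hp.1 (mk_eq_zero_iff p) hp.2 exists_not_isSquare

lemma evenReal_of_mem_goodInf {u : Kˣ} (h : sqCl u ∈ goodInf K) : EvenReal b K (u : K) := by
  intro q hq
  let _inst := resField hq.1
  rw [← sqCl_mem_evenSub]
  unfold goodInf at h
  exact Subgroup.mem_sInf.1 h _ hq.isGood

lemma sqCl_prod {ι : Type*} (s : Finset ι) (u : ι → Kˣ) :
    sqCl (∏ i ∈ s, u i) = ∏ i ∈ s, sqCl (u i) := by
  classical
  induction s using Finset.induction_on with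
  | empty => simp [sqCl_one]
  | insert a s ha ih => rw [Finset.prod_insert ha, Finset.prod_insert ha, sqCl_mul, ih]

lemma prod_mul_prod_eq {ι R : Type*} [DecidableEq ι] [CommRing R] (s t : Finset ι) (c : ι → R) :
    (∏ i ∈ s, c i) * ∏ i ∈ t, c i =
      (∏ i ∈ (s \ t) ∪ (t \ s), c i) * (∏ i ∈ s ∩ t, c i) ^ 2 := by
  rw [Finset.prod_union (disjoint_sdiff_sdiff), ← Finset.prod_inter_mul_prod_sdiff s t,
    ← Finset.prod_inter_mul_prod_sdiff t s, Finset.inter_comm t s]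
  ring

lemma isSumSq_prod {R ι : Type*} [CommRing R] (s : Finset ι) (g : ι → R)
    (h : ∀ i ∈ s, IsSumSq (g i)) : IsSumSq (∏ i ∈ s, g i) := by
  classical
  induction s using Finset.induction_on with
  | empty => rw [Finset.prod_empty]; simp
  | insert a s ha ih =>
    rw [Finset.prod_insert ha]
    exact (h a (Finset.mem_insert_self _ _)).mul
      (ih fun i hi => h i (Finset.mem_insert_of_mem hi))

lemma le_card_of_hasIndep (hK : ¬ IsSumSq (-1 : K)) {n : ℕ} (h : HasIndep K n) :
    n ≤ Nat.card {σ : k →+* ℝ // 0 < σ b} := by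
  classical
  obtain ⟨e, he, hind⟩ := h
  choose u hu using fun i => sqCl_surjective (e i)
  have hc : ∀ i, ConstSumSq b K (u i : K) := fun i =>
    constSumSq_of_evenReal' hK (u i).ne_zero (evenReal_of_mem_goodInf (by rw [hu]; exact he i))
  choose c hc0 hcu using hc
  by_contra! hlt
  let f : Finset (Fin n) → Set {σ : k →+* ℝ // 0 < σ b} :=
    fun s => {σ | σ.1 (∏ i ∈ s, c i) < 0}
  have hf : ¬ Function.Injective f := by
    intro hf
    have := Nat.card_le_card_of_injective f hf
    have h2 : Nat.card (Set {σ : k →+* ℝ // 0 < σ b}) =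
        2 ^ Nat.card {σ : k →+* ℝ // 0 < σ b} := by
      have := Fintype.ofFinite {σ : k →+* ℝ // 0 < σ b}
      rw [Nat.card_eq_fintype_card, Nat.card_eq_fintype_card, Fintype.card_set]
    rw [h2, Nat.card_eq_fintype_card, Fintype.card_finset, Fintype.card_fin] at this
    exact absurd this (not_le.2 (Nat.pow_lt_pow_right (by norm_num) hlt))
  rw [Function.Injective] at hf
  push Not at hf
  obtain ⟨s, t, hst, hne⟩ := hf
  let w := (s \ t) ∪ (t \ s)
  have hw : w.Nonempty := by
    rw [Finset.nonempty_iff_ne_empty]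
    intro h0
    apply hne
    have h1 := Finset.union_eq_empty.1 h0
    exact Finset.Subset.antisymm (Finset.sdiff_eq_empty_iff_subset.1 h1.1)
      (Finset.sdiff_eq_empty_iff_subset.1 h1.2)
  have hprod0 : ∀ s : Finset (Fin n), ∏ i ∈ s, c i ≠ 0 := fun s =>
    Finset.prod_ne_zero_iff.2 fun i _ => hc0 i
  have hpos : ∀ σ : k →+* ℝ, 0 < σ b → 0 < σ (∏ i ∈ w, c i) := by
    intro σ hσ
    have h1 := congrArg σ (prod_mul_prod_eq s t c)
    have h2 : σ (∏ i ∈ s, c i) < 0 ↔ σ (∏ i ∈ t, c i) < 0 := by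
      have := Set.ext_iff.1 hst ⟨σ, hσ⟩
      exact this
    rw [map_mul, map_mul, map_pow] at h1
    have hs0 : σ (∏ i ∈ s, c i) ≠ 0 := (map_ne_zero σ).2 (hprod0 s)
    have ht0 : σ (∏ i ∈ t, c i) ≠ 0 := (map_ne_zero σ).2 (hprod0 t)
    have h3 : 0 < σ (∏ i ∈ s, c i) * σ (∏ i ∈ t, c i) := by
      rcases hs0.lt_or_gt with h | h
      · exact mul_pos_of_neg_of_neg h (h2.1 h)
      · exact mul_pos h (ht0.lt_or_gt.resolve_left fun h' => lt_asymm h (h2.2 h'))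
    rw [h1] at h3
    exact pos_of_mul_pos_left h3 (sq_nonneg _)
  have hcw := isSumSq_of_pos (K := K) b_ne_zero hpos
  apply hind w hw
  simp only [← hu]
  rw [← sqCl_prod, ssq_iff]
  have h1 := isSumSq_prod w _ fun i _ => hcu i
  have h0 : algebraMap (CircleRing b) K (algebraMap k _ (∏ i ∈ w, c i)) ≠ 0 :=
    algebraMap_const_ne_zero (hprod0 w)
  have h2 : ((∏ i ∈ w, u i : Kˣ) : K) =
      (∏ i ∈ w, algebraMap (CircleRing b) K (algebraMap k _ (c i)) * (u i : K)) /
        algebraMap (CircleRing b) K (algebraMap k _ (∏ i ∈ w, c i)) := by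
    rw [eq_div_iff h0, Finset.prod_mul_distrib, map_prod, map_prod, Units.coe_prod, mul_comm]
  rw [h2]
  exact isSumSq_div h1 hcw

lemma hasIndep_card [CharZero K] : HasIndep K (Nat.card {σ : k →+* ℝ // 0 < σ b}) := by
  classical
  let e := (Finite.equivFin {σ : k →+* ℝ // 0 < σ b}).symm
  choose c hc0 hc using fun i => exists_signs ({(e i).1} : Set (k →+* ℝ))
  let ι := (algebraMap (CircleRing b) K).comp (algebraMap k (CircleRing b))
  have hι0 : ∀ i, ι (c i) ≠ 0 := fun i => algebraMap_const_ne_zero (hc0 i)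
  refine ⟨fun i => sqCl (Units.mk0 _ (hι0 i)), fun i => ?_, fun s hs hsum => ?_⟩
  · have := const_mem_goodInf ι (hc0 i)
    rw [← coe_mem_elems]
    exact this
  · rw [← sqCl_prod, ssq_iff, Units.coe_prod] at hsum
    obtain ⟨i, hi⟩ := hs
    have h1 := nonneg_of_isSumSq (K := K) (e i).1 (e i).2 (c := ∏ i ∈ s, c i) (by
      rw [map_prod, map_prod]
      exact hsum)
    rw [← Finset.mul_prod_erase s c hi, map_mul, map_prod] at h1
    have h2 : (e i).1 (c i) < 0 := (hc i _).1 rfl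
    have h3 : 0 < ∏ j ∈ s.erase i, (e i).1 (c j) := by
      refine Finset.prod_pos fun j hj => (hc j _).2 fun hji => ?_
      exact (Finset.ne_of_mem_erase hj) (e.injective (Subtype.ext (Set.mem_singleton_iff.1 hji))).symm
    nlinarith

end Indep

end CircleRing

section Norm

open NumberField

variable {k : Type*} [Field k] [NumberField k]

lemma det_sq_add_sq {ι : Type*} [Fintype ι] [DecidableEq ι] {U V : Matrix ι ι ℤ}
    (h : U * V = V * U) : ∃ x y : ℤ, (U ^ 2 + V ^ 2).det = x ^ 2 + y ^ 2 := by
  let f := Int.castRingHom GaussianInt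
  let i : GaussianInt := ⟨0, 1⟩
  have hi : i * i = -1 := rfl
  let U' := f.mapMatrix U
  let V' := f.mapMatrix V
  have hUV : U' * V' = V' * U' := by rw [← map_mul, h, map_mul]
  let z := (U' + i • V').det
  have hz : (U' - i • V').det = star z := by
    have := RingHom.map_det (starRingEnd GaussianInt) (U' + i • V')
    change _ = starRingEnd GaussianInt z
    rw [this]
    congr 1
    have hs : (starRingEnd GaussianInt) ⟨0, 1⟩ = ⟨0, -1⟩ := rfl
    ext a c
    all_goals simp [U', V', f, i, sub_eq_add_neg, hs]
  have h1 : f ((U ^ 2 + V ^ 2).det) = z * star z := by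
    rw [← hz, ← Matrix.det_mul, RingHom.map_det]
    congr 1
    rw [map_add, map_pow, map_pow]
    change U' ^ 2 + V' ^ 2 = _
    rw [add_mul, mul_sub, mul_sub, Matrix.mul_smul, Matrix.smul_mul, Matrix.smul_mul,
      Matrix.mul_smul, smul_smul, hi, hUV, sq, sq]
    simp
    abel
  refine ⟨z.re, z.im, ?_⟩
  have h2 := congrArg Zsqrtd.re h1
  simp [f] at h2
  rw [h2]; ring

lemma norm_sq_add_sq (u v : 𝓞 k) : ∃ x y : ℤ, Algebra.norm ℤ (u ^ 2 + v ^ 2) = x ^ 2 + y ^ 2 := by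
  classical
  rw [Algebra.norm_eq_matrix_det (RingOfIntegers.basis k), map_add, map_pow, map_pow]
  apply det_sq_add_sq
  rw [← map_mul, mul_comm, map_mul]

lemma norm_one_add (n : ℕ) (s : 𝓞 k) : Algebra.norm ℤ (1 + n * s) ≡ 1 [ZMOD n] := by
  classical
  rw [← ZMod.intCast_eq_intCast_iff, Algebra.norm_eq_matrix_det (RingOfIntegers.basis k)]
  have := RingHom.map_det (Int.castRingHom (ZMod n))
    (Algebra.leftMulMatrix (RingOfIntegers.basis k) (1 + n * s))
  rw [eq_intCast] at this
  rw [this, map_add, map_mul, map_natCast, map_one, map_add, map_mul, map_natCast, map_one]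
  simp

/-- An element which is negative at exactly one real embedding has negative norm. -/
lemma norm_neg {x : k} (σ₀ : k →+* ℝ) (h0 : σ₀ x < 0) (h : ∀ σ : k →+* ℝ, σ ≠ σ₀ → 0 < σ x) :
    Algebra.norm ℚ x < 0 := by
  classical
  have hx : x ≠ 0 := by rintro rfl; simp at h0
  let f : (k →ₐ[ℚ] ℂ) → ℂ := fun σ => σ x / ‖σ x‖
  have hne : ∀ σ : k →ₐ[ℚ] ℂ, σ x ≠ 0 := fun σ => by simpa using hx
  let c : (k →ₐ[ℚ] ℂ) → (k →ₐ[ℚ] ℂ) := fun σ => (ComplexEmbedding.conjugate σ.toRingHom).toRatAlgHom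
  have hc : ∀ σ y, c σ y = starRingEnd ℂ (σ y) := fun σ y => rfl
  let τ : k →ₐ[ℚ] ℂ := (Complex.ofRealHom.comp σ₀).toRatAlgHom
  have hτ : ∀ y, τ y = (σ₀ y : ℂ) := fun y => rfl
  have hfτ : f τ = -1 := by
    simp only [f, hτ, Complex.norm_real, Real.norm_eq_abs, abs_of_neg h0]
    push_cast
    rw [div_neg, div_self]
    exact_mod_cast h0.ne
  have hreal : ∀ σ : k →ₐ[ℚ] ℂ, c σ = σ → ∃ ρ : k →+* ℝ, ∀ y, σ y = ρ y := by
    intro σ hσ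
    have hr : ComplexEmbedding.IsReal σ.toRingHom := by
      ext y
      exact congrArg (fun g : k →ₐ[ℚ] ℂ => g y) hσ
    exact ⟨hr.embedding, fun y => (ComplexEmbedding.IsReal.coe_embedding_apply hr y).symm⟩
  have hcτ : c τ = τ := by
    ext y
    rw [hc, hτ, Complex.conj_ofReal]
  have hprod : ∏ σ, f σ = -1 := by
    rw [← Finset.mul_prod_erase _ _ (Finset.mem_univ τ), hfτ]
    suffices ∏ σ ∈ Finset.univ.erase τ, f σ = 1 by rw [this, mul_one]
    refine Finset.prod_involution (fun σ _ => c σ) ?_ ?_ ?_ ?_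
    · intro σ _
      simp only [f, hc]
      have h1 : ‖(starRingEnd ℂ) (σ x)‖ = ‖σ x‖ := Complex.norm_conj _
      rw [h1, div_mul_div_comm, Complex.mul_conj, Complex.normSq_eq_norm_sq]
      have h2 : (‖σ x‖ : ℂ) ≠ 0 := by simpa using hx
      push_cast
      field_simp
    · intro σ hσ hfσ hcσ
      obtain ⟨ρ, hρ⟩ := hreal σ hcσ
      have hρ0 : 0 < ρ x := h ρ (by
        rintro rfl
        apply Finset.ne_of_mem_erase hσ
        ext y
        rw [hρ, hτ])
      apply hfσ
      simp only [f, hρ, Complex.norm_real, Real.norm_eq_abs, abs_of_pos hρ0]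
      exact div_self (by exact_mod_cast hρ0.ne')
    · intro σ hσ
      refine Finset.mem_erase.2 ⟨fun hcσ => Finset.ne_of_mem_erase hσ ?_, Finset.mem_univ _⟩
      rw [← hcτ, ← hcσ]
      ext y
      rw [hc, hc, Complex.conj_conj]
    · intro σ _
      ext y
      rw [hc, hc, Complex.conj_conj]
  have hN := Algebra.norm_eq_prod_embeddings ℚ ℂ x
  have h1 : ∏ σ : k →ₐ[ℚ] ℂ, σ x = ((-∏ σ : k →ₐ[ℚ] ℂ, ‖σ x‖ : ℝ) : ℂ) := by
    have : ∏ σ : k →ₐ[ℚ] ℂ, σ x = (∏ σ, f σ) * ∏ σ : k →ₐ[ℚ] ℂ, (‖σ x‖ : ℂ) := by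
      rw [← Finset.prod_mul_distrib]
      refine Finset.prod_congr rfl fun σ _ => ?_
      have h2 : (‖σ x‖ : ℂ) ≠ 0 := by simpa using hx
      simp only [f]
      field_simp
    rw [this, hprod]
    push_cast
    ring
  rw [h1] at hN
  have h2 : ((Algebra.norm ℚ x : ℚ) : ℝ) = -∏ σ : k →ₐ[ℚ] ℂ, ‖σ x‖ := by
    have : ((Algebra.norm ℚ x : ℝ) : ℂ) = ((-∏ σ : k →ₐ[ℚ] ℂ, ‖σ x‖ : ℝ) : ℂ) := by
      rw [← hN]; simp
    exact_mod_cast this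
  have h3 : 0 < ∏ σ : k →ₐ[ℚ] ℂ, ‖σ x‖ := Finset.prod_pos fun σ _ => norm_pos_iff.2 (hne σ)
  have h4 : ((Algebra.norm ℚ x : ℚ) : ℝ) < 0 := by rw [h2]; linarith
  exact_mod_cast h4

/-- Some totally positive element of a real number field is not a sum of two squares. -/
theorem exists_totally_positive (hk : ¬ IsSumSq (-1 : k)) :
    ∃ c : k, (∀ σ : k →+* ℝ, 0 < σ c) ∧ ∀ u v : k, u ^ 2 + v ^ 2 ≠ c := by
  classical
  obtain ⟨σ₀⟩ := exists_embedding_of_real hk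
  obtain ⟨s₀, hs₀, hs⟩ := exists_signs ({σ₀} : Set (k →+* ℝ))
  obtain ⟨n, d, hd, rfl⟩ := IsFractionRing.div_surjective (A := 𝓞 k) s₀
  have hd0 : algebraMap (𝓞 k) k d ≠ 0 := by
    simpa using nonZeroDivisors.ne_zero hd
  let s : 𝓞 k := n * d
  have hsd : algebraMap (𝓞 k) k s = algebraMap (𝓞 k) k n / algebraMap (𝓞 k) k d *
      algebraMap (𝓞 k) k d ^ 2 := by
    simp only [s, map_mul]; field_simp
  have hpos : ∀ σ : k →+* ℝ, 0 < σ (algebraMap (𝓞 k) k d) ^ 2 := fun σ => by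
    have : σ (algebraMap (𝓞 k) k d) ≠ 0 := (map_ne_zero σ).2 hd0
    positivity
  have hneg : σ₀ (algebraMap (𝓞 k) k s) < 0 := by
    rw [hsd, map_mul, map_pow]
    exact mul_neg_of_neg_of_pos ((hs σ₀).1 rfl) (hpos σ₀)
  have hpos' : ∀ σ : k →+* ℝ, σ ≠ σ₀ → 0 < σ (algebraMap (𝓞 k) k s) := by
    intro σ hσ
    rw [hsd, map_mul, map_pow]
    exact mul_pos ((hs σ).2 hσ) (hpos σ)
  obtain ⟨M, hM⟩ := exists_nat_gt (1 / (-σ₀ (algebraMap (𝓞 k) k s)))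
  have hM' : 1 < M * (-σ₀ (algebraMap (𝓞 k) k s)) := by
    rwa [div_lt_iff₀ (by linarith)] at hM
  let β : ℕ → 𝓞 k := fun N => 1 + ((4 * M * N : ℕ) : 𝓞 k) * s
  have hβ : ∀ (N : ℕ) (σ : k →+* ℝ), σ (algebraMap (𝓞 k) k (β N)) =
      1 + 4 * M * N * σ (algebraMap (𝓞 k) k s) := fun N σ => by
    simp only [β, map_add, map_mul, map_one, map_natCast]; push_cast; ring
  have hβneg : ∀ N : ℕ, N ≠ 0 → σ₀ (algebraMap (𝓞 k) k (β N)) < 0 := by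
    intro N hN
    rw [hβ]
    have : (1 : ℝ) ≤ N := by exact_mod_cast Nat.one_le_iff_ne_zero.2 hN
    nlinarith
  have hβpos : ∀ (N : ℕ) (σ : k →+* ℝ), σ ≠ σ₀ → 0 < σ (algebraMap (𝓞 k) k (β N)) := by
    intro N σ hσ
    rw [hβ]
    have := hpos' σ hσ
    positivity
  have hnorm : ∀ N : ℕ, N ≠ 0 → Algebra.norm ℤ (β N) < 0 := by
    intro N hN
    have := norm_neg σ₀ (hβneg N hN) (hβpos N)
    rw [← Algebra.coe_norm_int] at this
    exact_mod_cast this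
  have hmod : ∀ N : ℕ, Algebra.norm ℤ (β N) ≡ 1 [ZMOD (4 * M * N : ℕ)] := fun N =>
    norm_one_add _ _
  let m := (Algebra.norm ℤ (β 1)).natAbs
  have hm0 : m ≠ 0 := Int.natAbs_ne_zero.2 (hnorm 1 one_ne_zero).ne
  have hm4 : m % 4 = 3 := by
    have h1 : Algebra.norm ℤ (β 1) ≡ 1 [ZMOD 4] :=
      (hmod 1).of_dvd ⟨M, by push_cast; ring⟩
    have h2 := hnorm 1 one_ne_zero
    unfold Int.ModEq at h1
    omega
  obtain ⟨q, hq, hq4, hodd⟩ : ∃ q ∈ m.primeFactors, q % 4 = 3 ∧ ¬ Even (padicValNat q m) := by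
    by_contra! hall
    obtain ⟨x, y, hxy⟩ := Nat.eq_sq_add_sq_iff.2 hall
    have hx : x ^ 2 % 4 = 0 ∨ x ^ 2 % 4 = 1 := by
      rw [Nat.pow_mod]
      have : x % 4 < 4 := Nat.mod_lt _ (by norm_num)
      interval_cases x % 4 <;> simp
    have hy : y ^ 2 % 4 = 0 ∨ y ^ 2 % 4 = 1 := by
      rw [Nat.pow_mod]
      have : y % 4 < 4 := Nat.mod_lt _ (by norm_num)
      interval_cases y % 4 <;> simp
    omega
  have hqp := Nat.prime_of_mem_primeFactors hq
  have hqm := Nat.dvd_of_mem_primeFactors hq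
  have : Fact q.Prime := ⟨hqp⟩
  let m' := (Algebra.norm ℤ (β m)).natAbs
  have hm'0 : m' ≠ 0 := Int.natAbs_ne_zero.2 (hnorm m hm0).ne
  have hqm' : ¬ q ∣ m' := by
    intro h
    have h1 : Algebra.norm ℤ (β m) ≡ 1 [ZMOD q] :=
      (hmod m).of_dvd (by exact_mod_cast hqm.mul_left _)
    have h2 : (q : ℤ) ∣ Algebra.norm ℤ (β m) := Int.natCast_dvd.2 h
    have h3 : (q : ℤ) ∣ 1 := by
      have h4 := h1.dvd
      simpa using dvd_add h4 h2
    exact hqp.one_lt.ne' (by exact_mod_cast Int.eq_one_of_dvd_one (by positivity) h3)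
  refine ⟨algebraMap (𝓞 k) k (β 1 * β m), fun σ => ?_, fun u v huv => ?_⟩
  · rw [map_mul, map_mul]
    by_cases hσ : σ = σ₀
    · subst hσ
      exact mul_pos_of_neg_of_neg (hβneg 1 one_ne_zero) (hβneg m hm0)
    · exact mul_pos (hβpos _ σ hσ) (hβpos _ σ hσ)
  · obtain ⟨p, e, he, rfl⟩ := IsFractionRing.div_surjective (A := 𝓞 k) u
    obtain ⟨p', e', he', rfl⟩ := IsFractionRing.div_surjective (A := 𝓞 k) v
    have he0 := nonZeroDivisors.ne_zero he
    have he'0 := nonZeroDivisors.ne_zero he'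
    have heK : algebraMap (𝓞 k) k e ≠ 0 := by simpa using he0
    have heK' : algebraMap (𝓞 k) k e' ≠ 0 := by simpa using he'0
    have heq : β 1 * β m * (e * e') ^ 2 = (p * e') ^ 2 + (p' * e) ^ 2 := by
      apply IsFractionRing.injective (𝓞 k) k
      rw [map_mul, ← huv]
      simp only [map_mul, map_add, map_pow]
      field_simp
    obtain ⟨x, y, hxy⟩ := norm_sq_add_sq (p * e') (p' * e)
    rw [← heq, map_mul, map_mul, map_pow] at hxy
    set t := Algebra.norm ℤ (e * e') with ht
    have ht0 : t.natAbs ≠ 0 := by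
      rw [Int.natAbs_ne_zero, ht, Algebra.norm_ne_zero_iff]
      exact mul_ne_zero he0 he'0
    have hnat : m * m' * t.natAbs ^ 2 = x.natAbs ^ 2 + y.natAbs ^ 2 := by
      have := congrArg Int.natAbs hxy
      rw [Int.natAbs_mul, Int.natAbs_mul, Int.natAbs_pow] at this
      change m * m' * _ = _ at this
      rw [this]
      zify
      rw [abs_of_nonneg (by positivity), sq_abs, sq_abs]
    have hev := Nat.eq_sq_add_sq_iff.1 ⟨_, _, hnat⟩ q
      (Nat.mem_primeFactors.2 ⟨hqp, (hqm.mul_right _).mul_right _, by positivity⟩) hq4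
    rw [padicValNat.mul (by positivity) (by positivity), padicValNat.mul hm0 hm'0,
      padicValNat.pow, padicValNat.eq_zero_of_not_dvd hqm', add_zero,
      Nat.even_add] at hev
    exact hodd (hev.2 (even_two_mul _))

end Norm

section Level

variable {k : Type*} [Field k]

theorem sum_three_sq_eq_zero (hk : ¬ IsSumSq (-1 : k)) {a b c : k}
    (h : a ^ 2 + b ^ 2 + c ^ 2 = 0) : a = 0 ∧ b = 0 ∧ c = 0 := by
  have key : ∀ {a b c : k}, a ^ 2 + b ^ 2 + c ^ 2 = 0 → a = 0 := fun {a b c} h => by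
    have := eq_zero_of_add_isSumSq hk (isSumSq_sq a) ((isSumSq_sq b).add (isSumSq_sq c))
      (by rw [← h]; ring)
    simpa using this
  exact ⟨key h, key (a := b) (b := a) (c := c) (by rw [← h]; ring),
    key (a := c) (b := a) (c := b) (by rw [← h]; ring)⟩

theorem natDegree_le_of_sum_three_sq (hk : ¬ IsSumSq (-1 : k)) {f g h : Polynomial k} {n : ℕ}
    (hd : (f ^ 2 + g ^ 2 + h ^ 2).natDegree ≤ 2 * n) :
    f.natDegree ≤ n ∧ g.natDegree ≤ n ∧ h.natDegree ≤ n := by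
  set m := max f.natDegree (max g.natDegree h.natDegree) with hm
  suffices hmn : m ≤ n by
    refine ⟨?_, ?_, ?_⟩ <;> omega
  by_contra! hlt
  have hf : f.natDegree ≤ m := by omega
  have hg : g.natDegree ≤ m := by omega
  have hh : h.natDegree ≤ m := by omega
  have h0 : (f ^ 2 + g ^ 2 + h ^ 2).coeff (2 * m) = 0 :=
    Polynomial.coeff_eq_zero_of_natDegree_lt (by omega)
  rw [Polynomial.coeff_add, Polynomial.coeff_add, Polynomial.coeff_pow_of_natDegree_le hf,
    Polynomial.coeff_pow_of_natDegree_le hg, Polynomial.coeff_pow_of_natDegree_le hh] at h0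
  obtain ⟨z₁, z₂, z₃⟩ := sum_three_sq_eq_zero hk h0
  have key : ∀ p : Polynomial k, p.natDegree ≤ m → p.coeff m = 0 → p.natDegree ≤ m - 1 :=
    fun p hp hz => Polynomial.natDegree_le_pred hp hz
  have k₁ := key f hf z₁
  have k₂ := key g hg z₂
  have k₃ := key h hh z₃
  omega

theorem sum_three_sq_poly_eq_zero (hk : ¬ IsSumSq (-1 : k)) {f g h : Polynomial k}
    (h0 : f ^ 2 + g ^ 2 + h ^ 2 = 0) : f = 0 ∧ g = 0 ∧ h = 0 := by
  have hd := natDegree_le_of_sum_three_sq hk (n := 0) (f := f) (g := g) (h := h) (by simp [h0])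
  have e := congrArg (Polynomial.eval 0) h0
  obtain ⟨h1, h2, h3⟩ := hd
  rw [Polynomial.eq_C_of_natDegree_le_zero h1, Polynomial.eq_C_of_natDegree_le_zero h2,
    Polynomial.eq_C_of_natDegree_le_zero h3] at e ⊢
  simp only [Polynomial.eval_add, Polynomial.eval_pow, Polynomial.eval_C,
    Polynomial.eval_zero] at e
  obtain ⟨e1, e2, e3⟩ := sum_three_sq_eq_zero hk e
  simp [e1, e2, e3]

/-- Cassels' descent: a polynomial that is a sum of three squares of rational functions is a
sum of three squares of polynomials. -/
theorem exists_sum_three_sq_poly (hk : ¬ IsSumSq (-1 : k)) (P : Polynomial k) :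
    ∀ (n : ℕ) (D w₁ w₂ w₃ : Polynomial k), D ≠ 0 → D.natDegree ≤ n →
      w₁ ^ 2 + w₂ ^ 2 + w₃ ^ 2 = P * D ^ 2 →
      ∃ v₁ v₂ v₃ : Polynomial k, v₁ ^ 2 + v₂ ^ 2 + v₃ ^ 2 = P := by
  intro n
  induction n with
  | zero =>
    intro D w₁ w₂ w₃ hD hn h
    rw [Polynomial.eq_C_of_natDegree_le_zero hn] at h hD
    set d := D.coeff 0
    have hd : d ≠ 0 := by simpa using hD
    refine ⟨Polynomial.C d⁻¹ * w₁, Polynomial.C d⁻¹ * w₂, Polynomial.C d⁻¹ * w₃, ?_⟩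
    have hc : Polynomial.C d⁻¹ * Polynomial.C d = 1 := by
      rw [← Polynomial.C_mul, inv_mul_cancel₀ hd, Polynomial.C_1]
    linear_combination Polynomial.C d⁻¹ ^ 2 * h +
      P * (Polynomial.C d⁻¹ * Polynomial.C d + 1) * hc
  | succ n ih =>
    intro D w₁ w₂ w₃ hD hn h
    have e₁ := EuclideanDomain.div_add_mod w₁ D
    have e₂ := EuclideanDomain.div_add_mod w₂ D
    have e₃ := EuclideanDomain.div_add_mod w₃ D
    have d₁ := Polynomial.degree_mod_lt w₁ hD
    have d₂ := Polynomial.degree_mod_lt w₂ hD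
    have d₃ := Polynomial.degree_mod_lt w₃ hD
    set q₁ := w₁ / D
    set q₂ := w₂ / D
    set q₃ := w₃ / D
    set r₁ := w₁ % D
    set r₂ := w₂ % D
    set r₃ := w₃ % D
    by_cases hr : r₁ ^ 2 + r₂ ^ 2 + r₃ ^ 2 = 0
    · obtain ⟨z₁, z₂, z₃⟩ := sum_three_sq_poly_eq_zero hk hr
      refine ⟨q₁, q₂, q₃, mul_right_cancel₀ (pow_ne_zero 2 hD) ?_⟩
      rw [← h, ← e₁, ← e₂, ← e₃, z₁, z₂, z₃]
      ring
    set S := q₁ ^ 2 + q₂ ^ 2 + q₃ ^ 2 with hS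
    set E := D * P - 2 * (w₁ * q₁ + w₂ * q₂ + w₃ * q₃) + D * S with hE
    have hDE : D * E = r₁ ^ 2 + r₂ ^ 2 + r₃ ^ 2 := by
      have f₁ : r₁ = w₁ - D * q₁ := by rw [← e₁]; ring
      have f₂ : r₂ = w₂ - D * q₂ := by rw [← e₂]; ring
      have f₃ : r₃ = w₃ - D * q₃ := by rw [← e₃]; ring
      rw [f₁, f₂, f₃, hE, hS]
      linear_combination -h
    have hE0 : E ≠ 0 := by
      rintro hE0
      exact hr (by rw [← hDE, hE0, mul_zero])
    have hdE : E.natDegree ≤ n := by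
      have hdD : D.natDegree ≠ 0 := by
        intro h0
        have hr0 : ∀ r : Polynomial k, r.degree < D.degree → r = 0 := fun r hlt => by
          rw [Polynomial.degree_eq_natDegree hD, h0] at hlt
          by_contra hne
          exact absurd hlt (not_lt.2 (Polynomial.zero_le_degree_iff.2 hne))
        exact hr (by rw [hr0 _ d₁, hr0 _ d₂, hr0 _ d₃]; ring)
      have hb : ∀ r : Polynomial k, r.degree < D.degree →
          (r ^ 2).natDegree ≤ 2 * (D.natDegree - 1) := fun r hlt => by
        refine Polynomial.natDegree_pow_le.trans (Nat.mul_le_mul_left 2 ?_)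
        by_cases hz : r = 0
        · simp [hz]
        have := (Polynomial.natDegree_lt_natDegree_iff hz).2 hlt
        omega
      have := Polynomial.natDegree_add_le_of_degree_le
        (Polynomial.natDegree_add_le_of_degree_le (hb _ d₁) (hb _ d₂)) (hb _ d₃)
      rw [← hDE, Polynomial.natDegree_mul hD hE0] at this
      omega
    refine ih E (E * q₁ + (S - P) * r₁) (E * q₂ + (S - P) * r₂) (E * q₃ + (S - P) * r₃)
      hE0 hdE ?_
    have hqr : 2 * (r₁ * q₁ + r₂ * q₂ + r₃ * q₃) = D * (P - S) - E := by
      rw [hE, ← e₁, ← e₂, ← e₃, hS]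
      ring
    linear_combination E ^ 2 * (-hS) + E * (S - P) * hqr - (S - P) ^ 2 * hDE

theorem exists_sum_two_sq_of_orthogonal (hk : ¬ IsSumSq (-1 : k)) {a₁ a₂ a₃ b₁ b₂ b₃ : k}
    (ha : a₁ ^ 2 + a₂ ^ 2 + a₃ ^ 2 = 1) (hab : a₁ * b₁ + a₂ * b₂ + a₃ * b₃ = 0) :
    ∃ u v : k, u ^ 2 + v ^ 2 = b₁ ^ 2 + b₂ ^ 2 + b₃ ^ 2 := by
  by_cases h1 : a₁ = 1
  · subst h1
    obtain ⟨-, h2, h3⟩ := sum_three_sq_eq_zero hk (a := 0) (b := a₂) (c := a₃)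
      (by linear_combination ha)
    subst h2 h3
    refine ⟨b₂, b₃, ?_⟩
    have : b₁ = 0 := by linear_combination hab
    rw [this]
    ring
  · have h1' : 1 - a₁ ≠ 0 := sub_ne_zero.2 (Ne.symm h1)
    refine ⟨b₂ + b₁ * a₂ / (1 - a₁), b₃ + b₁ * a₃ / (1 - a₁), ?_⟩
    field_simp
    linear_combination b₁ ^ 2 * ha + 2 * b₁ * (1 - a₁) * hab

theorem exists_sum_two_sq_of_poly (hk : ¬ IsSumSq (-1 : k)) {e : k} {D w₁ w₂ w₃ : Polynomial k}
    (hD : D ≠ 0)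
    (h : w₁ ^ 2 + w₂ ^ 2 + w₃ ^ 2 = (Polynomial.X ^ 2 + Polynomial.C e) * D ^ 2) :
    ∃ u v : k, u ^ 2 + v ^ 2 = e := by
  obtain ⟨f, g, t, hv⟩ := exists_sum_three_sq_poly hk _ _ D w₁ w₂ w₃ hD le_rfl h
  obtain ⟨h1, h2, h3⟩ := natDegree_le_of_sum_three_sq hk (n := 1) (f := f) (g := g) (h := t)
    (by rw [hv]; compute_degree)
  rw [Polynomial.eq_X_add_C_of_natDegree_le_one h1, Polynomial.eq_X_add_C_of_natDegree_le_one h2,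
    Polynomial.eq_X_add_C_of_natDegree_le_one h3] at hv
  set a₁ := f.coeff 1
  set a₂ := g.coeff 1
  set a₃ := t.coeff 1
  set b₁ := f.coeff 0
  set b₂ := g.coeff 0
  set b₃ := t.coeff 0
  have hv' : Polynomial.C (a₁ ^ 2 + a₂ ^ 2 + a₃ ^ 2 - 1) * Polynomial.X ^ 2 +
      Polynomial.C (2 * (a₁ * b₁ + a₂ * b₂ + a₃ * b₃)) * Polynomial.X +
      Polynomial.C (b₁ ^ 2 + b₂ ^ 2 + b₃ ^ 2 - e) = 0 := by
    simp only [map_add, map_sub, map_mul, map_pow, map_one, map_ofNat]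
    linear_combination hv
  have c2 := congrArg (fun p => p.coeff 2) hv'
  have c1 := congrArg (fun p => p.coeff 1) hv'
  have c0 := congrArg (fun p => p.coeff 0) hv'
  simp only [Polynomial.coeff_add, Polynomial.coeff_C_mul, Polynomial.coeff_X_pow,
    Polynomial.coeff_X, Polynomial.coeff_C, Polynomial.coeff_zero] at c2 c1 c0
  have := charZero_of_real hk
  norm_num at c2 c1 c0
  obtain ⟨u, v, huv⟩ := exists_sum_two_sq_of_orthogonal hk (a₁ := a₁) (a₂ := a₂) (a₃ := a₃)
    (b₁ := b₁) (b₂ := b₂) (b₃ := b₃) (by linear_combination c2) c1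
  exact ⟨u, v, by rw [huv]; linear_combination c0⟩

end Level

namespace CircleRing

open QuadraticAlgebra

variable {k : Type*} [Field k] [hk : Fact (¬ IsSumSq (-1 : k))] {b : k}
variable {K : Type*} [Field K] [Algebra (CircleRing b) K]
  [IsFractionRing (CircleRing b) K]

theorem neg_one_ne_sq_add_sq (he : ∀ u v : k, u ^ 2 + v ^ 2 ≠ -b) (x y : K) :
    x ^ 2 + y ^ 2 ≠ -1 := by
  intro hxy
  obtain ⟨p, s, hs, rfl⟩ := IsFractionRing.div_surjective (A := CircleRing b) x
  obtain ⟨q, t, ht, rfl⟩ := IsFractionRing.div_surjective (A := CircleRing b) y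
  have hs0 := nonZeroDivisors.ne_zero hs
  have ht0 := nonZeroDivisors.ne_zero ht
  have hsK : algebraMap (CircleRing b) K s ≠ 0 := by simpa using hs0
  have htK : algebraMap (CircleRing b) K t ≠ 0 := by simpa using ht0
  have heq : (s * t) ^ 2 + (p * t) ^ 2 + (q * s) ^ 2 = 0 := by
    apply IsFractionRing.injective (CircleRing b) K
    simp only [map_mul, map_add, map_pow, map_zero]
    field_simp at hxy
    linear_combination hxy
  have hst := mul_ne_zero hs0 ht0
  generalize s * t = f at heq hst
  generalize p * t = g at heq
  generalize q * s = h at heq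
  have hre := congrArg QuadraticAlgebra.re heq
  have him := congrArg QuadraticAlgebra.im heq
  simp only [pow_two, re_add, im_add, re_mul, im_mul, re_zero, im_zero] at hre him
  have h2 : f.re * f.im + g.re * g.im + h.re * h.im = 0 := by
    have := charZero_of_real hk.out
    have h2 : (2 : Polynomial k) * (f.re * f.im + g.re * g.im + h.re * h.im) = 0 := by
      linear_combination him
    simpa using h2
  have hD : f.im ^ 2 + g.im ^ 2 + h.im ^ 2 ≠ 0 := by
    intro h0
    obtain ⟨z1, z2, z3⟩ := sum_three_sq_poly_eq_zero hk.out h0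
    rw [z1, z2, z3] at hre
    obtain ⟨z4, -, -⟩ := sum_three_sq_poly_eq_zero hk.out
      (f := f.re) (g := g.re) (h := h.re) (by linear_combination hre)
    exact hst (QuadraticAlgebra.ext z4 z1)
  obtain ⟨u, v, huv⟩ := exists_sum_two_sq_of_poly hk.out (e := -b) hD
    (w₁ := f.re * g.im - f.im * g.re) (w₂ := g.re * h.im - g.im * h.re)
    (w₃ := h.re * f.im - h.im * f.re) (by
      rw [Polynomial.C_neg]
      linear_combination (f.im ^ 2 + g.im ^ 2 + h.im ^ 2) * hre -
        (f.re * f.im + g.re * g.im + h.re * h.im) * h2)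
  exact he u v huv

end CircleRing

section SplitPlace

variable {k : Type*} [Field k] [NumberField k] [hk : Fact (¬ IsSumSq (-1 : k))]

/-- Over a formally real number field, the rational function field has a split place. -/
theorem hasSplitPlace_of_polynomial {K : Type*} [Field K] [CharZero K]
    [Algebra (Polynomial k) K] [IsFractionRing (Polynomial k) K] : HasSplitPlace K := by
  let φ : Polynomial k →+* k := Polynomial.constantCoeff
  have hφ : ∀ p, φ p = 0 ↔ Polynomial.X ∣ p := fun p => Polynomial.X_dvd_iff.symm
  have hπ : Prime (Polynomial.X : Polynomial k) := Polynomial.prime_X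
  have hX : φ Polynomial.X = 0 := Polynomial.coeff_X_zero
  set H := evenSub φ K with hH
  have hinj := IsFractionRing.injective (Polynomial k) K
  have hne : ∀ {p : Polynomial k}, φ p ≠ 0 → algebraMap (Polynomial k) K p ≠ 0 :=
    fun {p} hp h0 => hp (by rw [(map_eq_zero_iff _ hinj).1 h0, map_zero])
  have hmem : ∀ {p : Polynomial k}, φ p ≠ 0 → algebraMap (Polynomial k) K p ∈ elems H :=
    fun {p} hp => (mem_elems_evenSub φ (hne hp)).2 ⟨1, one_ne_zero, p, hp, by simp⟩
  have key : ∀ g : Polynomial k, φ g ≠ 0 →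
      algebraMap (Polynomial k) K (1 + Polynomial.X * g) ∈ elems (binGen H) := by
    intro g hg
    have hXg : algebraMap (Polynomial k) K (Polynomial.X * g) ≠ 0 := by
      rw [map_mul]
      exact mul_ne_zero (by simp) (hne hg)
    refine mem_elems_binGen (x := algebraMap (Polynomial k) K (Polynomial.X * g)) (p := 1)
      (q := 1) hXg ?_ (hmem (by simp [hX])) (by simp)
    rw [mem_elems_evenSub φ hXg]
    rintro ⟨z, -, u, hu, h⟩
    exact not_even_and_odd (K := K) hπ hφ (z := z) (z' := 1) one_ne_zero hu hg
      (by rw [← h, map_mul]; ring)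
  have key' : ∀ g : Polynomial k,
      algebraMap (Polynomial k) K (1 + Polynomial.X * g) ∈ elems (binGen H) := by
    intro g
    by_cases hg : φ g = 0
    · have h1 := key (1 + g + Polynomial.X * g) (by simp [hX, hg])
      have h2 := key 1 (by simp)
      have h0 := elems_ne_zero h2
      obtain ⟨u, hu, hu'⟩ := h1
      obtain ⟨v, hv, hv'⟩ := h2
      refine ⟨u * v⁻¹, ?_, ?_⟩
      · rw [Units.val_mul, Units.val_inv_eq_inv_val, hu, hv, ← div_eq_mul_inv,
          div_eq_iff h0, ← map_mul]
        congr 1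
        ring
      · rw [sqCl_mul, sqCl_inv]
        exact mul_mem hu' (inv_mem hv')
    · exact key g hg
  refine ⟨H, isGood_evenSub hπ hφ hk.out exists_not_isSquare, fun x hx => ?_⟩
  obtain ⟨u, rfl⟩ := sqCl_surjective x
  obtain ⟨z, hz, w, hw, h⟩ := (sqCl_mem_evenSub φ).1 hx
  set c := φ w with hc
  obtain ⟨v, hv, hv'⟩ := const_mem_goodInf
    ((algebraMap (Polynomial k) K).comp Polynomial.C) hw
  obtain ⟨t, ht, ht'⟩ := key' (Polynomial.C c⁻¹ * w.divX)
  have hw' : w = Polynomial.C c * (1 + Polynomial.X * (Polynomial.C c⁻¹ * w.divX)) := by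
    have hcc : Polynomial.C c * Polynomial.C c⁻¹ = 1 := by
      rw [← Polynomial.C_mul, mul_inv_cancel₀ hw, Polynomial.C_1]
    have hd : Polynomial.X * w.divX + Polynomial.C c = w := Polynomial.X_mul_divX_add w
    linear_combination -hd - Polynomial.X * w.divX * hcc
  have hu : sqCl u = sqCl (v * t) := by
    rw [eq_comm, sqCl_eq_iff]
    refine ⟨Units.mk0 z hz, Units.ext ?_⟩
    rw [h, hw']
    simp only [Units.val_mul, Units.val_pow_eq_pow_val, Units.val_mk0, hv, ht, map_mul,
      RingHom.comp_apply]
    ring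
  rw [hu, sqCl_mul]
  exact Subgroup.mul_mem_sup hv' ht'

end SplitPlace

namespace CircleRing

open QuadraticAlgebra

/-- A ring homomorphism on a circle ring is an evaluation. -/
theorem map_eq_eval₂ {k S : Type*} [Field k] [CommRing S] {b : k} (f : CircleRing b →+* S)
    (z : CircleRing b) : f z = z.re.eval₂ (f.comp (algebraMap k _)) (f (xc b)) +
      z.im.eval₂ (f.comp (algebraMap k _)) (f (xc b)) * f (yc b) := by
  have h : f.comp (algebraMap (Polynomial k) (CircleRing b)) =
      Polynomial.eval₂RingHom (f.comp (algebraMap k _)) (f (xc b)) := by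
    refine Polynomial.ringHom_ext (fun c => ?_) ?_
    · rw [Polynomial.coe_eval₂RingHom, Polynomial.eval₂_C]
      rfl
    · rw [Polynomial.coe_eval₂RingHom, Polynomial.eval₂_X]
      rfl
  have h' : ∀ p : Polynomial k, f (algebraMap (Polynomial k) (CircleRing b) p) =
      p.eval₂ (f.comp (algebraMap k _)) (f (xc b)) := fun p => RingHom.congr_fun h p
  rw [← h', ← h', ← map_mul, ← map_add]
  congr 1
  ext1 <;> simp [QuadraticAlgebra.algebraMap_eq, yc]

theorem hasSplitPlace_one {k : Type*} [Field k] [NumberField k]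
    [hk : Fact (¬ IsSumSq (-1 : k))] {K : Type*} [Field K] [CharZero K]
    [Algebra (CircleRing (1 : k)) K] [IsFractionRing (CircleRing (1 : k)) K] :
    HasSplitPlace K := by
  let A := CircleRing (1 : k)
  let ι : k →+* K := (algebraMap A K).comp (algebraMap k A)
  set x : K := algebraMap A K (xc 1) with hx
  set y : K := algebraMap A K (yc 1) with hy
  have hinj := IsFractionRing.injective A K
  have hxy : x ^ 2 + y ^ 2 = 1 := by
    rw [hx, hy, ← map_pow, ← map_pow, ← map_add, xc_sq_add_yc_sq]
    exact map_one ι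
  have hmap : ∀ f : A, algebraMap A K f = f.re.eval₂ ι x + f.im.eval₂ ι x * y :=
    map_eq_eval₂ (algebraMap A K)
  have hxtr : ∀ p : Polynomial k, p.eval₂ ι x = 0 → p = 0 := by
    intro p hp
    have h := hmap ⟨p, 0⟩
    rw [hp] at h
    have := (map_eq_zero_iff _ hinj).1 (h.trans (by simp))
    exact congrArg QuadraticAlgebra.re this
  have hx1 : 1 + x ≠ 0 := by
    intro h
    have := hxtr (1 + Polynomial.X) (by simpa using h)
    have := congrArg (Polynomial.eval 0) this
    simp at this
  set t := y / (1 + x) with ht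
  have ht2 : 1 + t ^ 2 = 2 / (1 + x) := by
    rw [ht]
    field_simp
    linear_combination hxy
  have ht0 : 1 + t ^ 2 ≠ 0 := by
    rw [ht2]
    exact div_ne_zero two_ne_zero hx1
  have hxt : x = 2 / (1 + t ^ 2) - 1 := by
    rw [ht2]
    field_simp
    ring
  have hyt : y = t * (1 + x) := by
    rw [ht]
    field_simp
  let _alg : Algebra k K := ι.toAlgebra
  have htr : Transcendental k t := by
    intro halg
    have hxalg : IsAlgebraic k x := by
      rw [hxt]
      have h2 : IsAlgebraic k (2 : K) := by
        exact map_ofNat (algebraMap k K) 2 ▸ isAlgebraic_algebraMap (R := k) (A := K) (2 : k)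
      rw [div_eq_mul_inv]
      refine (h2.mul (IsAlgebraic.inv ?_)).sub isAlgebraic_one
      exact isAlgebraic_one.add (halg.pow 2)
    obtain ⟨p, hp0, hp⟩ := hxalg
    exact hp0 (hxtr p hp)
  let ψ : Polynomial k →+* K := (Polynomial.aeval t).toRingHom
  have hψ : Function.Injective ψ := transcendental_iff_injective.1 htr
  let _algp : Algebra (Polynomial k) K := ψ.toAlgebra
  have : IsFractionRing (Polynomial k) K := by
    have : FaithfulSMul (Polynomial k) K :=
      (faithfulSMul_iff_algebraMap_injective _ _).2 hψ
    let g : FractionRing (Polynomial k) →+* K := IsFractionRing.lift (g := ψ) hψ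
    have hg : ∀ p, g (algebraMap _ _ p) = ψ p := fun p => IsFractionRing.lift_algebraMap hψ p
    have hιg : ∀ c, ι c ∈ g.fieldRange := fun c =>
      ⟨algebraMap _ _ (Polynomial.C c), (hg _).trans (Polynomial.aeval_C t c)⟩
    have htg : t ∈ g.fieldRange :=
      ⟨algebraMap _ _ Polynomial.X, (hg _).trans (Polynomial.aeval_X t)⟩
    have hxg : x ∈ g.fieldRange := by
      rw [hxt]
      exact sub_mem (div_mem (by simp) (add_mem (one_mem _) (pow_mem htg 2)))
        (one_mem _)
    have hyg : y ∈ g.fieldRange := by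
      rw [hyt]
      exact mul_mem htg (add_mem (one_mem _) hxg)
    have hpg : ∀ p : Polynomial k, p.eval₂ ι x ∈ g.fieldRange := fun p => by
      rw [Polynomial.eval₂_eq_sum]
      exact sum_mem fun i _ => mul_mem (hιg _) (pow_mem hxg _)
    have hfg : ∀ f : A, algebraMap A K f ∈ g.fieldRange := fun f => by
      rw [hmap]
      exact add_mem (hpg _) (mul_mem (hpg _) hyg)
    refine IsFractionRing.of_field _ _ fun z => ?_
    obtain ⟨p, q, -, rfl⟩ := IsFractionRing.div_surjective (A := A) z
    obtain ⟨w, hw⟩ := div_mem (hfg p) (hfg q)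
    obtain ⟨u, v, -, rfl⟩ := IsFractionRing.div_surjective (A := Polynomial k) w
    exact ⟨u, v, by rw [← hw, map_div₀, hg, hg]; rfl⟩
  exact hasSplitPlace_of_polynomial (k := k)

end CircleRing

section EvenDegree

theorem exists_root_of_monic_of_odd {q : Polynomial ℝ} (hq : q.Monic) (ho : Odd q.natDegree) :
    ∃ x, q.eval x = 0 := by
  have h1 : 0 < q.natDegree := ho.pos
  have hd : 0 < q.degree := Polynomial.natDegree_pos_iff_degree_pos.1 h1
  have t1 := Polynomial.tendsto_atTop_of_leadingCoeff_nonneg q hd (by rw [hq]; norm_num)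
  set p := -(q.comp (-Polynomial.X)) with hp
  have hnd : p.natDegree = q.natDegree := by
    rw [hp, Polynomial.natDegree_neg, Polynomial.natDegree_comp, Polynomial.natDegree_neg,
      Polynomial.natDegree_X, mul_one]
  have hlc : p.leadingCoeff = 1 := by
    rw [hp, Polynomial.leadingCoeff_neg, Polynomial.leadingCoeff_comp (by simp), hq,
      Polynomial.leadingCoeff_neg, Polynomial.leadingCoeff_X, ho.neg_one_pow]
    norm_num
  have t2 := Polynomial.tendsto_atTop_of_leadingCoeff_nonneg p
    (Polynomial.natDegree_pos_iff_degree_pos.1 (by omega)) (by rw [hlc]; norm_num)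
  obtain ⟨x, hx⟩ := (t1.eventually_ge_atTop 0).exists
  obtain ⟨y, hy⟩ := (t2.eventually_ge_atTop 0).exists
  have hy' : q.eval (-y) ≤ 0 := by
    simpa [hp, Polynomial.eval_comp] using hy
  exact mem_range_of_exists_le_of_exists_ge q.continuous ⟨_, hy'⟩ ⟨_, hx⟩

theorem exists_ne_embedding {k F : Type*} [Field k] [Field F] [NumberField k] [Algebra k F]
    [Module.Finite k F] (he : Even (Module.finrank k F)) (τ : F →+* ℝ) :
    ∃ τ' : F →+* ℝ, τ' ≠ τ ∧
      τ'.comp (algebraMap k F) = τ.comp (algebraMap k F) := by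
  let _alg : Algebra k ℝ := (τ.comp (algebraMap k F)).toAlgebra
  let τ₀ : F →ₐ[k] ℝ := { τ with commutes' := fun _ => rfl }
  let pb := Field.powerBasisOfFiniteOfSeparable k F
  set m := minpoly k pb.gen with hm
  set p := m.map (algebraMap k ℝ) with hp
  have hmonic : p.Monic := (minpoly.monic pb.isIntegral_gen).map _
  have hsep : p.Separable :=
    Polynomial.Separable.map (Algebra.IsSeparable.isSeparable k pb.gen)
  have hdeg : p.natDegree = Module.finrank k F := by
    rw [hp, (minpoly.monic pb.isIntegral_gen).natDegree_map, pb.natDegree_minpoly, pb.finrank]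
  have hroot : p.eval (τ₀ pb.gen) = 0 := by
    rw [hp, Polynomial.eval_map_algebraMap, Polynomial.aeval_algHom_apply, minpoly.aeval, map_zero]
  obtain ⟨q, hq⟩ := Polynomial.dvd_iff_isRoot.2 hroot
  have hqm : q.Monic := (Polynomial.monic_X_sub_C _).of_mul_monic_left (hq ▸ hmonic)
  have hqd : p.natDegree = 1 + q.natDegree := by
    rw [hq, (Polynomial.monic_X_sub_C _).natDegree_mul hqm, Polynomial.natDegree_X_sub_C]
  have hodd : Odd q.natDegree := by
    rw [← hdeg, hqd] at he
    rcases Nat.even_or_odd q.natDegree with h | h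
    · exact absurd he (by rw [Nat.not_even_iff_odd]; exact odd_one.add_even h)
    · exact h
  obtain ⟨ρ, hρ⟩ := exists_root_of_monic_of_odd hqm hodd
  have hρp : Polynomial.aeval ρ (minpoly k pb.gen) = 0 := by
    rw [← Polynomial.eval_map_algebraMap, ← hm, ← hp, hq, Polynomial.eval_mul, hρ, mul_zero]
  have hne : ρ ≠ τ₀ pb.gen := by
    intro h
    rw [h] at hρ
    obtain ⟨s, hs⟩ := Polynomial.dvd_iff_isRoot.2 hρ
    have := hsep.squarefree (Polynomial.X - Polynomial.C (τ₀ pb.gen))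
      ⟨s, by rw [hq, hs, mul_assoc]⟩
    exact Polynomial.not_isUnit_X_sub_C _ this
  refine ⟨(pb.lift ρ hρp).toRingHom, fun h => hne ?_, ?_⟩
  · rw [← pb.lift_gen ρ hρp]
    exact RingHom.congr_fun h pb.gen
  · exact RingHom.ext fun c => (pb.lift ρ hρp).commutes c

theorem exists_forall_not_isSumSq {k F : Type*} [Field k] [NumberField k] [Field F]
    [NumberField F] [Algebra k F] (hF : ¬ IsSumSq (-1 : F)) (he : Even (Module.finrank k F)) :
    ∃ f : F, f ≠ 0 ∧ ∀ c : k, c ≠ 0 → ¬ IsSumSq (algebraMap k F c * f) := by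
  have : Module.Finite k F := Module.Finite.of_restrictScalars_finite ℚ k F
  obtain ⟨τ⟩ := exists_embedding_of_real hF
  obtain ⟨τ', hne, hres⟩ := exists_ne_embedding he τ
  obtain ⟨θ, hθ⟩ : ∃ θ, τ' θ ≠ τ θ := by
    by_contra! h
    exact hne (RingHom.ext h)
  have key : ∀ q : ℚ, (τ θ - q) * (τ' θ - q) < 0 → ∃ f : F, f ≠ 0 ∧
      ∀ c : k, c ≠ 0 → ¬ IsSumSq (algebraMap k F c * f) := by
    intro q hq
    refine ⟨θ - (q : F), ?_, fun c hc hs => ?_⟩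
    · intro h0
      have := congrArg τ h0
      rw [map_sub, map_ratCast, map_zero] at this
      rw [this, zero_mul] at hq
      exact lt_irrefl _ hq
    · have h1 := isSumSq_nonneg τ hs
      have h2 := isSumSq_nonneg τ' hs
      have h3 : τ' (algebraMap k F c) = τ (algebraMap k F c) := RingHom.congr_fun hres c
      rw [map_mul, map_sub, map_ratCast] at h1 h2
      rw [h3] at h2
      have h4 : τ (algebraMap k F c) ≠ 0 := by simpa using hc
      have h5 : 0 < τ (algebraMap k F c) ^ 2 := by positivity
      nlinarith [mul_nonneg h1 h2]
  rcases lt_or_gt_of_ne hθ with h | h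
  · obtain ⟨q, h1, h2⟩ := exists_rat_btwn h
    exact key q (mul_neg_of_pos_of_neg (by linarith) (by linarith))
  · obtain ⟨q, h1, h2⟩ := exists_rat_btwn h
    exact key q (mul_neg_of_neg_of_pos (by linarith) (by linarith))

end EvenDegree

theorem exists_isSumSq_preimage {R S : Type*} [CommRing R] [CommRing S] (f : R →+* S)
    (hf : Function.Surjective f) {s : S} (hs : IsSumSq s) : ∃ r, IsSumSq r ∧ f r = s := by
  induction hs with
  | zero => exact ⟨0, .zero, map_zero f⟩
  | sq_add a _ ih =>
    obtain ⟨r, hr, rfl⟩ := ih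
    obtain ⟨b, rfl⟩ := hf a
    exact ⟨b * b + r, .sq_add b hr, by rw [map_add, map_mul]⟩

theorem exists_of_mem_elems_sup {K : Type*} [Field K] {H G T : Subgroup (SqClass K)}
    (hle : H ≤ G ⊔ T) {z : K} (hz : z ∈ elems H) :
    ∃ g t y : Kˣ, sqCl g ∈ G ∧ sqCl t ∈ T ∧ z = g * t * y ^ 2 := by
  have hT : T.Normal := by
    refine ⟨fun n hn g => ?_⟩
    obtain ⟨g', rfl⟩ := sqCl_surjective g
    obtain ⟨n', rfl⟩ := sqCl_surjective n
    rwa [← sqCl_inv, ← sqCl_mul, ← sqCl_mul, mul_inv_cancel_comm]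
  obtain ⟨w, hwz, hw⟩ := hz
  have h : ∃ g ∈ G, ∃ t ∈ T, g * t = sqCl w :=
    Subgroup.mem_sup_of_normal_right.1 (hle hw)
  obtain ⟨g, hg, t, ht, hgt⟩ := h
  obtain ⟨g', hg'⟩ := sqCl_surjective g
  obtain ⟨t', ht'⟩ := sqCl_surjective t
  rw [← hg', ← ht', ← sqCl_mul, sqCl_eq_iff] at hgt
  obtain ⟨y, hy⟩ := hgt
  rw [← hg'] at hg
  rw [← ht'] at ht
  exact ⟨g', t', y, hg, ht, by rw [← hwz, hy]; simp⟩

namespace CircleRing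

open QuadraticAlgebra

variable {k : Type*} [Field k] [NumberField k] {b : k} [hk : Fact (¬ IsSumSq (-1 : k))]
  [hb : Fact (∀ p q : k, p ^ 2 + q ^ 2 ≠ b)]
variable {K : Type*} [Field K] [Algebra (CircleRing b) K] [IsFractionRing (CircleRing b) K]

omit [IsFractionRing (CircleRing b) K] in
theorem algebraMap_mem_valRing [CharZero K] {H : Subgroup (SqClass K)}
    (hH : IsGood H) (f : CircleRing b) : algebraMap (CircleRing b) K f ∈ hH.valRing := by
  set ι : k →+* K := (algebraMap (CircleRing b) K).comp (algebraMap k _) with hι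
  set x := algebraMap (CircleRing b) K (xc b) with hx
  set y := algebraMap (CircleRing b) K (yc b) with hy
  have hb0 : ι b ≠ 0 := by simpa using b_ne_zero (b := b)
  have hxy : x ^ 2 + y ^ 2 = ι b := by
    rw [hx, hy, ← map_pow, ← map_pow, ← map_add, xc_sq_add_yc_sq]
    rfl
  have hc : ∀ c, ι c ∈ hH.valRing := hH.algebraMap_mem ι
  have hsq : ∀ z : K, z ^ 2 ∈ hH.valRing → z ∈ hH.valRing := by
    intro z hz
    rw [← ValuationSubring.valuation_le_one_iff, map_pow] at hz
    rw [← ValuationSubring.valuation_le_one_iff]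
    exact (pow_le_one_iff two_ne_zero).1 hz
  have hxO : x ∈ hH.valRing := by
    by_contra hxO
    have hx0 : x ≠ 0 := by
      rintro h
      exact hxO (h ▸ zero_mem _)
    have h1 : (-(ι b / x ^ 2))⁻¹ ∉ hH.valRing := by
      intro h
      apply hxO
      apply hsq
      have := mul_mem (neg_mem h) (hc b)
      convert! this using 1
      field_simp
    have h2 := hH.not_isSumSq (hH.one_add_mem h1)
    apply h2
    have : -(1 + -(ι b / x ^ 2)) = (y / x) ^ 2 := by
      field_simp
      linear_combination -hxy
    rw [this]
    exact isSumSq_sq _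
  have hyO : y ∈ hH.valRing := by
    apply hsq
    rw [show y ^ 2 = ι b - x ^ 2 by linear_combination hxy]
    exact sub_mem (hc b) (pow_mem hxO 2)
  have hpO : ∀ p : Polynomial k, p.eval₂ ι x ∈ hH.valRing := fun p => by
    rw [Polynomial.eval₂_eq_sum]
    exact sum_mem fun i _ => mul_mem (hc _) (pow_mem hxO _)
  rw [map_eq_eval₂]
  exact add_mem (hpO _) (mul_mem (hpO _) hyO)

/-- A good subgroup comes from a prime of the circle ring with real residue field. -/
theorem exists_realPrime_of_isGood [CharZero K] {H : Subgroup (SqClass K)} (hH : IsGood H) :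
    ∃ (π : CircleRing b) (hπ : RealPrime π),
      letI := resField hπ.1
      H = evenSub (Ideal.Quotient.mk (Ideal.span {π})) K := by
  let A := CircleRing b
  let j : A →+* hH.valRing :=
    (algebraMap A K).codRestrict hH.valRing.toSubring (algebraMap_mem_valRing hH)
  have hinj := IsFractionRing.injective A K
  let P := (IsLocalRing.maximalIdeal hH.valRing).comap j
  have hPmem : ∀ f, f ∉ P → (algebraMap A K f)⁻¹ ∈ hH.valRing := by
    intro f hf
    rw [Ideal.mem_comap, IsLocalRing.mem_maximalIdeal, mem_nonunits_iff, not_not] at hf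
    obtain ⟨w, hw⟩ := hf.exists_right_inv
    have hw' : algebraMap A K f * w = 1 := congrArg Subtype.val hw
    rw [inv_eq_of_mul_eq_one_right hw']
    exact w.2
  have hPmem' : ∀ f ≠ 0, f ∈ P → (algebraMap A K f)⁻¹ ∉ hH.valRing := by
    intro f hf0 hf h
    rw [Ideal.mem_comap, IsLocalRing.mem_maximalIdeal, mem_nonunits_iff] at hf
    refine hf (IsUnit.of_mul_eq_one ⟨_, h⟩ (Subtype.ext ?_))
    have h0 : algebraMap A K f ≠ 0 := by rwa [Ne, map_eq_zero_iff _ hinj]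
    exact mul_inv_cancel₀ h0
  have hunit : ∀ f, f ∉ P → algebraMap A K f ∈ elems H := by
    intro f hf
    refine hH.rigidPair.mem_H_of_unit ?_ (algebraMap_mem_valRing hH f) (hPmem f hf)
    intro h0
    rw [map_eq_zero_iff _ hinj] at h0
    exact hf (h0 ▸ zero_mem _)
  have htop : ¬ ∀ f : A, f ≠ 0 → algebraMap A K f ∈ elems H := by
    intro h
    apply hH.ne_top
    rw [eq_top_iff]
    rintro z -
    obtain ⟨u, rfl⟩ := sqCl_surjective z
    obtain ⟨p, q, hq, hpq⟩ := IsFractionRing.div_surjective (A := A) (u : K)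
    have hq0 := nonZeroDivisors.ne_zero hq
    have hqK : algebraMap A K q ≠ 0 := by simpa using hq0
    have hp0 : p ≠ 0 := by
      rintro rfl
      rw [map_zero, zero_div] at hpq
      exact u.ne_zero hpq.symm
    rw [← coe_mem_elems, ← hpq]
    convert! elems_mul (elems_mul (h p hp0) (h q hq0)) (elems_sq H (inv_ne_zero hqK)) using 1
    field_simp
  obtain ⟨π, hPπ⟩ := IsPrincipalIdealRing.principal P
  rw [Ideal.submodule_span_eq] at hPπ
  have hπ0 : π ≠ 0 := by
    rintro rfl
    refine htop fun f hf => hunit f ?_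
    rw [hPπ]
    simpa using hf
  have hPprime : P.IsPrime := Ideal.IsPrime.comap j
  have hπ : Prime π := by
    rw [hPπ] at hPprime
    exact (Ideal.span_singleton_prime hπ0).1 hPprime
  have hdvd : ∀ f, f ∈ P ↔ π ∣ f := fun f => by rw [hPπ, Ideal.mem_span_singleton]
  have hreal : RealPrime π := by
    refine ⟨hπ, fun hs => ?_⟩
    obtain ⟨r, hr, hr'⟩ := exists_isSumSq_preimage _ Ideal.Quotient.mk_surjective hs
    have hrP : -(1 + r) ∈ P := by
      rw [hdvd, ← mk_eq_zero_iff]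
      simp [hr']
    have h1 : algebraMap A K (-r) ∈ elems (binGen H) := by
      by_cases h0 : -(1 + r) = 0
      · rw [show -r = 1 by linear_combination h0, map_one]
        exact ⟨1, rfl, by rw [sqCl_one]; exact one_mem _⟩
      · have := hH.one_add_mem (hPmem' _ h0 hrP)
        rwa [← map_one (algebraMap A K), ← map_add,
          show 1 + -(1 + r) = -r by ring] at this
    apply hH.not_isSumSq h1
    rw [← map_neg, neg_neg]
    exact isSumSq_map _ hr
  refine ⟨π, hreal, ?_⟩
  let _inst := resField hreal.1
  set φ := Ideal.Quotient.mk (Ideal.span {π}) with hφd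
  have hφ := mk_eq_zero_iff π
  have hle : evenSub φ K ≤ H := by
    intro z hz
    obtain ⟨u, rfl⟩ := sqCl_surjective z
    obtain ⟨w, hw, v, hv, h⟩ := (sqCl_mem_evenSub φ).1 hz
    rw [← coe_mem_elems, h, sq]
    refine elems_mul (elems_sq H hw) (hunit v ?_)
    rwa [hdvd, ← mk_eq_zero_iff]
  refine le_antisymm (fun z hz => ?_) hle
  by_contra hzn
  apply hH.ne_top
  rw [eq_top_iff]
  rintro z' -
  by_contra hz'
  have hgood : IsGood (evenSub φ K) := hreal.isGood
  have := hgood.mul_mem_of_notMem z z' hzn (fun h => hz' (hle h))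
  exact hz' ((Subgroup.mul_mem_cancel_left H hz).1 (hle this))

/-- The residue field at a real prime contains classes which are not products of constants and
sums of squares. -/
theorem RealPrime.exists_not_isSumSq {π : CircleRing b} (hπ : RealPrime π) :
    ∃ u : CircleRing b, ¬ π ∣ u ∧ ∀ c : k, c ≠ 0 →
      ¬ IsSumSq (Ideal.Quotient.mk (Ideal.span {π}) (algebraMap k _ c * u)) := by
  have hfin : Module.finrank k (CircleRing b ⧸ Ideal.span {π}) = 2 * dg π :=
    finrank_quotient hπ.1.ne_zero
  have hnum := numberField_resField hπ.1
  let _inst := resField hπ.1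
  obtain ⟨f, hf0, hf⟩ := exists_forall_not_isSumSq (k := k) hπ.2
    (by rw [hfin]; exact even_two_mul _)
  obtain ⟨u, rfl⟩ := Ideal.Quotient.mk_surjective f
  refine ⟨u, fun h => hf0 ((mk_eq_zero_iff π u).2 h), fun c hc hs => hf c hc ?_⟩
  rwa [map_mul] at hs

/-- The function field of a circle without rational points has no split place. -/
theorem not_hasSplitPlace {k : Type*} [Field k] [NumberField k] (b : k)
    [hk : Fact (¬ IsSumSq (-1 : k))] [hb : Fact (∀ p q : k, p ^ 2 + q ^ 2 ≠ b)]
    {K : Type*} [Field K] [Algebra (CircleRing b) K] [IsFractionRing (CircleRing b) K]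
    [CharZero K] : ¬ HasSplitPlace K := by
  rintro ⟨H, hH, hle⟩
  obtain ⟨π, hπ, hHπ⟩ := exists_realPrime_of_isGood (b := b) hH
  have hK : ¬ IsSumSq (-1 : K) := by
    refine hH.not_isSumSq (z := 1) ⟨1, rfl, ?_⟩
    rw [sqCl_one]
    exact one_mem _
  let _inst := resField hπ.1
  set φ := Ideal.Quotient.mk (Ideal.span {π}) with hφd
  have hφ := mk_eq_zero_iff π
  have hinj := IsFractionRing.injective (CircleRing b) K
  obtain ⟨u, hu0, hf⟩ := hπ.exists_not_isSumSq
  rw [← mk_eq_zero_iff] at hu0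
  have huK : algebraMap (CircleRing b) K u ≠ 0 := by
    rw [Ne, map_eq_zero_iff _ hinj]
    rintro rfl
    exact hu0 (map_zero _)
  have hu : algebraMap (CircleRing b) K u ∈ elems H := by
    rw [hHπ, mem_elems_evenSub φ huK]
    exact ⟨1, one_ne_zero, u, hu0, by simp⟩
  obtain ⟨g, t, y, hg, ht, hy⟩ := exists_of_mem_elems_sup hle hu
  obtain ⟨c, hc, hcs⟩ := constSumSq_of_evenReal' (b := b) hK g.ne_zero
    (evenReal_of_mem_goodInf hg)
  have hcK := algebraMap_const_ne_zero (b := b) (K := K) hc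
  obtain ⟨z₁, hz₁, u₁, hu₁, hs₁, h₁⟩ := residue_isSumSq (K := K) hπ.1 hφ hπ.2 hcs
    (mul_ne_zero hcK g.ne_zero)
  rw [hHπ] at ht
  obtain ⟨z₂, hz₂, u₂, hu₂, hs₂, h₂⟩ := sqAt_of_mem_binGen hπ.1 hφ ht
  have hprod : (y * z₁ * z₂) ^ 2 * algebraMap (CircleRing b) K (u₁ * u₂) =
      1 ^ 2 * algebraMap (CircleRing b) K (algebraMap k _ c * u) := by
    rw [map_mul, map_mul, hy, h₂]
    linear_combination -(y : K) ^ 2 * z₂ ^ 2 * algebraMap (CircleRing b) K u₂ * h₁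
  obtain ⟨e, he, heq⟩ := residue_unique (K := K) hπ.1 hφ one_ne_zero
    (by rw [map_mul]; exact mul_ne_zero hu₁ hu₂)
    (by
      rw [map_mul]
      refine mul_ne_zero ?_ hu0
      exact (map_ne_zero (φ.comp (algebraMap k _))).2 hc) hprod
  apply hf c hc
  rw [heq, map_mul]
  obtain ⟨r, hr⟩ := hs₂
  rw [hr]
  exact (isSumSq_sq e).mul (hs₁.mul (.mul_self r))

end CircleRing

section Model

variable {k : Type*} [Field k] {a b : k}

theorem mk_sq_add_sq (hab : a * b = 1) :
    (Ideal.Quotient.mk (Ideal.span {conicPoly k a a}) (X 0)) ^ 2 +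
      (Ideal.Quotient.mk (Ideal.span {conicPoly k a a}) (X 1)) ^ 2 =
      algebraMap k (ConicRing k a a) b := by
  have h : Ideal.Quotient.mk (Ideal.span {conicPoly k a a}) (conicPoly k a a) = 0 :=
    Ideal.Quotient.eq_zero_iff_mem.2 (Ideal.mem_span_singleton_self _)
  have hC : ∀ c : k, Ideal.Quotient.mk (Ideal.span {conicPoly k a a}) (C c) =
      algebraMap k (ConicRing k a a) c := fun _ => rfl
  have hab' : algebraMap k (ConicRing k a a) a * algebraMap k (ConicRing k a a) b = 1 := by
    rw [← map_mul, hab, map_one]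
  have key : ∀ q : MvPolynomial (Fin 2) k →+* ConicRing k a a, q (conicPoly k a a) = 0 →
      q (C a) * q (X 0) ^ 2 + q (C a) * q (X 1) ^ 2 - 1 = 0 := fun q hq => by
    simpa [conicPoly] using hq
  replace h := key _ h
  rw [hC] at h
  linear_combination algebraMap k (ConicRing k a a) b * h -
    (Ideal.Quotient.mk (Ideal.span {conicPoly k a a}) (X 0) ^ 2 +
      Ideal.Quotient.mk (Ideal.span {conicPoly k a a}) (X 1) ^ 2) * hab'

/-- The map from the circle ring to the coordinate ring of the conic. -/
def toConicRing (hab : a * b = 1) : CircleRing b →+* ConicRing k a a :=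
  CircleRing.evalHom (algebraMap k _) _ _ (mk_sq_add_sq hab)

theorem toConicRing_bijective (hab : a * b = 1) : Function.Bijective (toConicRing hab) := by
  let e : MvPolynomial (Fin 2) k →+* CircleRing b :=
    eval₂Hom (algebraMap k _) ![CircleRing.xc b, CircleRing.yc b]
  have eC : ∀ c, e (C c) = algebraMap k _ c := fun c => eval₂Hom_C _ _ c
  have e0 : e (X 0) = CircleRing.xc b := eval₂Hom_X' _ _ _
  have e1 : e (X 1) = CircleRing.yc b := eval₂Hom_X' _ _ _
  have he : e (conicPoly k a a) = 0 := by
    have h := CircleRing.xc_sq_add_yc_sq (b := b)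
    have hab' : algebraMap k (CircleRing b) a * algebraMap k (CircleRing b) b = 1 := by
      rw [← map_mul, hab, map_one]
    rw [conicPoly, map_sub, map_add, map_mul, map_mul, map_pow, map_pow, map_one, eC, e0, e1]
    linear_combination algebraMap k (CircleRing b) a * h + hab'
  let g : ConicRing k a a →+* CircleRing b :=
    Ideal.Quotient.lift (Ideal.span {conicPoly k a a}) e (fun z hz => by
      obtain ⟨w, rfl⟩ := Ideal.mem_span_singleton.1 hz
      rw [map_mul, he, zero_mul])
  have gC : ∀ c, g (algebraMap k _ c) = algebraMap k _ c := eC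
  have hx : toConicRing hab (CircleRing.xc b) = Ideal.Quotient.mk _ (X 0) :=
    CircleRing.evalHom_xc ..
  have hy : toConicRing hab (CircleRing.yc b) = Ideal.Quotient.mk _ (X 1) :=
    CircleRing.evalHom_yc ..
  have hc : ∀ c, toConicRing hab (algebraMap k _ c) = algebraMap k _ c := fun c =>
    CircleRing.evalHom_algebraMap ..
  constructor
  · refine Function.LeftInverse.injective (g := g) fun z => ?_
    have h1 := CircleRing.map_eq_eval₂ (g.comp (toConicRing hab)) z
    have h2 := CircleRing.map_eq_eval₂ (RingHom.id (CircleRing b)) z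
    have hcomp : (g.comp (toConicRing hab)).comp (algebraMap k (CircleRing b)) =
        (RingHom.id (CircleRing b)).comp (algebraMap k (CircleRing b)) :=
      RingHom.ext fun c => by simp only [RingHom.comp_apply, hc, gC, RingHom.id_apply]
    have hgx : (g.comp (toConicRing hab)) (CircleRing.xc b) = CircleRing.xc b := by
      rw [RingHom.comp_apply, hx]
      exact e0
    have hgy : (g.comp (toConicRing hab)) (CircleRing.yc b) = CircleRing.yc b := by
      rw [RingHom.comp_apply, hy]
      exact e1
    rw [hcomp, hgx, hgy] at h1
    exact h1.trans h2.symm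
  · refine Function.RightInverse.surjective (g := g) fun z => ?_
    suffices h : (toConicRing hab).comp g = RingHom.id _ from RingHom.congr_fun h z
    refine Ideal.Quotient.ringHom_ext (MvPolynomial.ringHom_ext (fun c => ?_) fun i => ?_)
    · exact (congrArg _ (eC c)).trans (hc c)
    · fin_cases i
      · exact (congrArg _ e0).trans hx
      · exact (congrArg _ e1).trans hy

theorem exists_isFractionRing [Fact (¬ IsSumSq (-1 : k))] (hab : a * b = 1) {K : Type*} [Field K]
    {ι : k →+* K} (h : IsConicFunctionField k a a K ι) :
    ∃ _ : Algebra (CircleRing b) K, IsFractionRing (CircleRing b) K := by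
  obtain ⟨f, hf, -, hz⟩ := h
  have hb := toConicRing_bijective hab
  refine ⟨(f.comp (toConicRing hab)).toAlgebra, ?_⟩
  let _alg := (f.comp (toConicRing hab)).toAlgebra
  have : FaithfulSMul (CircleRing b) K :=
    (faithfulSMul_iff_algebraMap_injective _ _).2 (hf.comp hb.1)
  refine IsFractionRing.of_field _ _ fun z => ?_
  obtain ⟨p, q, -, rfl⟩ := hz z
  obtain ⟨p, rfl⟩ := hb.2 p
  obtain ⟨q, rfl⟩ := hb.2 q
  exact ⟨p, q, rfl⟩

end Model

section Types

/-- The fields of type `n`; a field has at most one type, which is a Witt invariant. -/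
def HasWittType (K : Type*) [Field K] : ℕ → Prop
  | 0 => IsSumSq (-1 : K) ∧ ∃ x y : K, x ^ 2 + y ^ 2 = -1
  | 1 => IsSumSq (-1 : K) ∧ ¬ ∃ x y : K, x ^ 2 + y ^ 2 = -1
  | 2 => ¬ IsSumSq (-1 : K) ∧ HasSplitPlace K
  | n + 3 => ¬ IsSumSq (-1 : K) ∧ ¬ HasSplitPlace K ∧ IsGreatest {m | HasIndep K m} (n + 1)

theorem HasWittType.unique {K : Type*} [Field K] : ∀ {m n : ℕ}, HasWittType K m →
    HasWittType K n → m = n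
  | 0, 0, _, _ | 1, 1, _, _ | 2, 2, _, _ => rfl
  | 0, 1, h, h' => absurd h.2 h'.2
  | 1, 0, h, h' => absurd h'.2 h.2
  | 0, 2, h, h' | 0, _ + 3, h, h' | 1, 2, h, h' | 1, _ + 3, h, h' => absurd h.1 h'.1
  | 2, 0, h, h' | _ + 3, 0, h, h' | 2, 1, h, h' | _ + 3, 1, h, h' => absurd h'.1 h.1
  | 2, _ + 3, h, h' => absurd h.2 h'.2.1
  | _ + 3, 2, h, h' => absurd h'.2 h.2.1
  | _ + 3, _ + 3, h, h' => congrArg (· + 2) (h.2.2.unique h'.2.2)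

variable {K L : Type*} [Field K] [Field L] {α : SqClass K ≃* SqClass L}

theorem isSumSq_neg_one_iff (hα : IsWittEquiv α) :
    IsSumSq (-1 : L) ↔ IsSumSq (-1 : K) := by
  have h1 := ssq_iff (-1 : Kˣ)
  have h2 := ssq_iff (-1 : Lˣ)
  rw [← hα.map_neg_one, hα.ssq_iff, h1] at h2
  simpa using h2.symm

theorem repCl_neg_one_iff : RepCl (1 : SqClass K) 1 (sqCl (-1)) ↔
    ∃ x y : K, x ^ 2 + y ^ 2 = -1 := by
  rw [← sqCl_one, repCl_iff]
  simp [eq_comm]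

theorem exists_sq_add_sq_iff (hα : IsWittEquiv α) :
    (∃ x y : L, x ^ 2 + y ^ 2 = -1) ↔ ∃ x y : K, x ^ 2 + y ^ 2 = -1 := by
  rw [← repCl_neg_one_iff, ← repCl_neg_one_iff, ← hα.map_neg_one, ← map_one α, hα.repCl]

theorem _root_.IsWittEquiv.hasWittType (hα : IsWittEquiv α) :
    ∀ {n : ℕ}, HasWittType K n → HasWittType L n
  | 0, h => ⟨(isSumSq_neg_one_iff hα).2 h.1, (exists_sq_add_sq_iff hα).2 h.2⟩
  | 1, h => ⟨(isSumSq_neg_one_iff hα).2 h.1, mt (exists_sq_add_sq_iff hα).1 h.2⟩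
  | 2, h => ⟨mt (isSumSq_neg_one_iff hα).1 h.1, hα.hasSplitPlace h.2⟩
  | _ + 3, h => ⟨mt (isSumSq_neg_one_iff hα).1 h.1, mt hα.symm.hasSplitPlace h.2.1,
      hα.hasIndep h.2.2.1, fun _ hm => h.2.2.2 (hα.symm.hasIndep hm)⟩

end Types

section Existence

variable {k : Type*} [Field k] [NumberField k]

theorem exists_card_pos (hk : ¬ IsSumSq (-1 : k)) {m : ℕ} (hm : m ≤ Nat.card (k →+* ℝ)) :
    ∃ a : k, a ≠ 0 ∧ (∀ u v : k, u ^ 2 + v ^ 2 ≠ a) ∧ Nat.card {σ : k →+* ℝ // 0 < σ a} = m := by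
  rcases hm.eq_or_lt with rfl | hlt
  · obtain ⟨c, hc, hc'⟩ := exists_totally_positive hk
    refine ⟨c, ?_, hc', Nat.card_congr (Equiv.subtypeUnivEquiv hc)⟩
    rintro rfl
    exact hc' 0 0 (by ring)
  · obtain ⟨T, -, hT⟩ := Set.exists_subset_card_eq (s := (Set.univ : Set (k →+* ℝ))) (n := m)
      (by rwa [Set.ncard_univ])
    obtain ⟨a, ha0, ha⟩ := exists_signs Tᶜ
    have hpos : ∀ σ : k →+* ℝ, 0 < σ a ↔ σ ∈ T := fun σ =>
      ⟨fun h => by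
        by_contra hσ
        exact lt_asymm h ((ha σ).1 hσ), fun h => (ha σ).2 (by simpa using h)⟩
    refine ⟨a, ha0, ?_, ?_⟩
    · rintro u v rfl
      have : T = Set.univ := Set.eq_univ_of_forall fun σ => by
        rw [← hpos, map_add, map_pow, map_pow]
        refine lt_of_le_of_ne (by positivity) fun h => ?_
        apply ha0
        apply σ.injective
        rw [map_add, map_pow, map_pow, ← h, map_zero]
      rw [this, Set.ncard_univ] at hT
      omega
    · rw [← hT, ← Nat.card_coe_set_eq]
      exact Nat.card_congr (Equiv.subtypeEquivRight hpos)

theorem exists_hasWittType (hk : ¬ IsSumSq (-1 : k)) {n : ℕ}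
    (hn : n < Nat.card (k →+* ℝ) + 3) : ∃ a : k, a ≠ 0 ∧
      ∀ (K : Type*) [Field K] (ι : k →+* K), IsConicFunctionField k a a K ι → HasWittType K n := by
  have hkF : Fact (¬ IsSumSq (-1 : k)) := ⟨hk⟩
  match n with
  | 0 =>
    refine ⟨-1, by simp, fun K _ ι h => ?_⟩
    obtain ⟨_, _⟩ := exists_isFractionRing (b := -1) (by norm_num) h
    have hxy := congrArg (algebraMap (CircleRing (-1 : k)) K)
      (CircleRing.xc_sq_add_yc_sq (b := (-1 : k)))
    simp only [map_add, map_pow, map_neg, map_one] at hxy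
    exact ⟨hxy ▸ (isSumSq_sq _).add (isSumSq_sq _), _, _, hxy⟩
  | 1 =>
    obtain ⟨c, hc, hc'⟩ := exists_totally_positive hk
    have hc0 : c ≠ 0 := by
      rintro rfl
      exact hc' 0 0 (by ring)
    refine ⟨-c, by simpa, fun K _ ι h => ?_⟩
    obtain ⟨_, _⟩ := exists_isFractionRing (b := -c⁻¹) (by field_simp) h
    constructor
    · have := CircleRing.isSumSq_of_pos (b := -c⁻¹) (K := K) (by simpa) (c := -1) (fun σ hσ => by
        rw [map_neg, map_inv₀] at hσ
        have := inv_pos.2 (hc σ)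
        linarith)
      simpa using this
    · rintro ⟨x, y, hxy⟩
      refine CircleRing.neg_one_ne_sq_add_sq (b := -c⁻¹) (fun u v huv => ?_) x y hxy
      apply hc' (c * u) (c * v)
      rw [neg_neg] at huv
      field_simp at huv
      linear_combination c * huv
  | 2 =>
    refine ⟨1, one_ne_zero, fun K _ ι h => ?_⟩
    obtain ⟨_, _⟩ := exists_isFractionRing (b := 1) (by norm_num) h
    have := charZero_of_injective_ringHom ι.injective
    obtain ⟨σ⟩ := exists_embedding_of_real hk
    exact ⟨CircleRing.real_of_pos (b := 1) σ (by simp), CircleRing.hasSplitPlace_one (k := k)⟩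
  | j + 3 =>
    obtain ⟨a, ha, ha', hcard⟩ := exists_card_pos hk (m := j + 1) (by omega)
    refine ⟨a, ha, fun K _ ι h => ?_⟩
    obtain ⟨_, _⟩ := exists_isFractionRing (b := a⁻¹) (mul_inv_cancel₀ ha) h
    have := charZero_of_injective_ringHom ι.injective
    have hbF : Fact (∀ p q : k, p ^ 2 + q ^ 2 ≠ a⁻¹) := ⟨fun p q hpq => by
      apply ha' (a * p) (a * q)
      field_simp at hpq
      linear_combination a * hpq⟩
    have hcard' : Nat.card {σ : k →+* ℝ // 0 < σ a⁻¹} = j + 1 := by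
      rw [← hcard]
      exact Nat.card_congr (Equiv.subtypeEquivRight fun σ => by rw [map_inv₀, inv_pos])
    have hne : Nonempty {σ : k →+* ℝ // 0 < σ a⁻¹} :=
      (Nat.card_pos_iff.1 (by omega)).1
    obtain ⟨σ, hσ⟩ := hne
    have hK : ¬ IsSumSq (-1 : K) := CircleRing.real_of_pos (b := a⁻¹) σ hσ
    refine ⟨hK, CircleRing.not_hasSplitPlace a⁻¹, ?_, fun m hm => ?_⟩
    · rw [← hcard']
      exact CircleRing.hasIndep_card
    · rw [← hcard']
      exact CircleRing.le_card_of_hasIndep hK hm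

end Existence

end ConicWitt

/-- Let `k` be a formally real number field with exactly `r` orderings.  Then there are
`r + 3` pairs `(aᵢ, bᵢ)` of nonzero elements of `k` such that the function fields
`k_{aᵢ,bᵢ}` are pairwise not Witt equivalent. -/
theorem exists_r_add_three_conics_not_wittEquivalent
    (k : Type u) [Field k] [NumberField k]
    (hreal : ¬ IsSumSq (-1 : k))
    (r : ℕ) (hr : Nat.card {P : Set k // IsOrdering P} = r) :
    ∃ a b : Fin (r + 3) → k,
      (∀ i, a i ≠ 0 ∧ b i ≠ 0) ∧
      ∀ i j, i ≠ j → ConicNotWittEquivalent k (a i) (b i) (a j) (b j) := by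
  rw [ConicWitt.card_orderings] at hr
  choose a ha0 ha using fun i : Fin (r + 3) =>
    ConicWitt.exists_hasWittType.{u, u} hreal (n := i) (by rw [hr]; exact i.2)
  refine ⟨a, a, fun i => ⟨ha0 i, ha0 i⟩, fun i j hij K L _ _ ι ι' hK hL => ?_⟩
  rintro ⟨α, hα⟩
  exact hij (Fin.ext ((hα.hasWittType (ha i K ι hK)).unique (ha j L ι' hL)))

end
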